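/- For each infinite cardinal κ, the set of κ-avoidable polynomials over ℚ is computable. That is, fixing an infinite cardinal κ, there is a total computable (decidable) predicate on (k,n)-ary polynomials over ℚ (for all k ≥ 2, n ≥ 1) which holds of p exactly when p is κ-avoidable. -/

import Mathlib

/-- Codes for polynomials over `ℚ`: a list of monomials, each given by a rational
coefficient together with a list of exponents. -/
abbrev PolyCode : Type := List (ℚ × List ℕ)

/-- Decoding a code into a `(k,n)`-ary polynomial over `ℚ`: the variable `x_{i,j}`
(`i < k`, `j < n`) gets the exponent stored at position `i * n + j` of the exponent
list.  Every `(k,n)`-ary polynomial over `ℚ` is `decodePoly k n c` for some code `c`,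
so this is a natural computable encoding of such polynomials. -/
noncomputable def decodePoly (k n : ℕ) (c : PolyCode) : MvPolynomial (Fin k × Fin n) ℚ :=
  (c.map fun e =>
    (MvPolynomial.C e.1 : MvPolynomial (Fin k × Fin n) ℚ) *
      ∏ v : Fin k × Fin n, MvPolynomial.X v ^ (e.2.getD (v.1.1 * n + v.2.1) 0)).sum

open Cardinal

/-- `p` is `κ`-avoidable: `ℝ^n` can be colored with at most `κ` colors so that whenever
`a₀,…,a_{k-1} ∈ ℝ^n` are pairwise distinct and `p(a₀,…,a_{k-1}) = 0`, some two of the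
`aᵢ` receive different colors. -/
def Avoidable (κ : Cardinal.{0}) {k n : ℕ} (p : MvPolynomial (Fin k × Fin n) ℚ) : Prop :=
  ∃ (C : Type) (φ : (Fin n → ℝ) → C), #C ≤ κ ∧
    ∀ a : Fin k → (Fin n → ℝ), Function.Injective a →
      MvPolynomial.aeval (fun v : Fin k × Fin n => a v.1 v.2) p = (0 : ℝ) →
      ∃ i j : Fin k, φ (a i) ≠ φ (a j)

section MaximalSemirealFields

open Polynomial

/-- A maximal formally real algebraic extension. -/
structure MaximalSemireal {F Ω : Type*} [Field F] [Field Ω] [Algebra F Ω]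
    (M : IntermediateField F Ω) : Prop where
  not_isSumSq : ¬ IsSumSq (-1 : M)
  maximal : ∀ E : IntermediateField F Ω, ¬ IsSumSq (-1 : E) → M ≤ E → E = M

theorem exists_maximalSemireal {F Ω : Type*} [Field F] [Field Ω] [Algebra F Ω]
    (hF : ¬ IsSumSq (-1 : F)) : ∃ M : IntermediateField F Ω, MaximalSemireal M := by
  have transfer : ∀ (E : IntermediateField F Ω) (s : E), IsSumSq s →
      ∀ E' : IntermediateField F Ω, ∀ h : E ≤ E', IsSumSq (⟨s, h s.2⟩ : E') := by
    intro E s hs E' h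
    induction hs with
    | zero => exact IsSumSq.zero
    | sq_add a hs ih => exact IsSumSq.sq_add (⟨a, h a.2⟩ : E') ih
  obtain ⟨M, -, hM⟩ := zorn_le_nonempty₀ {E : IntermediateField F Ω | ¬ IsSumSq (-1 : E)}
    (by
      intro c hc hchain E₀ hE₀
      refine ⟨sSup c, ?_, fun E hE => le_sSup hE⟩
      have hdir : DirectedOn (· ≤ ·) c := hchain.directedOn
      have key : ∀ s : (sSup c : IntermediateField F Ω), IsSumSq s →
          ∃ E ∈ c, ∃ s' : E, IsSumSq s' ∧ (s' : Ω) = s := by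
        intro s hs
        induction hs with
        | zero => exact ⟨E₀, hE₀, 0, IsSumSq.zero, rfl⟩
        | sq_add a hs ih =>
          obtain ⟨E, hE, s', hs', e⟩ := ih
          have hmem : ∀ x ∈ (sSup c : IntermediateField F Ω), ∃ E ∈ c, x ∈ E := by
            intro x hx
            rw [sSup_eq_iSup', ← SetLike.mem_coe,
              @IntermediateField.coe_iSup_of_directed _ _ _ _ _ _ _ ⟨⟨E₀, hE₀⟩⟩
                (directedOn_iff_directed.1 hdir)] at hx
            obtain ⟨⟨E1, hE1⟩, ha1⟩ := Set.mem_iUnion.1 hx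
            exact ⟨E1, hE1, ha1⟩
          obtain ⟨E1, hE1, ha1⟩ := hmem a a.2
          obtain ⟨E2, hE2, h1, h2⟩ := hdir E hE E1 hE1
          exact ⟨E2, hE2, _, IsSumSq.sq_add (⟨a, h2 ha1⟩ : E2) (transfer E s' hs' E2 h1),
            by simp [e]⟩
      intro h
      obtain ⟨E, hE, s', hs', e⟩ := key _ h
      have : s' = -1 := Subtype.ext (by simpa using e)
      exact hc hE (this ▸ hs'))
    ⊥ (by
      intro h
      have key : ∀ s : (⊥ : IntermediateField F Ω), IsSumSq s →
          ∃ s' : F, IsSumSq s' ∧ algebraMap F Ω s' = s := by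
        intro s hs
        induction hs with
        | zero => exact ⟨0, IsSumSq.zero, by simp⟩
        | sq_add a hs ih =>
          obtain ⟨s', hs', e⟩ := ih
          obtain ⟨a', ha'⟩ := IntermediateField.mem_bot.1 a.2
          exact ⟨a' * a' + s', IsSumSq.sq_add _ hs', by simp [e, ha']⟩
      obtain ⟨s', hs', e⟩ := key _ h
      have : s' = -1 := (algebraMap F Ω).injective (by simpa using e)
      exact hF (this ▸ hs'))
  exact ⟨M, hM.prop, fun E hE hle => le_antisymm (hM.le_of_ge hE hle) hle⟩

namespace MaximalSemireal

variable {F Ω : Type*} [Field F] [Field Ω] [Algebra F Ω] {M : IntermediateField F Ω}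

theorem isSumSq_adjoin (hM : MaximalSemireal M) {α : Ω} (hα : α ∉ M) :
    IsSumSq (-1 : IntermediateField.adjoin M {α}) := by
  by_contra h
  have := hM.maximal ((IntermediateField.adjoin M {α}).restrictScalars F) h
    (fun x hx => (IntermediateField.adjoin M {α}).algebraMap_mem ⟨x, hx⟩)
  apply hα
  rw [← this]
  exact IntermediateField.mem_adjoin_simple_self M α

theorem exists_neg_one_eq [IsAlgClosed Ω] (hM : MaximalSemireal M) {a : M}
    (hsq : ¬ IsSquare a) : ∃ u v : M, IsSumSq u ∧ IsSumSq v ∧ -1 = u + a * v := by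
  obtain ⟨α, hα⟩ := IsAlgClosed.exists_pow_nat_eq (a : Ω) (n := 2) (by norm_num)
  have hαM : α ∉ M := fun h => hsq ⟨⟨α, h⟩, Subtype.ext (by simp [← hα, sq])⟩
  have hdec : ∀ y ∈ IntermediateField.adjoin M {α}, ∃ u v : M, y = u + v * α := by
    have h_integral : IsIntegral M α := ⟨X ^ 2 - C a, monic_X_pow_sub_C _ (by norm_num), by
      simp [hα]⟩
    intro y hy
    rw [← IntermediateField.mem_toSubalgebra,
      IntermediateField.adjoin_simple_toSubalgebra_of_isAlgebraic h_integral.isAlgebraic,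
      Algebra.adjoin_singleton_eq_range_aeval] at hy
    obtain ⟨g, rfl⟩ := hy
    have hmon : (X ^ 2 - C a : M[X]).Monic := monic_X_pow_sub_C _ (by norm_num)
    have hmod := Polynomial.modByMonic_add_div g (X ^ 2 - C a : M[X])
    have hdeg : (g %ₘ (X ^ 2 - C a)).natDegree ≤ 1 := by
      have := natDegree_modByMonic_lt g hmon (by
        intro h; have := congrArg natDegree h; simp at this)
      simp at this
      omega
    obtain ⟨v, u, huv⟩ := exists_eq_X_add_C_of_natDegree_le_one hdeg
    refine ⟨u, v, ?_⟩
    have : aeval α (X ^ 2 - C a : M[X]) = 0 := by simp [hα]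
    conv_lhs => rw [← hmod, huv]
    simp [hα]
    ring
  have key : ∀ s : IntermediateField.adjoin M {α}, IsSumSq s →
      ∃ u v w : M, IsSumSq u ∧ IsSumSq v ∧ (s : Ω) = u + a * v + w * α := by
    intro s hs
    induction hs with
    | zero => exact ⟨0, 0, 0, .zero, .zero, by simp⟩
    | sq_add y hs ih =>
      obtain ⟨u, v, w, hu, hv, e⟩ := ih
      obtain ⟨b, c, hbc⟩ := hdec y y.2
      refine ⟨b * b + u, c * c + v, w + (b * c + b * c), .sq_add _ hu, .sq_add _ hv, ?_⟩
      push_cast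
      rw [e, hbc, ← hα]
      ring
  obtain ⟨u, v, w, hu, hv, e⟩ := key _ (hM.isSumSq_adjoin hαM)
  have hw : w = 0 := by
    by_contra hw
    apply hαM
    have hw' : (w : Ω) ≠ 0 := by simpa using hw
    have : α = ((-1 - u - a * v) / w : M) := by
      push_cast
      rw [eq_div_iff hw']
      simp at e
      linear_combination -e
    rw [this]
    exact SetLike.coe_mem _
  subst hw
  exact ⟨u, v, hu, hv, Subtype.ext (by simpa using e)⟩

theorem isSquare_of_isSumSq [IsAlgClosed Ω] (hM : MaximalSemireal M) {a : M}
    (ha : IsSumSq a) : IsSquare a := by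
  by_contra hsq
  obtain ⟨u, v, hu, hv, e⟩ := hM.exists_neg_one_eq hsq
  exact hM.not_isSumSq (e ▸ hu.add (ha.mul hv))

theorem isSquare_or [IsAlgClosed Ω] (hM : MaximalSemireal M) (a : M) :
    IsSquare a ∨ IsSquare (-a) := by
  by_cases hsq : IsSquare a
  · exact .inl hsq
  right
  apply hM.isSquare_of_isSumSq
  obtain ⟨u, v, hu, hv, e⟩ := hM.exists_neg_one_eq hsq
  have hv0 : v ≠ 0 := by
    rintro rfl
    exact hM.not_isSumSq (by rw [e]; simpa using hu)
  have : -a = (1 * 1 + u) * v * (v⁻¹ * v⁻¹) := by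
    field_simp
    linear_combination e
  rw [this]
  exact ((IsSumSq.sq_add 1 hu).mul hv).mul (.mul_self _)

/-- The order on a maximal formally real field, given by squares. -/
def cone [IsAlgClosed Ω] (hM : MaximalSemireal M) : RingCone M where
  carrier := {a | IsSquare a}
  mul_mem' := IsSquare.mul
  one_mem' := IsSquare.one
  add_mem' ha hb := hM.isSquare_of_isSumSq (ha.isSumSq.add hb.isSumSq)
  zero_mem' := IsSquare.zero
  eq_zero_of_mem_of_neg_mem' := by
    intro a ha hb
    by_contra h
    apply hM.not_isSumSq
    have : (-1 : M) = a * (-a) * (a⁻¹ * a⁻¹) := by field_simp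
    rw [this]
    exact ((show IsSquare a from ha).isSumSq.mul (show IsSquare (-a) from hb).isSumSq).mul
      (.mul_self _)

theorem exists_dvd_one_add (hM : MaximalSemireal M) [IsAlgClosed Ω] {f : M[X]}
    (hf : Irreducible f) (hdeg : 2 ≤ f.natDegree) :
    ∃ G : M[X], IsSumSq G ∧ G.natDegree ≤ 2 * (f.natDegree - 1) ∧ f ∣ 1 + G := by
  obtain ⟨α, hα⟩ := IsAlgClosed.exists_aeval_eq_zero Ω f (by
    intro h
    have : f.natDegree = 0 := natDegree_eq_of_degree_eq_some h
    omega)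
  have hαM : α ∉ M := by
    intro h
    have hroot : f.IsRoot ⟨α, h⟩ := by
      apply (algebraMap M Ω).injective
      rw [← aeval_algebraMap_apply_eq_algebraMap_eval]
      simpa using hα
    have : f.natDegree = 1 := natDegree_eq_of_degree_eq_some (degree_eq_one_of_irreducible_of_root hf hroot)
    omega
  have halg : IsAlgebraic M α := ⟨f, hf.ne_zero, hα⟩
  have hdec : ∀ y ∈ IntermediateField.adjoin M {α}, ∃ g : M[X],
      g.natDegree ≤ f.natDegree - 1 ∧ aeval α g = y := by
    intro y hy
    rw [← IntermediateField.mem_toSubalgebra,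
      IntermediateField.adjoin_simple_toSubalgebra_of_isAlgebraic halg,
      Algebra.adjoin_singleton_eq_range_aeval] at hy
    obtain ⟨g, rfl⟩ := hy
    refine ⟨g % f, ?_, ?_⟩
    · have := natDegree_mod_lt g (q := f) (by omega)
      omega
    · conv_rhs => rw [← EuclideanDomain.mod_add_div g f]
      simp [hα]
  have key : ∀ s : IntermediateField.adjoin M {α}, IsSumSq s →
      ∃ G : M[X], IsSumSq G ∧ G.natDegree ≤ 2 * (f.natDegree - 1) ∧ aeval α G = s := by
    intro s hs
    induction hs with
    | zero => exact ⟨0, .zero, by simp, by simp⟩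
    | sq_add y hs ih =>
      obtain ⟨G, hG, hd, e⟩ := ih
      obtain ⟨g, hg, hy⟩ := hdec y y.2
      refine ⟨g * g + G, .sq_add _ hG, ?_, by simp [e, hy]⟩
      refine (natDegree_add_le _ _).trans (max_le (natDegree_mul_le.trans (by omega)) hd)
  obtain ⟨G, hG, hd, e⟩ := key _ (hM.isSumSq_adjoin hαM)
  refine ⟨G, hG, hd, ?_⟩
  exact (((minpoly.irreducible halg.isIntegral).associated_of_dvd hf
    (minpoly.dvd _ _ hα)).symm.dvd).trans (minpoly.dvd _ _ (by simp [e]))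

end MaximalSemireal

/-- The intermediate value property for polynomials. -/
def PolyIVT (R : Type*) [Field R] [LinearOrder R] : Prop :=
  ∀ (p : R[X]) (a b : R), a < b → p.eval a * p.eval b < 0 →
    ∃ c, a < c ∧ c < b ∧ p.eval c = 0

theorem exists_irreducible_factor_sign {R : Type*} [Field R] [LinearOrder R]
    [IsStrictOrderedRing R] (p : R[X]) (a b : R) (h : p.eval a * p.eval b < 0) :
    ∃ f, Irreducible f ∧ f ∣ p ∧ f.eval a * f.eval b < 0 := by
  induction p using WfDvdMonoid.induction_on_irreducible with
  | zero => simp at h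
  | unit u hu =>
    obtain ⟨c, hc, rfl⟩ := Polynomial.isUnit_iff.1 hu
    simp only [eval_C] at h
    nlinarith [mul_self_nonneg c]
  | mul q f hq hf ih =>
    by_cases hs : f.eval a * f.eval b < 0
    · exact ⟨f, hf, dvd_mul_right _ _, hs⟩
    · obtain ⟨g, hg, hd, hgs⟩ := ih (by
        by_contra hn
        rw [eval_mul, eval_mul] at h
        nlinarith [mul_nonneg (not_lt.1 hs) (not_lt.1 hn)])
      exact ⟨g, hg, hd.trans (dvd_mul_left _ _), hgs⟩

theorem polyIVT_of_factors {R : Type*} [Field R] [LinearOrder R]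
    [IsStrictOrderedRing R] (H : ∀ f : R[X], Irreducible f → 2 ≤ f.natDegree →
      ∃ G : R[X], IsSumSq G ∧ G.natDegree ≤ 2 * (f.natDegree - 1) ∧ f ∣ 1 + G) :
    PolyIVT R := by
  have hpos : ∀ G : R[X], IsSumSq G → ∀ a, 0 ≤ G.eval a := by
    intro G hG a
    induction hG with
    | zero => simp
    | sq_add g hs ih => simp only [eval_add, eval_mul]; nlinarith [mul_self_nonneg (g.eval a)]
  have hirr : ∀ n, ∀ f : R[X], f.natDegree = n → Irreducible f → 2 ≤ f.natDegree → ∀ a b,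
      ¬ f.eval a * f.eval b < 0 := by
    intro n
    induction n using Nat.strong_induction_on with
    | _ n ih =>
      intro f hn hf hd a b hab
      obtain ⟨G, hG, hGd, h, hh⟩ := H f hf hd
      have ha : 0 < f.eval a * h.eval a := by
        rw [← eval_mul, ← hh]; simp; linarith [hpos G hG a]
      have hb : 0 < f.eval b * h.eval b := by
        rw [← eval_mul, ← hh]; simp; linarith [hpos G hG b]
      have hs : h.eval a * h.eval b < 0 := by
        by_contra hs
        nlinarith [mul_pos ha hb, mul_nonneg (neg_nonneg.2 hab.le) (not_lt.1 hs)]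
      obtain ⟨g, hg, hgh, hgs⟩ := exists_irreducible_factor_sign h a b hs
      have hh0 : h ≠ 0 := by rintro rfl; simp at hs
      have hdeg : f.natDegree + h.natDegree ≤ 2 * (f.natDegree - 1) := by
        rw [← natDegree_mul hf.ne_zero hh0, ← hh]
        refine (natDegree_add_le _ _).trans ?_
        simp [hGd]
      have hgd := natDegree_le_of_dvd hgh hh0
      by_cases h2 : 2 ≤ g.natDegree
      · exact ih g.natDegree (by omega) g rfl hg h2 a b hgs
      · obtain ⟨r, hr⟩ := exists_root_of_degree_eq_one (p := g) (by
          have := hg.natDegree_pos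
          rw [degree_eq_natDegree hg.ne_zero]
          norm_cast
          omega)
        have : (1 + G).eval r = 0 := by
          rw [hh, eval_mul, (hr.dvd hgh).eq_zero, mul_zero]
        simp at this
        linarith [hpos G hG r]
  intro p a b hab hp
  obtain ⟨f, hf, hfp, hs⟩ := exists_irreducible_factor_sign p a b hp
  have h1 : f.natDegree ≤ 1 := by
    by_contra h
    exact hirr _ f rfl hf (by omega) a b hs
  obtain ⟨v, u, rfl⟩ := exists_eq_X_add_C_of_natDegree_le_one h1
  have hv : v ≠ 0 := by
    rintro rfl
    simp at hs
    nlinarith [mul_self_nonneg u]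
  have hroot : (C v * X + C u).IsRoot (-u / v) := by
    simp [IsRoot]; field_simp; ring
  simp at hs
  have hvv : 0 < v * v := mul_self_pos.2 hv
  have e : (v * a + u) * (v * b + u) = (v * v) * ((a - -u / v) * (b - -u / v)) := by
    field_simp; ring
  rw [e] at hs
  have hs' : (a - -u / v) * (b - -u / v) < 0 := by
    by_contra hn
    nlinarith [mul_nonneg hvv.le (not_lt.1 hn)]
  refine ⟨-u / v, ?_, ?_, hroot.dvd hfp⟩
  · rcases mul_neg_iff.1 hs' with h | h <;> linarith [h.1, h.2]
  · rcases mul_neg_iff.1 hs' with h | h <;> linarith [h.1, h.2]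

theorem exists_polyIVT_extension {F : Type} [Field F] (hF : ¬ IsSumSq (-1 : F)) :
    ∃ (M : Type) (_ : Field M) (_ : LinearOrder M) (_ : IsStrictOrderedRing M),
      Nonempty (F →+* M) ∧ PolyIVT M := by
  classical
  obtain ⟨M, hM⟩ := exists_maximalSemireal (Ω := AlgebraicClosure F) hF
  have : HasMemOrNegMem hM.cone := ⟨fun a => hM.isSquare_or a⟩
  let : LinearOrder M := LinearOrder.mkOfAddGroupCone hM.cone
  have : IsOrderedRing M := IsOrderedRing.mkOfCone hM.cone
  have : IsStrictOrderedRing M := IsOrderedRing.toIsStrictOrderedRing M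
  exact ⟨M, inferInstance, inferInstance, inferInstance, ⟨algebraMap F M⟩,
    polyIVT_of_factors fun f hf hd => hM.exists_dvd_one_add hf hd⟩

end MaximalSemirealFields

section SignTransfer

open Polynomial

namespace PolyIVT

variable {R : Type*} [Field R] [LinearOrder R] [IsStrictOrderedRing R]

/-- Rolle's theorem for adjacent roots. -/
theorem exists_derivative_root_of_adjacent (hR : PolyIVT R) {p : R[X]} (hp : p ≠ 0) {a b : R}
    (hab : a < b) (ha : p.eval a = 0) (hb : p.eval b = 0)
    (hadj : ∀ c, a < c → c < b → p.eval c ≠ 0) :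
    ∃ c, a < c ∧ c < b ∧ p.derivative.eval c = 0 := by
  obtain ⟨q, hq, hqa⟩ := exists_eq_pow_rootMultiplicity_mul_and_not_dvd p hp a
  have hq0 : q ≠ 0 := by rintro rfl; simp at hqa
  obtain ⟨g, hg, hgb⟩ := exists_eq_pow_rootMultiplicity_mul_and_not_dvd q hq0 b
  obtain ⟨m, hm⟩ : ∃ m, p.rootMultiplicity a = m + 1 :=
    Nat.exists_eq_succ_of_ne_zero ((rootMultiplicity_pos hp).2 ha).ne'
  have hqb : q.eval b = 0 := by
    rw [hq, eval_mul, mul_eq_zero] at hb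
    refine hb.resolve_left ?_
    simp [sub_ne_zero.2 hab.ne']
  obtain ⟨n, hn⟩ : ∃ n, q.rootMultiplicity b = n + 1 :=
    Nat.exists_eq_succ_of_ne_zero ((rootMultiplicity_pos hq0).2 hqb).ne'
  rw [hm] at hq
  rw [hn] at hg
  rw [dvd_iff_isRoot, IsRoot] at hqa hgb
  have hga : g.eval a ≠ 0 := by
    intro h; apply hqa; rw [hg]; simp [h]
  have hgab : 0 < g.eval a * g.eval b := by
    by_contra hlt
    obtain ⟨c, h1, h2, h3⟩ := hR g a b hab
      (lt_of_le_of_ne (not_lt.1 hlt) (mul_ne_zero hga hgb))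
    exact hadj c h1 h2 (by rw [hq, hg]; simp [h3])
  let h : R[X] := (C (m + 1 : R) * (X - C b) + C (n + 1 : R) * (X - C a)) * g
    + (X - C a) * (X - C b) * derivative g
  have hder : derivative p = (X - C a) ^ m * (X - C b) ^ n * h := by
    rw [hq, hg]
    simp only [derivative_mul, derivative_X_sub_C_pow, h]
    push_cast
    simp only [map_add, map_natCast, map_one]
    ring
  have hpos : (0 : R) < (m + 1) * (n + 1) := by positivity
  have hs : h.eval a * h.eval b < 0 := by
    have : h.eval a * h.eval b =
        -(((m + 1) * (n + 1)) * ((b - a) * (b - a)) * (g.eval a * g.eval b)) := by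
      simp [h]; ring
    rw [this]
    have := sub_pos.2 hab
    have : 0 < (((m + 1) * (n + 1)) * ((b - a) * (b - a)) * (g.eval a * g.eval b)) := by positivity
    linarith
  obtain ⟨c, h1, h2, h3⟩ := hR h a b hab hs
  exact ⟨c, h1, h2, by rw [hder]; simp [h3]⟩

theorem exists_derivative_root (hR : PolyIVT R) {p : R[X]} (hp : p ≠ 0) {a b : R}
    (hab : a < b) (ha : p.eval a = 0) (hb : p.eval b = 0) :
    ∃ c, a < c ∧ c < b ∧ p.derivative.eval c = 0 := by
  classical
  let s := p.roots.toFinset.filter (fun x => a < x)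
  have hbs : b ∈ s := by simp [s, hp, hb, hab]
  have hs : s.Nonempty := ⟨b, hbs⟩
  have hmem := s.min'_mem hs
  simp only [s, Finset.mem_filter, Multiset.mem_toFinset, mem_roots hp] at hmem
  obtain ⟨c, h1, h2, h3⟩ := hR.exists_derivative_root_of_adjacent hp hmem.2 ha hmem.1 (by
    intro c hac hc h
    exact absurd (s.min'_le c (by simp [s, hp, h, hac])) (not_le.2 hc))
  exact ⟨c, h1, h2.trans_le (s.min'_le b hbs), h3⟩

end PolyIVT

section Transfer

variable {K R R' : Type*} [Field K] [LinearOrder K] [IsStrictOrderedRing K]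
  [Field R] [LinearOrder R] [IsStrictOrderedRing R]
  [Field R'] [LinearOrder R'] [IsStrictOrderedRing R']

/-- Bounds on the roots of a polynomial. -/
theorem exists_root_bound (i : K →+* R) (hi : StrictMono i) {f : K[X]} (hf : f ≠ 0)  :
    ∃ B : K, ∀ x : R, eval₂ i x f = 0 → i (-B) < x ∧ x < i B := by
  set d := f.natDegree
  set c := f.leadingCoeff
  have hc : c ≠ 0 := leadingCoeff_ne_zero.2 hf
  set S := ∑ j ∈ Finset.range d, |f.coeff j|
  have hS : 0 ≤ S := Finset.sum_nonneg fun _ _ => abs_nonneg _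
  refine ⟨1 + S / |c| , fun x hx => ?_⟩
  have habs : ∀ z, |i z| = i |z| := fun z => (by
    rcases le_total 0 z with h | h
    · rw [abs_of_nonneg h, abs_of_nonneg (by simpa using hi.monotone h)]
    · rw [abs_of_nonpos h, abs_of_nonpos (by simpa using hi.monotone h), map_neg])
  suffices |x| < i (1 + S / |c|) by rw [map_neg]; exact abs_lt.1 this
  have hic : 0 < i |c| := by rw [← map_zero i]; exact hi (abs_pos.2 hc)
  have hiS : 0 ≤ i S := by rw [← map_zero i]; exact hi.monotone hS
  by_contra hlt
  push Not at hlt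
  simp only [map_add, map_one, map_div₀] at hlt
  have hx1 : 1 ≤ |x| := by
    have : 0 ≤ i S / i |c| := by positivity
    linarith
  have hx2 : i S < |x| * i |c| := by
    have : i S / i |c| < |x| := by linarith
    rwa [div_lt_iff₀ hic] at this
  rw [eval₂_eq_sum_range, Finset.sum_range_succ] at hx
  rcases Nat.eq_zero_or_pos d with h0 | h0
  · simp only [d] at h0
    rw [h0] at hx
    simp at hx
    have : c = 0 := by simp [c, leadingCoeff, h0, hx]
    exact hc this
  have h1 : |∑ j ∈ Finset.range d, i (f.coeff j) * x ^ j| ≤ i S * |x| ^ (d - 1) := by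
    refine (Finset.abs_sum_le_sum_abs _ _).trans ?_
    rw [map_sum, Finset.sum_mul]
    refine Finset.sum_le_sum fun j hj => ?_
    rw [abs_mul, abs_pow, habs]
    refine mul_le_mul_of_nonneg_left (pow_le_pow_right₀ hx1 ?_) ?_
    · have := Finset.mem_range.1 hj; omega
    · rw [← habs]; exact abs_nonneg _
  have h2 : |∑ j ∈ Finset.range d, i (f.coeff j) * x ^ j| = i |c| * |x| ^ d := by
    rw [eq_neg_of_add_eq_zero_left hx, abs_neg, abs_mul, abs_pow, habs]
    rfl
  have h3 : |x| ^ d = |x| * |x| ^ (d - 1) := by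
    rw [← pow_succ']; congr 1; omega
  have h4 : 0 < |x| ^ (d - 1) := by positivity
  rw [h2, h3] at h1
  nlinarith [mul_lt_mul_of_pos_right hx2 h4]

/-- Narrowing a cut so that it avoids a finite set. -/
theorem exists_gap (i : K →+* R) (α : R) (hα : ∀ z, i z ≠ α)
    (S : Finset K) {lo hi' : K} (h1 : i lo < α) (h2 : α < i hi') :
    ∃ u v : K, lo ≤ u ∧ v ≤ hi' ∧ i u < α ∧ α < i v ∧ ∀ s ∈ S, ¬ (u < s ∧ s < v) := by
  classical
  induction S using Finset.induction_on with
  | empty => exact ⟨lo, hi', le_rfl, le_rfl, h1, h2, by simp⟩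
  | insert s S _ ih =>
    obtain ⟨u, v, hu, hv, hu', hv', hS⟩ := ih
    rcases lt_or_gt_of_ne (hα s) with h | h
    · refine ⟨max u s, v, hu.trans (le_max_left _ _), hv, ?_, hv', ?_⟩
      · rcases max_choice u s with e | e <;> rw [e] <;> assumption
      · intro t ht
        rcases Finset.mem_insert.1 ht with rfl | ht
        · simp
        · rintro ⟨h3, h4⟩; exact hS t ht ⟨(le_max_left _ _).trans_lt h3, h4⟩
    · refine ⟨u, min v s, hu, (min_le_left _ _).trans hv, hu', ?_, ?_⟩
      · rcases min_choice v s with e | e <;> rw [e] <;> assumption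
      · intro t ht
        rcases Finset.mem_insert.1 ht with rfl | ht
        · simp
        · rintro ⟨h3, h4⟩; exact hS t ht ⟨h3, h4.trans_le (min_le_left _ _)⟩

/-- Roots of polynomials of small degree are in the base field. -/
theorem root_mem_range {R : Type*} [Field R] (i : K →+* R) {d : ℕ}
    (hd : ∀ g : K[X], Irreducible g → 2 ≤ g.natDegree → g.natDegree < d →
      ∀ x : R, eval₂ i x g ≠ 0)
    (g : K[X]) (hg0 : g ≠ 0) (hg : g.natDegree < d) {x : R} (hx : eval₂ i x g = 0) :
    ∃ r, i r = x ∧ g.eval r = 0 := by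
  obtain ⟨f, hf, hfg, hfx⟩ : ∃ f, Irreducible f ∧ f ∣ g ∧ eval₂ i x f = 0 := by
    clear hg hd
    induction g using WfDvdMonoid.induction_on_irreducible with
    | zero => exact absurd rfl hg0
    | unit u hu =>
      exfalso
      obtain ⟨c, hc, rfl⟩ := Polynomial.isUnit_iff.1 hu
      simp at hx
      simp [hx] at hg0
    | mul q f hq hf ih =>
      rw [eval₂_mul, mul_eq_zero] at hx
      rcases hx with h | h
      · exact ⟨f, hf, dvd_mul_right _ _, h⟩
      · obtain ⟨g, h1, h2, h3⟩ := ih hq h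
        exact ⟨g, h1, h2.trans (dvd_mul_left _ _), h3⟩
  have hle := natDegree_le_of_dvd hfg hg0
  have h1 : f.natDegree ≤ 1 := by
    by_contra h
    exact hd f hf (by omega) (by omega) x hfx
  have hdeg : f.degree = 1 := by
    have := hf.natDegree_pos
    rw [degree_eq_natDegree hf.ne_zero]
    norm_cast
    omega
  obtain ⟨r, hr⟩ := exists_root_of_degree_eq_one hdeg
  refine ⟨r, ?_, (hr.dvd hfg).eq_zero⟩
  obtain ⟨q, hq⟩ := dvd_iff_isRoot.2 hr
  rw [hq, eval₂_mul, mul_eq_zero] at hfx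
  rcases hfx with h | h
  · simp at h; exact (sub_eq_zero.1 h).symm
  · exfalso
    have hq0 : q ≠ 0 := by rintro rfl; simp at hq; exact hf.ne_zero hq
    have : q.natDegree = 0 := by
      have := congrArg natDegree hq
      rw [natDegree_mul (X_sub_C_ne_zero r) hq0, natDegree_X_sub_C] at this
      omega
    rw [eq_C_of_natDegree_eq_zero this] at h hq0
    simp at h
    simp [h] at hq0

/-- Over an ordered field with respect to which `f` has least possible degree, an isolated root
`α` of `f` determines the signs of all polynomials by the interval containing it. -/
theorem exists_matching_root_aux (hR : PolyIVT R) (hR' : PolyIVT R')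
    (i : K →+* R) (hi : StrictMono i) (i' : K →+* R') (hi' : StrictMono i')
    {f : K[X]} (hf : Irreducible f) (hdeg : 2 ≤ f.natDegree)
    (hd : ∀ g : K[X], Irreducible g → 2 ≤ g.natDegree → g.natDegree < f.natDegree →
      (∀ x : R, eval₂ i x g ≠ 0) ∧ ∀ x : R', eval₂ i' x g ≠ 0)
    {α : R} (hα : eval₂ i α f = 0) :
    ∃ α' : R', eval₂ i' α' f = 0 ∧
      ∀ g : K[X], 0 < eval₂ i α g ↔ 0 < eval₂ i' α' g := by
  classical
  have hroot := root_mem_range i fun g h1 h2 h3 => (hd g h1 h2 h3).1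
  have hroot' := root_mem_range i' fun g h1 h2 h3 => (hd g h1 h2 h3).2
  have hnoroot : ∀ z, f.eval z ≠ 0 := by
    intro z hz
    have : f.natDegree = 1 :=
      natDegree_eq_of_degree_eq_some (degree_eq_one_of_irreducible_of_root hf hz)
    omega
  have hαK : ∀ z, i z ≠ α := by
    rintro z rfl
    rw [eval₂_at_apply, map_eq_zero] at hα
    exact hnoroot z hα
  have hf' : derivative f ≠ 0 := by
    intro h
    have := Polynomial.derivative_eq_zero.1 h
    omega
  have hf'd : (derivative f).natDegree < f.natDegree := natDegree_derivative_lt (by omega)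
  obtain ⟨B, hB⟩ := exists_root_bound i hi hf.ne_zero
  obtain ⟨u, v, -, -, hu, hv, hgap⟩ := exists_gap i α hαK (derivative f).roots.toFinset
    (hB α hα).1 (hB α hα).2
  have huv : u < v := hi.lt_iff_lt.1 (hu.trans hv)
  have hgap1 : ∀ x : R, i u < x → x < i v → eval₂ i x (derivative f) ≠ 0 := by
    intro x h1 h2 h
    obtain ⟨r, rfl, hr⟩ := hroot _ hf' hf'd h
    exact hgap r (by simp [hf', hr]) ⟨hi.lt_iff_lt.1 h1, hi.lt_iff_lt.1 h2⟩
  have hgap1' : ∀ x : R', i' u < x → x < i' v → eval₂ i' x (derivative f) ≠ 0 := by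
    intro x h1 h2 h
    obtain ⟨r, rfl, hr⟩ := hroot' _ hf' hf'd h
    exact hgap r (by simp [hf', hr]) ⟨hi'.lt_iff_lt.1 h1, hi'.lt_iff_lt.1 h2⟩
  have huniq : ∀ x y : R, i u < x → x < y → y < i v → eval₂ i x f = 0 → eval₂ i y f ≠ 0 := by
    intro x y h1 h2 h3 hx hy
    obtain ⟨c, hc1, hc2, hc3⟩ := hR.exists_derivative_root (p := f.map i)
      ((Polynomial.map_ne_zero_iff i.injective).2 hf.ne_zero) h2
      (by rwa [eval_map]) (by rwa [eval_map])
    rw [derivative_map, eval_map] at hc3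
    exact hgap1 c (h1.trans hc1) (hc2.trans h3) hc3
  have huniq' : ∀ x y : R', i' u < x → x < y → y < i' v → eval₂ i' x f = 0 →
      eval₂ i' y f ≠ 0 := by
    intro x y h1 h2 h3 hx hy
    obtain ⟨c, hc1, hc2, hc3⟩ := hR'.exists_derivative_root (p := f.map i')
      ((Polynomial.map_ne_zero_iff i'.injective).2 hf.ne_zero) h2
      (by rwa [eval_map]) (by rwa [eval_map])
    rw [derivative_map, eval_map] at hc3
    exact hgap1' c (h1.trans hc1) (hc2.trans h3) hc3
  have hsgn : ∀ a b, f.eval a * f.eval b < 0 → a < b →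
      ∃ c : R, i a < c ∧ c < i b ∧ eval₂ i c f = 0 := by
    intro a b h hab
    obtain ⟨c, h1, h2, h3⟩ := hR (f.map i) (i a) (i b) (hi hab) (by
      rw [eval_map, eval_map, eval₂_at_apply, eval₂_at_apply, ← map_mul, ← map_zero i]
      exact hi h)
    exact ⟨c, h1, h2, by rwa [eval_map] at h3⟩
  have hsgn' : ∀ a b, f.eval a * f.eval b < 0 → a < b →
      ∃ c : R', i' a < c ∧ c < i' b ∧ eval₂ i' c f = 0 := by
    intro a b h hab
    obtain ⟨c, h1, h2, h3⟩ := hR' (f.map i') (i' a) (i' b) (hi' hab) (by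
      rw [eval_map, eval_map, eval₂_at_apply, eval₂_at_apply, ← map_mul, ← map_zero i']
      exact hi' h)
    exact ⟨c, h1, h2, by rwa [eval_map] at h3⟩
  have hfuv : f.eval u * f.eval v < 0 := by
    by_contra hn
    have hpos : 0 < f.eval u * f.eval v :=
      lt_of_le_of_ne (not_lt.1 hn) (mul_ne_zero (hnoroot u) (hnoroot v)).symm
    obtain ⟨g, hg⟩ := dvd_iff_isRoot.2 (show (f.map i).IsRoot α by rwa [IsRoot, eval_map])
    have hev : ∀ z, i (f.eval z) = (i z - α) * g.eval (i z) := by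
      intro z
      rw [← eval₂_at_apply, ← eval_map, hg]; simp
    have hg2 : g.eval (i u) * g.eval (i v) < 0 := by
      by_contra hn2
      have h1 : 0 < i (f.eval u) * i (f.eval v) := by
        rw [← map_mul, ← map_zero i]; exact hi hpos
      rw [hev, hev] at h1
      nlinarith [mul_pos (sub_pos.2 hu) (sub_pos.2 hv),
        mul_nonneg (mul_pos (sub_pos.2 hu) (sub_pos.2 hv)).le (not_lt.1 hn2)]
    obtain ⟨c, hc1, hc2, hc3⟩ := hR g _ _ (hi huv) hg2
    have hcf : eval₂ i c f = 0 := by rw [← eval_map, hg]; simp [hc3]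
    rcases lt_trichotomy c α with h | h | h
    · exact huniq c α hc1 h hv hcf hα
    · apply hgap1 c hc1 hc2
      rw [← eval_map, ← derivative_map, hg]
      subst h
      simp [hc3]
    · exact huniq α c hu h hc2 hα hcf
  obtain ⟨α', hu', hv', hα'⟩ := hsgn' u v hfuv huv
  refine ⟨α', hα', ?_⟩
  have hlt : ∀ e, u ≤ e → e ≤ v → (i e < α ↔ f.eval e * f.eval v < 0) := by
    intro e h1 h2
    constructor
    · intro h
      by_contra hn
      have h3 : f.eval u * f.eval e < 0 := by
        by_contra hn2
        have := hnoroot e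
        have := mul_self_pos.2 this
        nlinarith [mul_nonneg (not_lt.1 hn) (not_lt.1 hn2)]
      obtain ⟨c, hc1, hc2, hc3⟩ := hsgn u e h3 (lt_of_le_of_ne h1 (by
        rintro rfl; nlinarith [mul_self_nonneg (f.eval u)]))
      exact huniq c α hc1 (hc2.trans h) hv hc3 hα
    · intro h
      by_contra hn
      have hn' : α < i e := lt_of_le_of_ne (not_lt.1 hn) (hαK e).symm
      obtain ⟨c, hc1, hc2, hc3⟩ := hsgn e v h (lt_of_le_of_ne h2 (by
        rintro rfl; nlinarith [mul_self_nonneg (f.eval e)]))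
      exact huniq α c hu (hn'.trans hc1) hc2 hα hc3
  have hα'K : ∀ z, i' z ≠ α' := by
    rintro z rfl
    rw [eval₂_at_apply, map_eq_zero] at hα'
    exact hnoroot z hα'
  have hlt' : ∀ e, u ≤ e → e ≤ v → (i' e < α' ↔ f.eval e * f.eval v < 0) := by
    intro e h1 h2
    constructor
    · intro h
      by_contra hn
      have h3 : f.eval u * f.eval e < 0 := by
        by_contra hn2
        have := hnoroot e
        have := mul_self_pos.2 this
        nlinarith [mul_nonneg (not_lt.1 hn) (not_lt.1 hn2)]
      obtain ⟨c, hc1, hc2, hc3⟩ := hsgn' u e h3 (lt_of_le_of_ne h1 (by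
        rintro rfl; nlinarith [mul_self_nonneg (f.eval u)]))
      exact huniq' c α' hc1 (hc2.trans h) hv' hc3 hα'
    · intro h
      by_contra hn
      have hn' : α' < i' e := lt_of_le_of_ne (not_lt.1 hn) (hα'K e).symm
      obtain ⟨c, hc1, hc2, hc3⟩ := hsgn' e v h (lt_of_le_of_ne h2 (by
        rintro rfl; nlinarith [mul_self_nonneg (f.eval e)]))
      exact huniq' α' c hu' (hn'.trans hc1) hc2 hα' hc3
  have hmain : ∀ g : K[X], g.natDegree < f.natDegree →
      (0 < eval₂ i α g ↔ 0 < eval₂ i' α' g) := by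
    intro g hgd
    by_cases hg0 : g = 0
    · simp [hg0]
    obtain ⟨e1, e2, h1, h2, h3, h4, h5⟩ := exists_gap i α hαK g.roots.toFinset hu hv
    have h12 : e1 < e2 := hi.lt_iff_lt.1 (h3.trans h4)
    have h3' : i' e1 < α' := (hlt' e1 h1 (h12.le.trans h2)).2 ((hlt e1 h1 (h12.le.trans h2)).1 h3)
    have h4' : α' < i' e2 := by
      refine lt_of_le_of_ne (not_lt.1 fun h => ?_) (hα'K e2).symm
      exact absurd ((hlt e2 (h1.trans h12.le) h2).2 ((hlt' e2 (h1.trans h12.le) h2).1 h))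
        (not_lt.2 h4.le)
    set w := (e1 + e2) / 2
    have hw1 : e1 < w := left_lt_add_div_two.2 h12
    have hw2 : w < e2 := add_div_two_lt_right.2 h12
    have hn : ∀ x : R, i e1 < x → x < i e2 → eval₂ i x g ≠ 0 := by
      intro x hx1 hx2 h
      obtain ⟨r, rfl, hr⟩ := hroot _ hg0 hgd h
      exact h5 r (by simp [hg0, hr]) ⟨hi.lt_iff_lt.1 hx1, hi.lt_iff_lt.1 hx2⟩
    have hn' : ∀ x : R', i' e1 < x → x < i' e2 → eval₂ i' x g ≠ 0 := by
      intro x hx1 hx2 h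
      obtain ⟨r, rfl, hr⟩ := hroot' _ hg0 hgd h
      exact h5 r (by simp [hg0, hr]) ⟨hi'.lt_iff_lt.1 hx1, hi'.lt_iff_lt.1 hx2⟩
    have hconst : ∀ x y : R, i e1 < x → x < i e2 → i e1 < y → y < i e2 → 0 < eval₂ i x g →
        0 < eval₂ i y g := by
      intro x y hx1 hx2 hy1 hy2 h
      by_contra hneg
      have hneg' : eval₂ i y g < 0 := lt_of_le_of_ne (not_lt.1 hneg) (hn y hy1 hy2)
      rcases lt_trichotomy x y with hxy | rfl | hxy
      · obtain ⟨c, hc1, hc2, hc3⟩ := hR (g.map i) x y hxy (by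
          rw [eval_map, eval_map]; exact mul_neg_of_pos_of_neg h hneg')
        exact hn c (hx1.trans hc1) (hc2.trans hy2) (by rwa [eval_map] at hc3)
      · exact absurd h (not_lt.2 hneg'.le)
      · obtain ⟨c, hc1, hc2, hc3⟩ := hR (g.map i) y x hxy (by
          rw [eval_map, eval_map]; exact mul_neg_of_neg_of_pos hneg' h)
        exact hn c (hy1.trans hc1) (hc2.trans hx2) (by rwa [eval_map] at hc3)
    have hconst' : ∀ x y : R', i' e1 < x → x < i' e2 → i' e1 < y → y < i' e2 →
        0 < eval₂ i' x g → 0 < eval₂ i' y g := by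
      intro x y hx1 hx2 hy1 hy2 h
      by_contra hneg
      have hneg' : eval₂ i' y g < 0 := lt_of_le_of_ne (not_lt.1 hneg) (hn' y hy1 hy2)
      rcases lt_trichotomy x y with hxy | rfl | hxy
      · obtain ⟨c, hc1, hc2, hc3⟩ := hR' (g.map i') x y hxy (by
          rw [eval_map, eval_map]; exact mul_neg_of_pos_of_neg h hneg')
        exact hn' c (hx1.trans hc1) (hc2.trans hy2) (by rwa [eval_map] at hc3)
      · exact absurd h (not_lt.2 hneg'.le)
      · obtain ⟨c, hc1, hc2, hc3⟩ := hR' (g.map i') y x hxy (by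
          rw [eval_map, eval_map]; exact mul_neg_of_neg_of_pos hneg' h)
        exact hn' c (hy1.trans hc1) (hc2.trans hx2) (by rwa [eval_map] at hc3)
    have e : 0 < eval₂ i (i w) g ↔ 0 < eval₂ i' (i' w) g := by
      rw [eval₂_at_apply, eval₂_at_apply, ← map_zero i, ← map_zero i', hi.lt_iff_lt,
        hi'.lt_iff_lt]
    constructor
    · intro h
      exact hconst' _ _ (hi' hw1) (hi' hw2) h3' h4'
        (e.1 (hconst _ _ h3 h4 (hi hw1) (hi hw2) h))
    · intro h
      exact hconst _ _ (hi hw1) (hi hw2) h3 h4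
        (e.2 (hconst' _ _ h3' h4' (hi' hw1) (hi' hw2) h))
  intro g
  have e1 : eval₂ i α g = eval₂ i α (g % f) := by
    conv_lhs => rw [← EuclideanDomain.mod_add_div g f]
    simp [eval₂_mul, hα]
  have e2 : eval₂ i' α' g = eval₂ i' α' (g % f) := by
    conv_lhs => rw [← EuclideanDomain.mod_add_div g f]
    simp [eval₂_mul, hα']
  rw [e1, e2]
  exact hmain _ (natDegree_mod_lt g (by omega))

end Transfer

end SignTransfer

section GraphTransfer

open Polynomial

section Transfer

variable {K R R' : Type*} [Field K] [LinearOrder K] [IsStrictOrderedRing K]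
  [Field R] [LinearOrder R] [IsStrictOrderedRing R]
  [Field R'] [LinearOrder R'] [IsStrictOrderedRing R']

/-- If a polynomial has all its roots in `K`, its sign at `x` only depends on the cut of `x`. -/
theorem sign_eq_of_same_cut (hR : PolyIVT R) (i : K →+* R) (hi : StrictMono i)
    {g : K[X]} (hroot : ∀ x : R, eval₂ i x g = 0 → ∃ r, i r = x ∧ g.eval r = 0)
    {x : R} {w : K} (hw : ∀ s, g.eval s = 0 → s ≠ w ∧ i s ≠ x ∧ (s < w ↔ i s < x)) :
    0 < eval₂ i x g ↔ 0 < g.eval w := by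
  have key : ∀ y z : R, (∀ s, g.eval s = 0 → i s ≠ y ∧ i s ≠ z ∧ (i s < y ↔ i s < z)) →
      0 < eval₂ i y g → 0 < eval₂ i z g := by
    intro y z h hy
    by_contra hz
    have hz0 : eval₂ i z g ≠ 0 := by
      intro h0
      obtain ⟨r, rfl, hr⟩ := hroot _ h0
      exact (h r hr).2.1 rfl
    have hz' : eval₂ i z g < 0 := lt_of_le_of_ne (not_lt.1 hz) hz0
    rcases lt_trichotomy y z with hyz | rfl | hyz
    · obtain ⟨c, h1, h2, h3⟩ := hR (g.map i) y z hyz (by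
        rw [eval_map, eval_map]; exact mul_neg_of_pos_of_neg hy hz')
      rw [eval_map] at h3
      obtain ⟨r, rfl, hr⟩ := hroot _ h3
      exact absurd ((h r hr).2.2.2 h2) (not_lt.2 h1.le)
    · exact hz hy
    · obtain ⟨c, h1, h2, h3⟩ := hR (g.map i) z y hyz (by
        rw [eval_map, eval_map]; exact mul_neg_of_neg_of_pos hz' hy)
      rw [eval_map] at h3
      obtain ⟨r, rfl, hr⟩ := hroot _ h3
      exact absurd ((h r hr).2.2.1 h2) (not_lt.2 h1.le)
  have e : 0 < eval₂ i (i w) g ↔ 0 < g.eval w := by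
    rw [eval₂_at_apply, ← map_zero i, hi.lt_iff_lt]
  rw [← e]
  constructor
  · refine key _ _ fun s hs => ?_
    obtain ⟨h1, h2, h3⟩ := hw s hs
    exact ⟨h2, i.injective.ne h1, by rw [← h3, hi.lt_iff_lt]⟩
  · refine key _ _ fun s hs => ?_
    obtain ⟨h1, h2, h3⟩ := hw s hs
    exact ⟨i.injective.ne h1, h2, by rw [← h3, hi.lt_iff_lt]⟩

/-- An order-preserving partial isomorphism which cannot be extended is total, if the target is
sufficiently saturated. -/
theorem surjective_of_maximal (hR : PolyIVT R) (hR' : PolyIVT R')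
    (i : K →+* R) (hi : StrictMono i) (i' : K →+* R') (hi' : StrictMono i')
    (hsat : ∀ S T : Set K, (∀ s ∈ S, ∀ t ∈ T, s < t) →
      ∃ y : R', (∀ s ∈ S, i' s < y) ∧ ∀ t ∈ T, y < i' t)
    (hmax : ∀ (x : R) (y : R'), (∀ g : K[X], 0 < eval₂ i x g ↔ 0 < eval₂ i' y g) →
      ∃ z, i z = x ∧ i' z = y) : Function.Surjective i := by
  classical
  have hnone : ∀ d, ∀ g : K[X], Irreducible g → 2 ≤ g.natDegree → g.natDegree = d →
      (∀ x : R, eval₂ i x g ≠ 0) ∧ ∀ x : R', eval₂ i' x g ≠ 0 := by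
    intro d
    induction d using Nat.strong_induction_on with
    | _ d ih =>
    intro f hf hdeg hd
    have hnoroot : ∀ z, f.eval z ≠ 0 := by
      intro z hz
      have : f.natDegree = 1 :=
        natDegree_eq_of_degree_eq_some (degree_eq_one_of_irreducible_of_root hf hz)
      omega
    have hd' : ∀ g : K[X], Irreducible g → 2 ≤ g.natDegree → g.natDegree < f.natDegree →
      (∀ x : R, eval₂ i x g ≠ 0) ∧ ∀ x : R', eval₂ i' x g ≠ 0 :=
      fun g h1 h2 h3 => ih _ (hd ▸ h3) g h1 h2 rfl
    constructor
    · intro x hx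
      obtain ⟨y, hy, h⟩ := exists_matching_root_aux hR hR' i hi i' hi' hf hdeg hd' hx
      obtain ⟨z, rfl, -⟩ := hmax x y h
      rw [eval₂_at_apply, map_eq_zero] at hx
      exact hnoroot z hx
    · intro x hx
      obtain ⟨y, hy, h⟩ := exists_matching_root_aux hR' hR i' hi' i hi hf hdeg
        (fun g h1 h2 h3 => (hd' g h1 h2 h3).symm) hx
      obtain ⟨z, rfl, -⟩ := hmax y x fun g => (h g).symm
      rw [eval₂_at_apply, map_eq_zero] at hy
      exact hnoroot z hy
  intro x
  by_contra hx
  push Not at hx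
  obtain ⟨y, hy1, hy2⟩ := hsat {s | i s < x} {t | x < i t}
    (fun s hs t ht => hi.lt_iff_lt.1 (lt_trans hs ht))
  have hcut : ∀ s, i s < x ↔ i' s < y := by
    intro s
    refine ⟨hy1 s, fun h => ?_⟩
    by_contra h2
    exact absurd (hy2 s (lt_of_le_of_ne (not_lt.1 h2) (hx s).symm)) (not_lt.2 h.le)
  have hy : ∀ s, i' s ≠ y := by
    rintro s rfl
    rcases lt_or_gt_of_ne (hx s) with h | h
    · exact lt_irrefl _ ((hcut s).1 h)
    · exact lt_irrefl _ (hy2 s h)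
  obtain ⟨z, hz, -⟩ := hmax x y (by
    intro g
    by_cases hg : g = 0
    · simp [hg]
    have hroot := fun t : R => root_mem_range i (d := g.natDegree + 1)
      (fun f h1 h2 _ => (hnone _ f h1 h2 rfl).1) g hg (Nat.lt_succ_self _) (x := t)
    have hroot' := fun t : R' => root_mem_range i' (d := g.natDegree + 1)
      (fun f h1 h2 _ => (hnone _ f h1 h2 rfl).2) g hg (Nat.lt_succ_self _) (x := t)
    obtain ⟨w, hw1, hw2⟩ := Order.exists_between_finsets
      (g.roots.toFinset.filter fun s => i s < x) (g.roots.toFinset.filter fun s => ¬ i s < x) (by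
        intro s hs t ht
        simp only [Finset.mem_filter] at hs ht
        exact hi.lt_iff_lt.1 (hs.2.trans_le (not_lt.1 ht.2)))
    have hw : ∀ s, g.eval s = 0 → s ≠ w ∧ (s < w ↔ i s < x) := by
      intro s hs
      by_cases h : i s < x
      · have := hw1 s (by simp [hg, hs, h])
        exact ⟨this.ne, by simp [h, this]⟩
      · have := hw2 s (by simpa [hg, hs] using h)
        exact ⟨this.ne', by simp [h, this.le]⟩
    rw [sign_eq_of_same_cut hR i hi hroot
      (fun s hs => ⟨(hw s hs).1, hx s, (hw s hs).2⟩),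
      sign_eq_of_same_cut hR' i' hi' hroot'
      (fun s hs => ⟨(hw s hs).1, hy s, by rw [(hw s hs).2, hcut]⟩)])
  exact hx z hz

end Transfer

section Graph

variable {R R' : Type*} [Field R] [LinearOrder R] [IsStrictOrderedRing R]
  [Field R'] [LinearOrder R'] [IsStrictOrderedRing R']

theorem eval₂_inv_pos_iff {A S : Type*} [CommRing A] [Field S] [LinearOrder S]
    [IsStrictOrderedRing S] (φ : A →+* S) (g : A[X]) {a : S} (ha : a ≠ 0) :
    0 < eval₂ φ a⁻¹ g ↔ 0 < eval₂ φ a (g.reverse * X ^ g.natDegree) := by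
  let _ : Invertible a⁻¹ := invertibleOfNonzero (inv_ne_zero ha)
  have := eval₂_reverse_mul_pow φ a⁻¹ g
  simp only [invOf_eq_inv, inv_inv] at this
  rw [← this, eval₂_mul, eval₂_X_pow]
  have h3 : a⁻¹ ^ g.natDegree * a ^ g.natDegree = 1 := by
    rw [← mul_pow, inv_mul_cancel₀ ha, one_pow]
  have h2 : eval₂ φ a g.reverse * a ^ g.natDegree =
      (eval₂ φ a g.reverse * a⁻¹ ^ g.natDegree) * (a ^ g.natDegree) ^ 2 := by
    linear_combination (-eval₂ φ a g.reverse * a ^ g.natDegree) * h3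
  have h4 : 0 < (a ^ g.natDegree) ^ 2 :=
    lt_of_le_of_ne (sq_nonneg _) (pow_ne_zero _ (pow_ne_zero _ ha)).symm
  rw [h2, mul_pos_iff_of_pos_right h4]

theorem surjective_of_maximal_of_isField {K : Type*} [CommRing K] (hR : PolyIVT R)
    (hR' : PolyIVT R') (hK : IsField K) (i : K →+* R) (hi : Function.Injective i) (i' : K →+* R')
    (hpos : ∀ z, 0 < i z ↔ 0 < i' z)
    (hsat : ∀ S T : Set K, (∀ s ∈ S, ∀ t ∈ T, i' s < i' t) →
      ∃ y : R', (∀ s ∈ S, i' s < y) ∧ ∀ t ∈ T, y < i' t)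
    (hmax : ∀ (x : R) (y : R'), (∀ g : K[X], 0 < eval₂ i x g ↔ 0 < eval₂ i' y g) →
      ∃ z, i z = x ∧ i' z = y) : Function.Surjective i := by
  let _ : Field K := hK.toField
  let _ : LinearOrder K := LinearOrder.lift' i hi
  have hi : StrictMono i := fun a b h => h
  have : IsStrictOrderedRing K := Function.Injective.isStrictOrderedRing i (map_zero _) (map_one _)
    (map_add _) (map_mul _) Iff.rfl Iff.rfl
  have hi' : StrictMono i' := by
    intro a b h
    have h1 := (hpos (b - a)).1 (by rw [map_sub]; exact sub_pos.2 (hi h))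
    rw [map_sub] at h1
    exact sub_pos.1 h1
  exact surjective_of_maximal hR hR' i hi i' hi'
    (fun S T h => hsat S T fun s hs t ht => hi' (h s hs t ht)) hmax

/-- A maximal order-preserving partial isomorphism. -/
theorem exists_maximal_graph : ∃ T : Subring (R × R'), (∀ z ∈ T, 0 < z.1 ↔ 0 < z.2) ∧
    ∀ (x : R) (y : R'),
      (∀ g : T[X], 0 < eval₂ ((RingHom.fst R R').comp T.subtype) x g ↔
        0 < eval₂ ((RingHom.snd R R').comp T.subtype) y g) → (x, y) ∈ T := by
  let P : Set (Subring (R × R')) := {T | ∀ z ∈ T, 0 < z.1 ↔ 0 < z.2}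
  have hbot : (⊥ : Subring (R × R')) ∈ P := by
    intro z hz
    obtain ⟨n, rfl⟩ := Subring.mem_bot.1 hz
    simp
  obtain ⟨T, -, hT⟩ := zorn_le_nonempty₀ P (by
    intro c hc hchain T0 hT0
    refine ⟨sSup c, ?_, fun z hz => le_sSup hz⟩
    intro z hz
    obtain ⟨T, hT, hzT⟩ := (Subring.mem_sSup_of_directedOn ⟨T0, hT0⟩ hchain.directedOn).1 hz
    exact hc hT z hzT) ⊥ hbot
  refine ⟨T, hT.prop, fun x y h => ?_⟩
  let ev : T[X] →+* R × R' := eval₂RingHom T.subtype (x, y)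
  have hev : ∀ g, ev g = (eval₂ ((RingHom.fst R R').comp T.subtype) x g,
      eval₂ ((RingHom.snd R R').comp T.subtype) y g) := by
    intro g
    have h1 := hom_eval₂ g T.subtype (RingHom.fst R R') (x, y)
    have h2 := hom_eval₂ g T.subtype (RingHom.snd R R') (x, y)
    exact Prod.ext h1 h2
  have hP : ev.range ∈ P := by
    rintro _ ⟨g, rfl⟩
    rw [hev]
    exact h g
  have hle : T ≤ ev.range := fun z hz => ⟨C ⟨z, hz⟩, by simp [ev]⟩
  exact hT.le_of_ge hP hle ⟨X, by simp [ev]⟩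

theorem exists_orderEmbedding_of_saturated [Countable R] (hR : PolyIVT R) (hR' : PolyIVT R')
    (hsat : ∀ S T : Set R', S.Countable → T.Countable → (∀ s ∈ S, ∀ t ∈ T, s < t) →
      ∃ y : R', (∀ s ∈ S, s < y) ∧ ∀ t ∈ T, y < t) : Nonempty (R →+* R') := by
  obtain ⟨T, hT, hmax⟩ := exists_maximal_graph (R := R) (R' := R')
  have hneg : ∀ z ∈ T, z.1 < 0 ↔ z.2 < 0 := by
    intro z hz
    have := hT _ (T.neg_mem hz)
    simpa using this
  have hz0 : ∀ z ∈ T, z.1 = 0 ↔ z.2 = 0 := by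
    intro z hz
    have h1 := hT z hz
    have h2 := hneg z hz
    constructor
    · intro h
      rw [h] at h1 h2
      simp only [lt_irrefl, false_iff, not_lt] at h1 h2
      exact le_antisymm h1 h2
    · intro h
      rw [h] at h1 h2
      simp only [lt_irrefl, iff_false, not_lt] at h1 h2
      exact le_antisymm h1 h2
  have hinv : ∀ z ∈ T, (z.1⁻¹, z.2⁻¹) ∈ T := by
    rintro ⟨a, b⟩ hz
    by_cases ha : a = 0
    · have hb := (hz0 _ hz).1 ha
      simp only at hb
      simp only [ha, hb, inv_zero]
      exact T.zero_mem
    have hb : b ≠ 0 := fun h => ha ((hz0 _ hz).2 h)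
    refine hmax _ _ fun g => ?_
    rw [eval₂_inv_pos_iff _ _ ha, eval₂_inv_pos_iff _ _ hb]
    have h1 := hom_eval₂ (g.reverse * X ^ g.natDegree) T.subtype (RingHom.fst R R') (a, b)
    have h2 := hom_eval₂ (g.reverse * X ^ g.natDegree) T.subtype (RingHom.snd R R') (a, b)
    simp only [RingHom.coe_fst, RingHom.coe_snd] at h1 h2
    rw [← h1, ← h2]
    refine hT _ ?_
    have h3 := eval₂_at_apply (p := g.reverse * X ^ g.natDegree) T.subtype ⟨(a, b), hz⟩
    simp only [Subring.subtype_apply] at h3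
    rw [h3]
    exact Subtype.prop _
  have hfield : IsField T := by
    refine ⟨⟨0, 1, fun h => ?_⟩, mul_comm, ?_⟩
    · have := congrArg (fun z : T => z.1.1) h
      simp at this
    · rintro ⟨⟨a, b⟩, hz⟩ hne
      refine ⟨⟨_, hinv _ hz⟩, ?_⟩
      have ha : a ≠ 0 := by
        intro h
        have hb := (hz0 _ hz).1 h
        simp only at hb
        exact hne (by simp [h, hb])
      have hb : b ≠ 0 := fun h => ha ((hz0 _ hz).2 h)
      ext <;> simp [ha, hb]
  let i0 : T →+* R := (RingHom.fst R R').comp T.subtype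
  let iSnd : T →+* R' := (RingHom.snd R R').comp T.subtype
  have hinj : Function.Injective i0 := by
    rw [injective_iff_map_eq_zero]
    rintro ⟨⟨a, b⟩, hz⟩ (h : a = 0)
    have hb := (hz0 _ hz).1 h
    simp only at hb
    simp [h, hb]
  have hsurj : Function.Surjective i0 := by
    have : Countable T := hinj.countable
    refine surjective_of_maximal_of_isField hR hR' hfield i0 hinj iSnd (fun z => hT z.1 z.2) ?_ ?_
    · intro S S' h
      obtain ⟨y, h1, h2⟩ := hsat (iSnd '' S) (iSnd '' S')
        ((Set.countable_univ.mono (Set.subset_univ S)).image _)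
        ((Set.countable_univ.mono (Set.subset_univ S')).image _) (by
        rintro _ ⟨s, hs, rfl⟩ _ ⟨t, ht, rfl⟩
        exact h s hs t ht)
      exact ⟨y, fun s hs => h1 _ ⟨s, hs, rfl⟩, fun t ht => h2 _ ⟨t, ht, rfl⟩⟩
    · intro x y h
      exact ⟨⟨(x, y), hmax x y h⟩, rfl, rfl⟩
  exact ⟨iSnd.comp (RingEquiv.ofBijective i0 ⟨hinj, hsurj⟩).symm.toRingHom⟩

end Graph

end GraphTransfer

section Ultrapower

open Polynomial

open Filter

/-- The ultrapower of the reals. -/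
abbrev RealUltrapower := Germ (hyperfilter ℕ : Filter ℕ) ℝ

theorem PolyIVT.real : PolyIVT ℝ := by
  intro p a b hab h
  have hc : ContinuousOn (fun x => p.eval x) (Set.Icc a b) := p.continuous.continuousOn
  rcases mul_neg_iff.1 h with ⟨h1, h2⟩ | ⟨h1, h2⟩
  · obtain ⟨c, hc1, hc2⟩ := intermediate_value_Ioo' hab.le hc ⟨h2, h1⟩
    exact ⟨c, hc1.1, hc1.2, hc2⟩
  · obtain ⟨c, hc1, hc2⟩ := intermediate_value_Ioo hab.le hc ⟨h1, h2⟩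
    exact ⟨c, hc1.1, hc1.2, hc2⟩

theorem PolyIVT.germ : PolyIVT RealUltrapower := by
  intro p a b hab h
  let φ : (ℕ → ℝ) →+* RealUltrapower := Germ.coeRingHom _
  have hφ : Function.Surjective φ := fun z => by
    induction z using Germ.inductionOn with
    | h f => exact ⟨f, rfl⟩
  obtain ⟨q, rfl⟩ := Polynomial.map_surjective φ hφ p
  obtain ⟨a, rfl⟩ := hφ a
  obtain ⟨b, rfl⟩ := hφ b
  have hev : ∀ a : ℕ → ℝ, (q.map φ).eval (φ a) =
      φ (fun n => (q.map (Pi.evalRingHom _ n)).eval (a n)) := by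
    intro a
    rw [eval_map, eval₂_at_apply]
    congr 1
    ext n
    have := eval₂_at_apply (p := q) (Pi.evalRingHom (fun _ : ℕ => ℝ) n) a
    rw [eval_map]
    exact this.symm
  rw [hev, hev, ← map_mul] at h
  have hab' : ∀ᶠ n in (hyperfilter ℕ : Filter ℕ), a n < b n := Germ.coe_lt.1 hab
  have h' : ∀ᶠ n in (hyperfilter ℕ : Filter ℕ), (q.map (Pi.evalRingHom _ n)).eval (a n) *
      (q.map (Pi.evalRingHom _ n)).eval (b n) < 0 := Germ.coe_lt.1 h
  have key : ∀ n, ∃ c : ℝ, a n < b n → (q.map (Pi.evalRingHom _ n)).eval (a n) *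
      (q.map (Pi.evalRingHom _ n)).eval (b n) < 0 →
      a n < c ∧ c < b n ∧ (q.map (Pi.evalRingHom _ n)).eval c = 0 := by
    intro n
    by_cases h1 : a n < b n
    · by_cases h2 : (q.map (Pi.evalRingHom _ n)).eval (a n) *
        (q.map (Pi.evalRingHom _ n)).eval (b n) < 0
      · obtain ⟨c, hc⟩ := PolyIVT.real _ _ _ h1 h2
        exact ⟨c, fun _ _ => hc⟩
      · exact ⟨0, fun _ h => absurd h h2⟩
    · exact ⟨0, fun h => absurd h h1⟩
  choose c hc using key
  refine ⟨φ c, Germ.coe_lt.2 ?_, Germ.coe_lt.2 ?_, ?_⟩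
  · filter_upwards [hab', h'] with n h1 h2 using (hc n h1 h2).1
  · filter_upwards [hab', h'] with n h1 h2 using (hc n h1 h2).2.1
  · rw [hev]
    refine Germ.coe_eq.2 ?_
    filter_upwards [hab', h'] with n h1 h2 using (hc n h1 h2).2.2

theorem germ_saturated (S T : Set RealUltrapower) (hS : S.Countable) (hT : T.Countable)
    (hST : ∀ s ∈ S, ∀ t ∈ T, s < t) : ∃ y : RealUltrapower, (∀ s ∈ S, s < y) ∧ ∀ t ∈ T, y < t := by
  classical
  have : ∀ z : RealUltrapower, ∃ f : ℕ → ℝ, (f : RealUltrapower) = z := fun z => by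
    induction z using Germ.inductionOn with
    | h f => exact ⟨f, rfl⟩
  choose rep hrep using this
  obtain ⟨e, he⟩ := Set.countable_iff_exists_injOn.1 (hS.union hT)
  let good : ℕ → ℕ → ℝ → Prop := fun m n r =>
    (∀ s ∈ S, e s ≤ m → rep s n < r) ∧ ∀ t ∈ T, e t ≤ m → r < rep t n
  have hfin : ∀ m, {z | z ∈ S ∪ T ∧ e z ≤ m}.Finite := by
    intro m
    refine Set.Finite.of_finite_image ((Set.finite_Iic m).subset ?_)
      (he.mono fun z hz => hz.1)
    rintro _ ⟨z, hz, rfl⟩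
    exact hz.2
  have hev : ∀ m, ∀ᶠ n in (hyperfilter ℕ : Filter ℕ), ∃ r, good m n r := by
    intro m
    have h1 : ∀ᶠ n in (hyperfilter ℕ : Filter ℕ), ∀ s ∈ {z | z ∈ S ∪ T ∧ e z ≤ m},
        ∀ t ∈ {z | z ∈ S ∪ T ∧ e z ≤ m}, s ∈ S → t ∈ T → rep s n < rep t n := by
      rw [eventually_all_finite (hfin m)]
      intro s hs
      rw [eventually_all_finite (hfin m)]
      intro t ht
      by_cases hsS : s ∈ S
      · by_cases htT : t ∈ T
        · have := hST s hsS t htT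
          rw [← hrep s, ← hrep t] at this
          filter_upwards [Germ.coe_lt.1 this] with n hn _ _ using hn
        · simp [htT]
      · simp [hsS]
    filter_upwards [h1] with n hn
    obtain ⟨r, h2, h3⟩ := Order.exists_between_finsets
      (((hfin m).toFinset.filter (· ∈ S)).image fun s => rep s n)
      (((hfin m).toFinset.filter (· ∈ T)).image fun s => rep s n) (by
        simp only [Finset.mem_image, Finset.mem_filter, Set.Finite.mem_toFinset]
        rintro _ ⟨s, hs, rfl⟩ _ ⟨t, ht, rfl⟩
        exact hn s hs.1 t ht.1 hs.2 ht.2)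
    refine ⟨r, fun s hs hm => h2 _ ?_, fun t ht hm => h3 _ ?_⟩
    · exact Finset.mem_image_of_mem _ (by simp [hs, hm])
    · exact Finset.mem_image_of_mem _ (by simp [ht, hm])
  have hsel : ∀ n, ∃ r, ∀ m ≤ n, (∃ r, good m n r) → good m n r := by
    intro n
    by_cases h0 : ∃ m ≤ n, ∃ r, good m n r
    · obtain ⟨m0, hm0, h0⟩ := h0
      obtain ⟨r, hr⟩ := Nat.findGreatest_spec (P := fun m => ∃ r, good m n r) hm0 h0
      refine ⟨r, fun m hm h => ?_⟩
      have := Nat.le_findGreatest (P := fun m => ∃ r, good m n r) hm h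
      exact ⟨fun s hs hm => hr.1 s hs (hm.trans this), fun s hs hm => hr.2 s hs (hm.trans this)⟩
    · exact ⟨0, fun m hm h => absurd ⟨m, hm, h⟩ h0⟩
  choose y hy using hsel
  have hge : ∀ m, ∀ᶠ n in (hyperfilter ℕ : Filter ℕ), m ≤ n := fun m =>
    (Nat.hyperfilter_le_atTop) (eventually_ge_atTop m)
  refine ⟨(y : RealUltrapower), fun s hs => ?_, fun t ht => ?_⟩
  · rw [← hrep s]
    refine Germ.coe_lt.2 ?_
    filter_upwards [hev (e s), hge (e s)] with n h1 h2
    exact (hy n _ h2 h1).1 s hs le_rfl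
  · rw [← hrep t]
    refine Germ.coe_lt.2 ?_
    filter_upwards [hev (e t), hge (e t)] with n h1 h2
    exact (hy n _ h2 h1).2 t ht le_rfl

/-- Countable ordered fields satisfying the intermediate value theorem embed into an ultrapower
of the reals. -/
theorem PolyIVT.exists_ringHom_germ {M : Type} [Field M] [LinearOrder M] [IsStrictOrderedRing M]
    (hM : PolyIVT M) {S : Set M} (hS : S.Countable) :
    ∃ (A : Subfield M), S ⊆ A ∧ Nonempty (A →+* RealUltrapower) := by
  let E : Subfield M := Subfield.closure S
  have hE : Countable E := by
    have := Subfield.cardinalMk_closure_le_max S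
    rw [← Cardinal.mk_le_aleph0_iff]
    refine this.trans (max_le ?_ le_rfl)
    exact Cardinal.le_aleph0_iff_set_countable.2 hS
  let A := algebraicClosure E M
  have hA : Countable A := by
    have := Algebra.IsAlgebraic.cardinalMk_le_max E A
    rw [← Cardinal.mk_le_aleph0_iff]
    exact this.trans (max_le (Cardinal.mk_le_aleph0_iff.2 hE) le_rfl)
  have hAI : PolyIVT A := by
    intro p a b hab h
    have hev : ∀ a : A, (p.map (algebraMap A M)).eval (a : M) = ((p.eval a : A) : M) := by
      intro a
      rw [eval_map]
      exact eval₂_at_apply (algebraMap A M) a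
    obtain ⟨c, h1, h2, h3⟩ := hM (p.map (algebraMap A M)) a b hab (by
      rw [hev, hev]; exact h)
    have hp : p ≠ 0 := by rintro rfl; simp at h
    have hcA : IsAlgebraic A c := ⟨p, hp, by rwa [eval_map] at h3⟩
    have hcE : IsAlgebraic E c := hcA.restrictScalars E
    have hc : c ∈ A := mem_algebraicClosure_iff.2 hcE
    refine ⟨⟨c, hc⟩, h1, h2, ?_⟩
    have := hev ⟨c, hc⟩
    rw [h3] at this
    exact Subtype.ext this.symm
  obtain ⟨φ⟩ := exists_orderEmbedding_of_saturated hAI PolyIVT.germ germ_saturated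
  refine ⟨A.toSubfield, fun s hs => ?_, ⟨φ⟩⟩
  exact A.algebraMap_mem ⟨s, Subfield.subset_closure hs⟩

end Ultrapower

/-- The Artin–Lang theorem for systems over `ℚ`. -/
theorem artin_lang {F : Type} [Field F] [Algebra ℚ F] (hF : ¬ IsSumSq (-1 : F)) {ι : Type}
    [Countable ι]
    (x : ι → F) (E G : Finset (MvPolynomial ι ℚ))
    (hE : ∀ f ∈ E, MvPolynomial.aeval x f = 0) (hG : ∀ f ∈ G, MvPolynomial.aeval x f ≠ 0) :
    ∃ y : ι → ℝ, (∀ f ∈ E, MvPolynomial.aeval y f = 0) ∧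
      ∀ f ∈ G, MvPolynomial.aeval y f ≠ 0 := by
  obtain ⟨M, _, _, _, ⟨θ⟩, hM⟩ := exists_polyIVT_extension hF
  obtain ⟨A, hA, ⟨φ⟩⟩ := hM.exists_ringHom_germ (Set.countable_range fun i => θ (x i))
  let z : ι → A := fun i => ⟨θ (x i), hA ⟨i, rfl⟩⟩
  choose y hy using fun i => (Filter.Germ.inductionOn (φ (z i)) fun f => ⟨f, rfl⟩ :
    ∃ f : ℕ → ℝ, (f : Filter.Germ (Filter.hyperfilter ℕ : Filter ℕ) ℝ) = φ (z i))
  have key : ∀ f : MvPolynomial ι ℚ, MvPolynomial.aeval x f = 0 ↔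
      ∀ᶠ n in (Filter.hyperfilter ℕ : Filter ℕ), MvPolynomial.aeval (fun i => y i n) f = 0 := by
    intro f
    let ψ : (ℕ → ℝ) →+* Filter.Germ (Filter.hyperfilter ℕ : Filter ℕ) ℝ :=
      Filter.Germ.coeRingHom _
    have h1 : θ (MvPolynomial.aeval x f) = ((MvPolynomial.aeval z f : A) : M) := by
      rw [MvPolynomial.aeval_def, MvPolynomial.aeval_def, MvPolynomial.hom_eval₂]
      have := MvPolynomial.hom_eval₂ f (algebraMap ℚ A) A.subtype z
      refine Eq.trans ?_ this.symm
      congr 1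
      exact Subsingleton.elim _ _
    have h2 : φ (MvPolynomial.aeval z f) = ψ (MvPolynomial.aeval y f) := by
      rw [MvPolynomial.aeval_def, MvPolynomial.aeval_def, MvPolynomial.hom_eval₂,
        MvPolynomial.hom_eval₂]
      congr 1
      · exact Subsingleton.elim _ _
      · ext i; exact (hy i).symm
    have h3 : ∀ n, MvPolynomial.aeval y f n = MvPolynomial.aeval (fun i => y i n) f := by
      intro n
      have := MvPolynomial.hom_eval₂ f (algebraMap ℚ (ℕ → ℝ)) (Pi.evalRingHom _ n) y
      rw [MvPolynomial.aeval_def, MvPolynomial.aeval_def]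
      refine this.trans ?_
      congr 1
    rw [← map_eq_zero_iff θ θ.injective, h1, ZeroMemClass.coe_eq_zero,
      ← map_eq_zero_iff φ φ.injective, h2]
    simp only [← h3]
    exact Filter.Germ.coe_eq
  have hall : ∀ᶠ n in (Filter.hyperfilter ℕ : Filter ℕ),
      (∀ f ∈ E, MvPolynomial.aeval (fun i => y i n) f = 0) ∧
      ∀ f ∈ G, MvPolynomial.aeval (fun i => y i n) f ≠ 0 := by
    refine Filter.Eventually.and ?_ ?_
    · rw [Filter.eventually_all_finset]
      exact fun f hf => (key f).1 (hE f hf)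
    · rw [Filter.eventually_all_finset]
      intro f hf
      have := mt (key f).2 (hG f hf)
      exact Ultrafilter.eventually_not.2 this
  obtain ⟨n, hn⟩ := hall.exists
  exact ⟨fun i => y i n, hn⟩

section PowerSeriesHensel

variable {V K : Type*} [Field K]

/-- The ideal of power series of order at least `n`. -/
noncomputable def orderIdeal (V K : Type*) [Field K] (n : ℕ) : Ideal (MvPowerSeries V K) where
  carrier := {f | (n : ℕ∞) ≤ f.order}
  add_mem' ha hb := (le_min ha hb).trans MvPowerSeries.min_order_le_add
  zero_mem' := by simp
  smul_mem' c f hf := (le_trans hf le_add_self).trans MvPowerSeries.le_order_mul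

theorem mem_orderIdeal {n : ℕ} {f : MvPowerSeries V K} :
    f ∈ orderIdeal V K n ↔ (n : ℕ∞) ≤ f.order := Iff.rfl

theorem mem_orderIdeal_iff {n : ℕ} {f : MvPowerSeries V K} :
    f ∈ orderIdeal V K n ↔ ∀ d, Finsupp.degree d < n → MvPowerSeries.coeff d f = 0 := by
  rw [mem_orderIdeal]
  refine ⟨fun h d hd => MvPowerSeries.coeff_of_lt_order (lt_of_lt_of_le ?_ h),
    MvPowerSeries.nat_le_order⟩
  exact_mod_cast hd

theorem mem_orderIdeal_one {f : MvPowerSeries V K} :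
    f ∈ orderIdeal V K 1 ↔ MvPowerSeries.constantCoeff f = 0 := by
  rw [mem_orderIdeal]
  exact_mod_cast MvPowerSeries.one_le_order_iff_constCoeff_eq_zero

theorem mul_mem_orderIdeal {a b : ℕ} {f g : MvPowerSeries V K} (hf : f ∈ orderIdeal V K a)
    (hg : g ∈ orderIdeal V K b) : f * g ∈ orderIdeal V K (a + b) := by
  rw [mem_orderIdeal] at *
  push_cast
  exact (add_le_add hf hg).trans MvPowerSeries.le_order_mul

theorem orderIdeal_anti {a b : ℕ} (h : a ≤ b) : orderIdeal V K b ≤ orderIdeal V K a :=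
  fun f hf => le_trans (by exact_mod_cast h) (mem_orderIdeal.1 hf)

theorem eq_zero_of_forall_mem_orderIdeal {f : MvPowerSeries V K}
    (h : ∀ n, f ∈ orderIdeal V K n) : f = 0 := by
  ext d
  exact mem_orderIdeal_iff.1 (h (Finsupp.degree d + 1)) d (Nat.lt_succ_self _)

/-- Hensel's lemma for multivariate power series. -/
theorem MvPowerSeries.exists_root (f : Polynomial (MvPowerSeries V K)) (b : K)
    (hb : (f.map MvPowerSeries.constantCoeff).eval b = 0)
    (hb' : (f.map MvPowerSeries.constantCoeff).derivative.eval b ≠ 0) :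
    ∃ Y : MvPowerSeries V K, f.eval Y = 0 ∧ MvPowerSeries.constantCoeff Y = b := by
  set u := (f.map MvPowerSeries.constantCoeff).derivative.eval b
  let Y : ℕ → MvPowerSeries V K := fun n =>
    Nat.rec (MvPowerSeries.C b) (fun _ y => y - MvPowerSeries.C u⁻¹ * f.eval y) n
  have hY : ∀ n, Y (n + 1) = Y n - MvPowerSeries.C u⁻¹ * f.eval (Y n) := fun n => rfl
  have hcc : ∀ (g : Polynomial (MvPowerSeries V K)) y, MvPowerSeries.constantCoeff y = b →
      MvPowerSeries.constantCoeff (g.eval y) =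
        (g.map MvPowerSeries.constantCoeff).eval b := by
    intro g y hy
    rw [← hy, Polynomial.eval_map, Polynomial.eval₂_at_apply]
  have key : ∀ n, MvPowerSeries.constantCoeff (Y n) = b ∧ f.eval (Y n) ∈ orderIdeal V K (n + 1) := by
    intro n
    induction n with
    | zero =>
      have h0 : MvPowerSeries.constantCoeff (Y 0) = b := by simp [Y]
      exact ⟨h0, mem_orderIdeal_one.2 (by rw [hcc _ _ h0, hb])⟩
    | succ n ih =>
      obtain ⟨h1, h2⟩ := ih
      have h3 : MvPowerSeries.constantCoeff (f.eval (Y n)) = 0 := by rw [hcc _ _ h1, hb]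
      refine ⟨by rw [hY]; simp [h1, h3], ?_⟩
      obtain ⟨k, hk⟩ := Polynomial.binomExpansion f (Y n) (-(MvPowerSeries.C u⁻¹ * f.eval (Y n)))
      rw [hY, sub_eq_add_neg, hk]
      have e : f.eval (Y n) + f.derivative.eval (Y n) * -(MvPowerSeries.C u⁻¹ * f.eval (Y n)) +
          k * (-(MvPowerSeries.C u⁻¹ * f.eval (Y n))) ^ 2 =
          f.eval (Y n) * (1 - MvPowerSeries.C u⁻¹ * f.derivative.eval (Y n)) +
          (k * MvPowerSeries.C u⁻¹ ^ 2) * (f.eval (Y n) * f.eval (Y n)) := by ring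
      rw [e]
      refine Ideal.add_mem _ (mul_mem_orderIdeal h2 (mem_orderIdeal_one.2 ?_))
        (Ideal.mul_mem_left _ _ (orderIdeal_anti (by omega) (mul_mem_orderIdeal h2 h2)))
      rw [map_sub, map_one, map_mul, hcc _ _ h1, ← Polynomial.derivative_map,
        MvPowerSeries.constantCoeff_C]
      rw [inv_mul_cancel₀ hb', sub_self]
  have hstep : ∀ n, Y (n + 1) - Y n ∈ orderIdeal V K (n + 1) := by
    intro n
    rw [hY, sub_sub_cancel_left]
    exact neg_mem (Ideal.mul_mem_left _ _ (key n).2)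
  have hdiff : ∀ n m, n ≤ m → Y m - Y n ∈ orderIdeal V K (n + 1) := by
    intro n m h
    induction m, h using Nat.le_induction with
    | base => simp
    | succ m h ih =>
      have := Ideal.add_mem _ (orderIdeal_anti (by omega) (hstep m)) ih
      simpa using this
  let L : MvPowerSeries V K := fun d => MvPowerSeries.coeff d (Y (Finsupp.degree d))
  have hL : ∀ d, MvPowerSeries.coeff d L = MvPowerSeries.coeff d (Y (Finsupp.degree d)) :=
    fun d => rfl
  have hLY : ∀ n, L - Y n ∈ orderIdeal V K (n + 1) := by
    intro n
    rw [mem_orderIdeal_iff]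
    intro d hd
    have := mem_orderIdeal_iff.1 (hdiff (Finsupp.degree d) n (by omega)) d (by omega)
    rw [map_sub, sub_eq_zero] at this
    rw [map_sub, hL, this, sub_self]
  refine ⟨L, eq_zero_of_forall_mem_orderIdeal fun n => ?_, ?_⟩
  · obtain ⟨k, hk⟩ := Polynomial.evalSubFactor f L (Y n)
    have h1 : f.eval L = f.eval (Y n) + k * (L - Y n) := by rw [← hk]; ring
    rw [h1]
    exact orderIdeal_anti (Nat.le_succ n)
      (Ideal.add_mem _ (key n).2 (Ideal.mul_mem_left _ _ (hLY n)))
  · have h1 := mem_orderIdeal_one.1 (hLY 0)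
    rw [map_sub, sub_eq_zero] at h1
    rw [h1, (key 0).1]

end PowerSeriesHensel

section LocalStructure

open MvPolynomial

/-- A polynomial in one distinguished variable and a family `V` of variables, specialised at `x`
to a univariate polynomial. -/
noncomputable def uniPoly {K R V : Type*} [CommRing K] [CommRing R] [Algebra K R] (x : V → R)
    (q : MvPolynomial (Option V) K) : Polynomial R :=
  aeval (fun o : Option V => o.elim Polynomial.X fun v => Polynomial.C (x v)) q

variable {K R V W : Type*}

section uniPoly

variable [CommRing K] [CommRing R] [Algebra K R]

theorem eval_uniPoly (x : V → R) (q : MvPolynomial (Option V) K) (y : R) :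
    (uniPoly x q).eval y = aeval (fun o : Option V => o.elim y x) q := by
  induction q using MvPolynomial.induction_on with
  | C a => simp [uniPoly, IsScalarTower.algebraMap_apply K R (Polynomial R)]
  | add p q hp hq => simp_all [uniPoly]
  | mul_X p i hp => cases i <;> simp_all [uniPoly]

theorem derivative_uniPoly (x : V → R) (q : MvPolynomial (Option V) K) :
    (uniPoly x q).derivative = uniPoly x (pderiv none q) := by
  classical
  induction q using MvPolynomial.induction_on with
  | C a => simp [uniPoly, IsScalarTower.algebraMap_apply K R (Polynomial R)]
  | add p q hp hq => simp_all [uniPoly]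
  | mul_X p i hp =>
    cases i with
    | none => simp_all [uniPoly]; ring
    | some v => simp_all [uniPoly, pderiv_X]; ring

theorem map_uniPoly {S : Type*} [CommRing S] [Algebra K S] (φ : R →ₐ[K] S) (x : V → R)
    (q : MvPolynomial (Option V) K) :
    (uniPoly x q).map (φ : R →+* S) = uniPoly (fun v => φ (x v)) q := by
  induction q using MvPolynomial.induction_on with
  | C a => simp [uniPoly, IsScalarTower.algebraMap_apply K R (Polynomial R), IsScalarTower.algebraMap_apply K S (Polynomial S)]
  | add p q hp hq => simp_all [uniPoly]
  | mul_X p i hp => cases i <;> simp_all [uniPoly]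

end uniPoly

/-- The embedding of variables giving the `w`-th equation. -/
def eqVar (V : Type*) {W : Type*} (w : W) : Option V → V ⊕ W := fun o => o.elim (Sum.inr w) Sum.inl

/-- The ideal of the equations `q w (t, y_w) = 0`. -/
noncomputable def eqIdeal {K V W : Type*} [CommRing K] (q : W → MvPolynomial (Option V) K) :
    Ideal (MvPolynomial (V ⊕ W) K) :=
  Ideal.span (Set.range fun w => rename (eqVar V w) (q w))

theorem aeval_eqVar [CommRing K] [CommRing R] [Algebra K R] (x : V ⊕ W → R) (w : W)
    (q : MvPolynomial (Option V) K) :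
    aeval x (rename (eqVar V w) q) = aeval (fun o : Option V => o.elim (x (Sum.inr w))
      fun v => x (Sum.inl v)) q := by
  rw [aeval_rename]
  congr 2
  funext o
  cases o <;> rfl

theorem exists_powerSeries [Field K] (τ : V → K) (b : K) (q : MvPolynomial (Option V) K)
    (h0 : aeval (fun o : Option V => o.elim b τ) q = 0)
    (h1 : aeval (fun o : Option V => o.elim b τ) (pderiv none q) ≠ 0) :
    ∃ Y : MvPowerSeries V K, aeval (fun o : Option V => o.elim Y
      fun v => MvPowerSeries.C (τ v) + MvPowerSeries.X v) q = 0 ∧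
      MvPowerSeries.constantCoeff Y = b := by
  have hm : (uniPoly (fun v => (MvPowerSeries.C (τ v) + MvPowerSeries.X v : MvPowerSeries V K))
      q).map MvPowerSeries.constantCoeff = uniPoly τ q := by
    let φ : MvPowerSeries V K →ₐ[K] K :=
      { (MvPowerSeries.constantCoeff : MvPowerSeries V K →+* K) with
        commutes' := fun r => by simp [MvPowerSeries.algebraMap_apply] }
    have := map_uniPoly φ (fun v => (MvPowerSeries.C (τ v) + MvPowerSeries.X v :
      MvPowerSeries V K)) q
    have e : (fun v => φ (MvPowerSeries.C (τ v) + MvPowerSeries.X v : MvPowerSeries V K)) = τ := by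
      funext v
      change MvPowerSeries.constantCoeff _ = _
      simp
    rw [e] at this
    exact this
  obtain ⟨Y, hY, hY'⟩ := MvPowerSeries.exists_root (uniPoly (fun v => (MvPowerSeries.C (τ v) +
    MvPowerSeries.X v : MvPowerSeries V K)) q) b (by rw [hm, eval_uniPoly, h0])
    (by rwa [hm, derivative_uniPoly, eval_uniPoly])
  exact ⟨Y, by rwa [eval_uniPoly] at hY, hY'⟩

section

variable [Field K] (τ : V → K) (b : W → K) (Y : W → MvPowerSeries V K)

/-- The evaluation of polynomials at the formal solution. -/
noncomputable def formalEval : MvPolynomial (V ⊕ W) K →ₐ[K] MvPowerSeries V K :=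
  aeval (Sum.elim (fun v => MvPowerSeries.C (τ v) + MvPowerSeries.X v) Y)

/-- The maximal ideal of the base point. -/
noncomputable def pointIdeal : Ideal (MvPolynomial (V ⊕ W) K) :=
  RingHom.ker (aeval (R := K) (Sum.elim τ b))

theorem mem_pointIdeal {f : MvPolynomial (V ⊕ W) K} :
    f ∈ pointIdeal τ b ↔ aeval (Sum.elim τ b) f = 0 := RingHom.mem_ker

theorem mem_of_mul_mem {A : Type*} [CommRing A] {J m : Ideal A} {N : ℕ} (hJ : m ^ N ≤ J) {r x : A} (hr : r ∈ m)
    (h : (1 - r) * x ∈ J) : x ∈ J := by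
  have h1 : (1 - r ^ N) * x ∈ J := by
    have : (1 - r) ∣ (1 - r ^ N) := by simpa using sub_dvd_pow_sub_pow 1 r N
    obtain ⟨c, hc⟩ := this
    rw [hc, mul_right_comm]
    exact J.mul_mem_right _ h
  have h2 : r ^ N * x ∈ J := J.mul_mem_right _ (hJ (Ideal.pow_mem_pow hr N))
  have : x = (1 - r ^ N) * x + r ^ N * x := by ring
  rw [this]
  exact J.add_mem h1 h2

theorem mem_of_formalEval_eq_zero [Finite V] (q : W → MvPolynomial (Option V) K)
    (h1 : ∀ w, aeval (fun o : Option V => o.elim (b w) τ) (pderiv none (q w)) ≠ 0)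
    (hY : ∀ w, aeval (fun o : Option V => o.elim (Y w)
      fun v => MvPowerSeries.C (τ v) + MvPowerSeries.X v) (q w) = 0)
    (hb : ∀ w, MvPowerSeries.constantCoeff (Y w) = b w)
    (h : MvPolynomial (V ⊕ W) K) (hh : formalEval τ Y h = 0) (N : ℕ) (hN : N ≠ 0) :
    h ∈ eqIdeal q ⊔ pointIdeal τ b ^ N := by
  set J := eqIdeal q ⊔ pointIdeal τ b ^ N
  let T : W → MvPolynomial V K := fun w => MvPowerSeries.truncTotal N (Y w)
  let ρ : MvPolynomial (V ⊕ W) K →ₐ[K] MvPolynomial V K := aeval (Sum.elim (fun v => X v + C (τ v)) T)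
  let ι : MvPolynomial V K →ₐ[K] MvPolynomial (V ⊕ W) K :=
    aeval (fun v => X (Sum.inl v) - C (τ v))
  have hρ : ∀ g, (ρ g : MvPowerSeries V K) - formalEval τ Y g ∈ orderIdeal V K N := by
    intro g
    rw [← Ideal.Quotient.eq]
    let a1 : MvPolynomial (V ⊕ W) K →ₐ[K] (MvPowerSeries V K ⧸ orderIdeal V K N) :=
      (Ideal.Quotient.mkₐ K (orderIdeal V K N)).comp
        ((MvPolynomial.coeToMvPowerSeries.algHom K).comp ρ)
    let a2 : MvPolynomial (V ⊕ W) K →ₐ[K] (MvPowerSeries V K ⧸ orderIdeal V K N) :=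
      (Ideal.Quotient.mkₐ K (orderIdeal V K N)).comp (formalEval τ Y)
    have : a1 = a2 := by
      apply MvPolynomial.algHom_ext
      rintro (v | w)
      · simp [a1, a2, ρ, formalEval, add_comm]
      · simp only [a1, a2, ρ, formalEval, AlgHom.comp_apply, aeval_X, Sum.elim_inr]
        refine Ideal.Quotient.eq.2 (mem_orderIdeal_iff.2 fun d hd => ?_)
        simp [T, MvPowerSeries.coeff_truncTotal _ hd]
    have := congrArg (fun a => a g) this
    simpa [a1, a2] using this
  have hιm : ∀ f : MvPolynomial V K, f ∈ idealOfVars V K ^ N → ι f ∈ pointIdeal τ b ^ N := by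
    intro f hf
    have : (idealOfVars V K).map ι ≤ pointIdeal τ b := by
      rw [idealOfVars, Ideal.map_span, Ideal.span_le]
      rintro _ ⟨_, ⟨v, rfl⟩, rfl⟩
      rw [SetLike.mem_coe, mem_pointIdeal]
      simp [ι]
    exact Ideal.pow_right_mono this N (by rw [← Ideal.map_pow]; exact Ideal.mem_map_of_mem _ hf)
  have hzero : ∀ g, formalEval τ Y g = 0 → ι (ρ g) ∈ pointIdeal τ b ^ N := by
    intro g hg
    apply hιm
    have := hρ g
    rw [hg, sub_zero, mem_orderIdeal_iff] at this
    rw [mem_pow_idealOfVars_iff]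
    intro d hd
    by_contra! hlt
    have h2 := this d hlt
    rw [MvPolynomial.coeff_coe] at h2
    exact (MvPolynomial.mem_support_iff.1 hd) h2
  have hiota : ∀ v, ι (ρ (X (Sum.inl v))) = X (Sum.inl v) := by
    intro v; simp [ι, ρ]
  have hT : ∀ w, X (Sum.inr w) - ι (T w) ∈ J := by
    intro w
    set P : Polynomial (MvPolynomial (V ⊕ W) K) :=
      uniPoly (fun v => (X (Sum.inl v) : MvPolynomial (V ⊕ W) K)) (q w) with hP
    have e1 : P.eval (X (Sum.inr w)) ∈ J := by
      rw [hP, eval_uniPoly]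
      refine Ideal.mem_sup_left (Ideal.subset_span ⟨w, ?_⟩)
      change rename (eqVar V w) (q w) = _
      rw [← aeval_X_left_apply (rename (eqVar V w) (q w)), aeval_eqVar]
    have e2 : P.eval (ι (T w)) ∈ J := by
      refine Ideal.mem_sup_right ?_
      have := hzero (rename (eqVar V w) (q w)) (by
        rw [formalEval, aeval_eqVar]; simpa using hY w)
      rw [hP, eval_uniPoly]
      convert this using 1
      rw [← AlgHom.comp_apply, ← aeval_X_left_apply (rename (eqVar V w) (q w)),
        ← AlgHom.comp_apply]
      have e : ((ι.comp ρ).comp (aeval X)) = aeval (fun i => ι (ρ (X i))) := by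
        apply MvPolynomial.algHom_ext
        intro i
        simp
      rw [e, aeval_eqVar]
      congr 2
      funext o
      cases o with
      | none => simp [ρ]
      | some v => simp [hiota]
    obtain ⟨k, hk⟩ := Polynomial.binomExpansion P (ι (T w)) (X (Sum.inr w) - ι (T w))
    rw [add_sub_cancel] at hk
    set z := X (Sum.inr w) - ι (T w) with hz
    set u := P.derivative.eval (ι (T w)) + k * z with hu
    have e3 : u * z ∈ J := by
      have : u * z = P.eval (X (Sum.inr w)) - P.eval (ι (T w)) := by rw [hk, hu]; ring
      rw [this]
      exact J.sub_mem e1 e2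
    have hιT : aeval (Sum.elim τ b) (ι (T w)) = b w := by
      have : ((aeval (Sum.elim τ b)).comp ι : MvPolynomial V K →ₐ[K] K) = aeval (fun _ => 0) := by
        apply MvPolynomial.algHom_ext
        intro v; simp [ι]
      rw [← AlgHom.comp_apply, this]
      rw [← hb w, aeval_def, eval₂_zero'_apply]
      simp [T, MvPowerSeries.constantCoeff_truncTotal_eq_ite, Nat.pos_of_ne_zero hN]
    have hzδ : aeval (Sum.elim τ b) z = 0 := by
      rw [hz, map_sub, hιT]; simp
    have huδ : aeval (Sum.elim τ b) u ≠ 0 := by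
      rw [hu, map_add, map_mul, hzδ, mul_zero, add_zero, hP, derivative_uniPoly, eval_uniPoly]
      convert h1 w using 1
      rw [← AlgHom.comp_apply]
      congr 1
      apply MvPolynomial.algHom_ext
      rintro (_ | v)
      · simpa using hιT
      · simp
    refine mem_of_mul_mem (m := pointIdeal τ b) (N := N) le_sup_right
      (r := 1 - C (aeval (Sum.elim τ b) u)⁻¹ * u) ?_ ?_
    · rw [mem_pointIdeal]
      rw [map_sub, map_one, map_mul, algHom_C, Algebra.algebraMap_self, RingHom.id_apply,
        inv_mul_cancel₀ huδ, sub_self]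
    · rw [sub_sub_cancel, mul_assoc]
      exact J.mul_mem_left _ e3
  have hfin : ι (ρ h) - h ∈ J := by
    rw [← Ideal.Quotient.eq]
    have : (Ideal.Quotient.mkₐ K J).comp (ι.comp ρ) = Ideal.Quotient.mkₐ K J := by
      apply MvPolynomial.algHom_ext
      rintro (v | w)
      · simp only [AlgHom.comp_apply, hiota]
      · simp only [AlgHom.comp_apply]
        refine Ideal.Quotient.eq.2 ?_
        have : ρ (X (Sum.inr w)) = T w := by simp [ρ]
        rw [this, ← neg_sub]
        exact J.neg_mem (hT w)
    exact congrArg (fun a => a h) this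
  have := J.sub_mem (Ideal.mem_sup_right (hzero h hh)) hfin
  rwa [sub_sub_cancel] at this

theorem exists_mul_mem_eqIdeal [Finite V] [Finite W] (q : W → MvPolynomial (Option V) K)
    (h1 : ∀ w, aeval (fun o : Option V => o.elim (b w) τ) (pderiv none (q w)) ≠ 0)
    (hY : ∀ w, aeval (fun o : Option V => o.elim (Y w)
      fun v => MvPowerSeries.C (τ v) + MvPowerSeries.X v) (q w) = 0)
    (hb : ∀ w, MvPowerSeries.constantCoeff (Y w) = b w)
    (h : MvPolynomial (V ⊕ W) K) (hh : formalEval τ Y h = 0) :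
    ∃ S : MvPolynomial (V ⊕ W) K, aeval (Sum.elim τ b) S ≠ 0 ∧ S * h ∈ eqIdeal q := by
  have key : Ideal.Quotient.mk (eqIdeal q) h ∈ ⨅ i : ℕ, (pointIdeal τ b ^ i •
      (⊤ : Submodule (MvPolynomial (V ⊕ W) K) (MvPolynomial (V ⊕ W) K ⧸ eqIdeal q))) := by
    rw [Submodule.mem_iInf]
    intro N
    have := mem_of_formalEval_eq_zero τ b Y q h1 hY hb h hh (N + 1) (by simp)
    obtain ⟨x, hx, y, hy, e⟩ := Submodule.mem_sup.1 this
    have e2 : Ideal.Quotient.mk (eqIdeal q) h = y • (1 : MvPolynomial (V ⊕ W) K ⧸ eqIdeal q) := by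
      rw [← e, map_add, Ideal.Quotient.eq_zero_iff_mem.2 hx, zero_add]
      change _ = Ideal.Quotient.mk (eqIdeal q) (y • 1)
      rw [smul_eq_mul, mul_one]
    rw [e2]
    exact Submodule.smul_mem_smul (Ideal.pow_le_pow_right (Nat.le_succ N) hy) trivial
  rw [Ideal.mem_iInf_smul_pow_eq_bot_iff] at key
  obtain ⟨r, hr⟩ := key
  have hr' := mem_pointIdeal (τ := τ) (b := b) |>.1 r.2
  refine ⟨1 - r, by rw [map_sub, hr', map_one, sub_zero]; exact one_ne_zero, ?_⟩
  rw [← Ideal.Quotient.eq_zero_iff_mem, sub_mul, one_mul, map_sub, sub_eq_zero]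
  exact hr.symm

end

end LocalStructure

section Descent

open MvPolynomial

variable {k K σ ι : Type*} [Field k] [Field K] [Algebra k K]

/-- Applying a linear functional to all coefficients. -/
noncomputable def coeffFunctional (l : K →ₗ[k] k) (f : MvPolynomial σ K) : MvPolynomial σ k :=
  ∑ m ∈ f.support, monomial m (l (coeff m f))

theorem coeff_coeffFunctional (l : K →ₗ[k] k) (f : MvPolynomial σ K) (m : σ →₀ ℕ) :
    coeff m (coeffFunctional l f) = l (coeff m f) := by
  classical
  rw [coeffFunctional, coeff_sum]
  simp only [coeff_monomial]
  rw [Finset.sum_ite_eq']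
  split_ifs with h
  · rfl
  · rw [notMem_support_iff.1 h, map_zero]

theorem coeffFunctional_mul (l : K →ₗ[k] k) (f : MvPolynomial σ K) (g : MvPolynomial σ k) :
    coeffFunctional l (f * map (algebraMap k K) g) = coeffFunctional l f * g := by
  classical
  ext m
  rw [coeff_coeffFunctional, coeff_mul, coeff_mul, map_sum]
  refine Finset.sum_congr rfl fun x _ => ?_
  rw [coeff_map, coeff_coeffFunctional, mul_comm, ← Algebra.smul_def, map_smul, smul_eq_mul,
    mul_comm]

theorem coeffFunctional_mem (l : K →ₗ[k] k) (F : ι → MvPolynomial σ k) (f : MvPolynomial σ K)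
    (hf : f ∈ Ideal.span (Set.range fun i => map (algebraMap k K) (F i))) :
    coeffFunctional l f ∈ Ideal.span (Set.range F) := by
  suffices ∀ c, coeffFunctional l (c * f) ∈ Ideal.span (Set.range F) by simpa using this 1
  induction hf using Submodule.span_induction with
  | mem x hx =>
    obtain ⟨i, rfl⟩ := hx
    intro c
    rw [coeffFunctional_mul]
    exact Ideal.mul_mem_left _ _ (Ideal.subset_span ⟨i, rfl⟩)
  | zero =>
    intro c
    have : coeffFunctional l (c * 0 : MvPolynomial σ K) = 0 := by
      ext m; simp [coeff_coeffFunctional]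
    rw [this]
    exact zero_mem _
  | add x y _ _ hx hy =>
    intro c
    have : coeffFunctional l (c * (x + y)) = coeffFunctional l (c * x) + coeffFunctional l (c * y) := by
      ext m; simp [coeff_coeffFunctional, mul_add]
    rw [this]
    exact add_mem (hx c) (hy c)
  | smul a x _ hx =>
    intro c
    rw [smul_eq_mul, ← mul_assoc]
    exact hx _

theorem exists_aeval_coeffFunctional_ne_zero (δ : σ → K) (S : MvPolynomial σ K)
    (hS : aeval δ S ≠ 0) : ∃ l : K →ₗ[k] k, aeval δ (coeffFunctional l S) ≠ 0 := by
  classical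
  by_contra! h
  apply hS
  let e := Module.Basis.ofVectorSpace k K
  let B : Finset (Module.Basis.ofVectorSpaceIndex k K) := S.support.biUnion fun m => (e.repr (coeff m S)).support
  have h1 : ∀ m ∈ S.support, coeff m S = ∑ i ∈ B, e.repr (coeff m S) i • e i := by
    intro m hm
    conv_lhs => rw [← e.linearCombination_repr (coeff m S), Finsupp.linearCombination_apply]
    refine Finset.sum_subset (s₁ := (e.repr (coeff m S)).support)
      (fun i hi => Finset.mem_biUnion.2 ⟨m, hm, hi⟩) fun i _ hi => ?_
    rw [Finsupp.notMem_support_iff.1 hi]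
    exact zero_smul _ _
  have h2 : ∀ i, ∑ m ∈ S.support, algebraMap k K (e.repr (coeff m S) i) * m.prod (fun v n => δ v ^ n) = 0 := by
    intro i
    have := h (e.coord i)
    rw [coeffFunctional, map_sum] at this
    simpa [aeval_monomial] using this
  rw [aeval_def, eval₂_eq]
  simp only [Algebra.algebraMap_self, RingHom.id_apply]
  calc _ = ∑ m ∈ S.support, ∑ i ∈ B, e i * (algebraMap k K (e.repr (coeff m S) i) * m.prod (fun v n => δ v ^ n)) := by
        refine Finset.sum_congr rfl fun m hm => ?_
        conv_lhs => rw [h1 m hm]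
        rw [Finset.sum_mul]
        refine Finset.sum_congr rfl fun i _ => ?_
        rw [Algebra.smul_def, mul_comm _ (e i), mul_assoc]
        rfl
    _ = 0 := by
        rw [Finset.sum_comm]
        refine Finset.sum_eq_zero fun i _ => ?_
        rw [← Finset.mul_sum, h2, mul_zero]

theorem exists_mul_mem_span_of_map (δ : σ → K) (F : ι → MvPolynomial σ k) (h : MvPolynomial σ k)
    (S : MvPolynomial σ K) (hS : aeval δ S ≠ 0)
    (hh : S * map (algebraMap k K) h ∈
      Ideal.span (Set.range fun i => map (algebraMap k K) (F i))) :
    ∃ S' : MvPolynomial σ k, aeval δ S' ≠ 0 ∧ S' * h ∈ Ideal.span (Set.range F) := by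
  obtain ⟨l, hl⟩ := exists_aeval_coeffFunctional_ne_zero (k := k) δ S hS
  exact ⟨_, hl, by rw [← coeffFunctional_mul]; exact coeffFunctional_mem l F _ hh⟩

variable {V W : Type*}

theorem shift_injective (τ : V → K) : Function.Injective (aeval (R := k) (fun v =>
    (MvPowerSeries.C (τ v) + MvPowerSeries.X v : MvPowerSeries V K))) := by
  have e : ∀ f : MvPolynomial V k, aeval (R := k)
      (fun v => (MvPowerSeries.C (τ v) + MvPowerSeries.X v : MvPowerSeries V K)) f =
      ((aeval (R := K) (fun v => (C (τ v) + X v : MvPolynomial V K))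
        (map (algebraMap k K) f) : MvPolynomial V K) : MvPowerSeries V K) := by
    intro f
    induction f using MvPolynomial.induction_on with
    | C a => simp [MvPowerSeries.algebraMap_apply, IsScalarTower.algebraMap_apply k K (MvPowerSeries V K)]
    | add p q hp hq => simp_all
    | mul_X p i hp => simp_all
  have hs : Function.LeftInverse (aeval (R := K) (fun v => (X v - C (τ v) : MvPolynomial V K)))
      (aeval (R := K) (fun v => (C (τ v) + X v : MvPolynomial V K))) := by
    intro f
    induction f using MvPolynomial.induction_on with
    | C a => simp
    | add p q hp hq => simp_all
    | mul_X p i hp => simp_all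
  intro f g hfg
  rw [e, e] at hfg
  exact MvPolynomial.map_injective _ (algebraMap k K).injective
    (hs.injective (MvPolynomial.coe_injective _ _ hfg))

theorem eqIdeal_dichotomy [Finite V] [Finite W] (q : W → MvPolynomial (Option V) k)
    (τ : V → K) (b : W → K)
    (h0 : ∀ w, aeval (fun o : Option V => o.elim (b w) τ) (q w) = 0)
    (h1 : ∀ w, aeval (fun o : Option V => o.elim (b w) τ) (pderiv none (q w)) ≠ 0)
    (p : MvPolynomial (V ⊕ W) k) :
    (∃ S : MvPolynomial (V ⊕ W) k, aeval (Sum.elim τ b) S ≠ 0 ∧ S * p ∈ eqIdeal q) ∨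
    ∃ (S ψ : MvPolynomial (V ⊕ W) k) (χ : MvPolynomial V k), χ ≠ 0 ∧
      aeval (Sum.elim τ b) S ≠ 0 ∧ S * (p * ψ - rename Sum.inl χ) ∈ eqIdeal q := by
  let qK : W → MvPolynomial (Option V) K := fun w => map (algebraMap k K) (q w)
  have h0' : ∀ w, aeval (fun o : Option V => o.elim (b w) τ) (qK w) = 0 := by
    intro w; rw [← h0 w]; exact aeval_map_algebraMap _ _ _
  have h1' : ∀ w, aeval (fun o : Option V => o.elim (b w) τ) (pderiv none (qK w)) ≠ 0 := by
    intro w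
    rw [pderiv_map, aeval_map_algebraMap]
    exact h1 w
  choose Y hY hYb using fun w => exists_powerSeries τ (b w) (qK w) (h0' w) (h1' w)
  let Φ : MvPolynomial (V ⊕ W) k →ₐ[k] MvPowerSeries V K :=
    aeval (Sum.elim (fun v => MvPowerSeries.C (τ v) + MvPowerSeries.X v) Y)
  have hΦ : ∀ h, formalEval τ Y (map (algebraMap k K) h) = Φ h :=
    fun h => aeval_map_algebraMap _ _ _
  have key : ∀ h, Φ h = 0 → ∃ S : MvPolynomial (V ⊕ W) k, aeval (Sum.elim τ b) S ≠ 0 ∧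
      S * h ∈ eqIdeal q := by
    intro h hh
    obtain ⟨S, hS, hS2⟩ := exists_mul_mem_eqIdeal τ b Y qK h1' hY hYb (map (algebraMap k K) h)
      (by rw [hΦ, hh])
    refine exists_mul_mem_span_of_map (Sum.elim τ b) _ h S hS ?_
    rw [eqIdeal] at hS2
    convert hS2 using 5 with w
    simp [qK, map_rename]
  by_cases hp : Φ p = 0
  · exact Or.inl (key p hp)
  · right
    let Ψ : MvPolynomial V k →ₐ[k] MvPowerSeries V K :=
      aeval (fun v => (MvPowerSeries.C (τ v) + MvPowerSeries.X v : MvPowerSeries V K))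
    have hΨ : Function.Injective Ψ := shift_injective τ
    have hΨΦ : ∀ f, Φ (rename Sum.inl f) = Ψ f := by
      intro f
      simp [Φ, Ψ, aeval_rename]
    let _ : Algebra (MvPolynomial V k) (MvPowerSeries V K) := Ψ.toRingHom.toAlgebra
    have hmap : ∀ f, algebraMap (MvPolynomial V k) (MvPowerSeries V K) f = Ψ f := fun _ => rfl
    have : IsScalarTower k (MvPolynomial V k) (MvPowerSeries V K) :=
      IsScalarTower.of_algebraMap_eq fun x => (Ψ.commutes x).symm
    have : IsDomain (MvPowerSeries V K) := NoZeroDivisors.to_isDomain _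
    have halg : ∀ w, IsAlgebraic (MvPolynomial V k) (Y w) := by
      intro w
      refine ⟨uniPoly (fun v => X v) (q w), ?_, ?_⟩
      · intro hz
        apply h1 w
        have := derivative_uniPoly (fun v => (X v : MvPolynomial V k)) (q w)
        rw [hz, Polynomial.derivative_zero] at this
        have h2 := congrArg (fun r => Polynomial.eval (b w) (Polynomial.map (aeval τ : MvPolynomial V k →ₐ[k] K).toRingHom r)) this.symm
        simp only [Polynomial.map_zero, Polynomial.eval_zero] at h2
        have h3 := map_uniPoly (aeval τ : MvPolynomial V k →ₐ[k] K) (fun v => (X v : MvPolynomial V k)) (pderiv none (q w))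
        rw [show (aeval τ : MvPolynomial V k →ₐ[k] K).toRingHom = ((aeval τ : MvPolynomial V k →ₐ[k] K) : MvPolynomial V k →+* K) from rfl, h3, eval_uniPoly] at h2
        simpa using h2
      · rw [Polynomial.aeval_def, ← Polynomial.eval_map]
        have h3 := map_uniPoly Ψ (fun v => (X v : MvPolynomial V k)) (q w)
        rw [show algebraMap (MvPolynomial V k) (MvPowerSeries V K) = (Ψ : _ →+* MvPowerSeries V K) from rfl, h3, eval_uniPoly, ← hY w]
        rw [← aeval_map_algebraMap K]
        simp [Ψ, qK]
    have halgΦ : ∀ f, IsAlgebraic (MvPolynomial V k) (Φ f) := by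
      intro f
      induction f using MvPolynomial.induction_on with
      | C a =>
        have : Φ (C a) = algebraMap (MvPolynomial V k) (MvPowerSeries V K) (C a) := by
          rw [hmap]; simp [Φ, Ψ]
        rw [this]
        exact isAlgebraic_algebraMap _
      | add f g hf hg => rw [map_add]; exact hf.add hg
      | mul_X f i hf =>
        rw [map_mul]
        refine hf.mul ?_
        cases i with
        | inl v =>
          have : Φ (X (Sum.inl v)) = algebraMap (MvPolynomial V k) (MvPowerSeries V K) (X v) := by
            rw [hmap]; simp [Φ, Ψ]
          rw [this]
          exact isAlgebraic_algebraMap _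
        | inr w =>
          have : Φ (X (Sum.inr w)) = Y w := by simp [Φ]
          rw [this]
          exact halg w
    obtain ⟨t, ht, r, hr, e⟩ := (halgΦ p).exists_nonzero_eq_adjoin_mul
      (mem_nonZeroDivisors_of_ne_zero hp)
    have : t ∈ Φ.range := by
      clear e
      induction ht using Algebra.adjoin_induction with
      | mem x hx => rw [Set.mem_singleton_iff.1 hx]; exact ⟨p, rfl⟩
      | algebraMap r => exact ⟨rename Sum.inl r, hΨΦ r⟩
      | add x y _ _ hx hy => exact add_mem hx hy
      | mul x y _ _ hx hy => exact mul_mem hx hy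
    obtain ⟨ψ, rfl⟩ := this
    obtain ⟨S, hS, hS2⟩ := key (p * ψ - rename Sum.inl r) (by
      rw [map_sub, map_mul, hΨΦ, ← hmap, ← e]
      exact sub_self _)
    exact ⟨S, ψ, r, hr, hS, hS2⟩

end Descent

section FormallyReal

open Cardinal

/-- The multiplicative set `1 + ∑ A²`. -/
def oneAddSumSq (A : Type*) [CommRing A] : Submonoid A where
  carrier := {a | ∃ s, IsSumSq s ∧ a = 1 + s}
  one_mem' := ⟨0, IsSumSq.zero, by simp⟩
  mul_mem' := by
    rintro _ _ ⟨s, hs, rfl⟩ ⟨t, ht, rfl⟩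
    exact ⟨s + t + s * t, (hs.add ht).add (hs.mul ht), by ring⟩

theorem exists_isSumSq_mul_eq {A : Type*} [CommRing A] {x : Localization (oneAddSumSq A)}
    (hx : IsSumSq x) : ∃ s ∈ oneAddSumSq A, ∃ t : A, IsSumSq t ∧
      x * algebraMap A _ (s * s) = algebraMap A _ t := by
  induction hx with
  | zero => exact ⟨1, one_mem _, 0, IsSumSq.zero, by simp⟩
  | sq_add a hs ih =>
    obtain ⟨u, hu, t, ht, e⟩ := ih
    obtain ⟨⟨b, s⟩, hb⟩ := IsLocalization.surj (oneAddSumSq A) a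
    refine ⟨s * u, mul_mem s.2 hu, (b * u) * (b * u) + t * (s * s), ?_, ?_⟩
    · exact IsSumSq.sq_add _ (ht.mul (IsSumSq.mul_self _))
    · simp only [map_add, map_mul] at e ⊢
      simp only at hb
      rw [← hb, ← e]
      ring

/-- If `-1` is not a sum of squares, then the ring maps to a formally real field. -/
theorem exists_formallyReal_field {A : Type} [CommRing A] (hA : ¬ IsSumSq (-1 : A)) :
    ∃ (F : Type) (_ : Field F) (_ : A →+* F), ¬ IsSumSq (-1 : F) ∧ #F ≤ #A * #A := by
  have h0 : (0 : A) ∉ oneAddSumSq A := by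
    rintro ⟨s, hs, e⟩
    exact hA (by rwa [neg_eq_of_add_eq_zero_right e.symm])
  have hnt : Nontrivial (Localization (oneAddSumSq A)) := by
    by_contra h
    rw [not_nontrivial_iff_subsingleton] at h
    exact h0 ((IsLocalization.subsingleton_iff (M := oneAddSumSq A)).1 h)
  obtain ⟨m, hm⟩ := Ideal.exists_maximal (Localization (oneAddSumSq A))
  refine ⟨_ ⧸ m, Ideal.Quotient.field m, (Ideal.Quotient.mk m).comp (algebraMap A _), ?_, ?_⟩
  · intro h
    have lift : ∀ y : Localization (oneAddSumSq A) ⧸ m, IsSumSq y →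
        ∃ x, IsSumSq x ∧ Ideal.Quotient.mk m x = y := by
      intro y hy
      induction hy with
      | zero => exact ⟨0, IsSumSq.zero, map_zero _⟩
      | sq_add a hs ih =>
        obtain ⟨x, hx, rfl⟩ := ih
        obtain ⟨b, rfl⟩ := Ideal.Quotient.mk_surjective a
        exact ⟨b * b + x, IsSumSq.sq_add _ hx, by simp⟩
    obtain ⟨x, hx, e⟩ := lift _ h
    have h1 : x + 1 ∈ m := by
      rw [← Ideal.Quotient.eq_zero_iff_mem, map_add, e, map_one, neg_add_cancel]
    obtain ⟨s, ⟨σ, hσ, rfl⟩, t, ht, e2⟩ := exists_isSumSq_mul_eq hx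
    have h2 : algebraMap A (Localization (oneAddSumSq A)) (1 + (σ + σ + σ * σ + t)) ∈ m := by
      have := m.mul_mem_right (algebraMap A _ ((1 + σ) * (1 + σ))) h1
      rw [add_mul, e2, one_mul, ← map_add] at this
      convert this using 2
      ring
    have h3 : IsUnit (algebraMap A (Localization (oneAddSumSq A)) (1 + (σ + σ + σ * σ + t))) :=
      IsLocalization.map_units _ (⟨_, _, ((hσ.add hσ).add (hσ.mul hσ)).add ht, rfl⟩ :
        oneAddSumSq A)
    exact hm.ne_top (Ideal.eq_top_of_isUnit_mem _ h2 h3)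
  · rw [Cardinal.mul_def A A]
    refine mk_le_of_surjective (f := fun x : A × oneAddSumSq A => Ideal.Quotient.mk m
      (IsLocalization.mk' (Localization (oneAddSumSq A)) x.1 x.2)) ?_ |>.trans ?_
    · intro y
      obtain ⟨x, rfl⟩ := Ideal.Quotient.mk_surjective y
      obtain ⟨a, s, rfl⟩ := IsLocalization.exists_mk'_eq (oneAddSumSq A) x
      exact ⟨(a, s), rfl⟩
    · exact mk_le_of_injective (f := fun x => (x.1, x.2.1)) fun x y h => by
        ext <;> simp_all

theorem exists_ringHom_complex {F : Type} [Field F] [CharZero F] (h : #F ≤ continuum) :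
    ∃ e : F →+* ℂ, Function.Injective e := by
  let L := AlgebraicClosure (FractionRing (MvPolynomial ℝ F))
  have hL1 : #(FractionRing (MvPolynomial ℝ F)) = continuum := by
    rw [Cardinal.mk_fractionRing, MvPolynomial.cardinalMk_eq_max]
    simp [Cardinal.mk_real, h, aleph0_le_continuum]
  have hL : #L = continuum := by
    apply le_antisymm
    · refine (Algebra.IsAlgebraic.cardinalMk_le_max (FractionRing (MvPolynomial ℝ F)) L).trans ?_
      rw [hL1]
      simp [aleph0_le_continuum]
    · rw [← hL1]
      exact mk_le_of_injective (algebraMap (FractionRing (MvPolynomial ℝ F)) L).injective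
  have : CharZero L := charZero_of_injective_algebraMap
    (algebraMap (FractionRing (MvPolynomial ℝ F)) L).injective
  have hc : aleph0 < #L := by rw [hL]; exact aleph0_lt_continuum
  obtain ⟨e⟩ := IsAlgClosed.ringEquiv_of_equiv_of_charZero (K := L) (L := ℂ) hc
    (Cardinal.eq.1 (by rw [hL, Cardinal.mk_complex]))
  exact ⟨(e : L →+* ℂ).comp ((algebraMap (FractionRing (MvPolynomial ℝ F)) L).comp
    (algebraMap F _)), RingHom.injective _⟩

end FormallyReal

section PolarizedPartition

open Cardinal

theorem aleph0_le_succ_iterate {κ : Cardinal.{0}} (hκ : ℵ₀ ≤ κ) (m : ℕ) : ℵ₀ ≤ Order.succ^[m] κ := by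
  induction m with
  | zero => exact hκ
  | succ m ih => rw [Function.iterate_succ_apply']; exact ih.trans (Order.le_succ _)

theorem succ_iterate_mono {κ : Cardinal.{0}} {a b : ℕ} (h : a ≤ b) : Order.succ^[a] κ ≤ Order.succ^[b] κ := by
  induction b, h using Nat.le_induction with
  | base => exact le_rfl
  | succ m _ ih => rw [Function.iterate_succ_apply']; exact ih.trans (Order.le_succ _)

theorem exists_monochromatic_grid {X C : Type} {κ : Cardinal.{0}} (hκ : ℵ₀ ≤ κ) (hC : #C ≤ κ) (l : ℕ)
    (m : ℕ) (L : Fin m → Set X) (hL : ∀ c : Fin m, #(L c) = Order.succ^[c + 1] κ)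
    (f : (Fin m → X) → C) :
    ∃ A : ∀ c : Fin m, Fin l → L c, (∀ c, Function.Injective (A c)) ∧
      ∃ x, ∀ s : Fin m → Fin l, f (fun c => A c (s c)) = x := by
  induction m with
  | zero => exact ⟨fun c => c.elim0, fun c => c.elim0, f Fin.elim0, fun s => congrArg f (Subsingleton.elim _ _)⟩
  | succ m ih =>
    choose A hA x hx using fun y : L (Fin.last m) => ih (fun c => L c.castSucc)
      (fun c => by simpa using hL c.castSucc) (fun u => f (Fin.snoc (α := fun _ => X) u y))
    let D := (∀ c : Fin m, Fin l → L c.castSucc) × C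
    let κm := Order.succ^[m] κ
    have hκm : ℵ₀ ≤ κm := aleph0_le_succ_iterate hκ m
    obtain ⟨Q, hQ⟩ : ∃ Q : Type, #Q = κm := ⟨κm.out, mk_out _⟩
    have hD : #D ≤ #Q := by
      rw [hQ]
      have h1 : ∀ c : Fin m, #(Fin l → L c.castSucc) ≤ κm := by
        intro c
        rw [← Cardinal.power_def, mk_fin]
        refine (power_nat_le ?_).trans ?_
        · rw [hL]; exact aleph0_le_succ_iterate hκ _
        · rw [hL]; exact succ_iterate_mono (by simp)
      have h2 : #(∀ c : Fin m, Fin l → L c.castSucc) ≤ κm := by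
        rw [mk_pi]
        refine (prod_le_prod _ (fun _ => κm) h1).trans ?_
        rw [prod_const]
        simp only [lift_id, mk_fin]
        exact power_nat_le hκm
      rw [← Cardinal.mul_def]
      exact (mul_le_mul' h2 (hC.trans (succ_iterate_mono (Nat.zero_le m)))).trans (mul_eq_self hκm).le
    obtain ⟨e⟩ := hD
    have hw : #Q < #(L (Fin.last m)) := by
      rw [hQ, hL]
      simp only [Fin.val_last, Function.iterate_succ_apply', κm]
      exact Order.lt_succ _
    have hinf : Infinite (L (Fin.last m)) := by
      rw [infinite_iff, hL]; exact aleph0_le_succ_iterate hκ _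
    obtain ⟨d, hd⟩ := exists_infinite_fiber (fun y : L (Fin.last m) => e (A y, x y)) hw
    obtain ⟨B⟩ : Nonempty (Fin l ↪ ((fun y : L (Fin.last m) => e (A y, x y)) ⁻¹' {d})) := by
      exact ⟨(Fin.valEmbedding).trans (Infinite.natEmbedding _)⟩
    by_cases hl : l = 0
    · subst hl
      by_cases hC : Nonempty (Fin (m+1) → Fin 0)
      · exact (hC.some 0).elim0
      · obtain ⟨y⟩ : Nonempty ((fun y : L (Fin.last m) => e (A y, x y)) ⁻¹' {d}) := inferInstance
        exact ⟨fun c i => i.elim0, fun c i => i.elim0, x y.1, fun s => (hC ⟨s⟩).elim⟩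
    · have i0 : Fin l := ⟨0, Nat.pos_of_ne_zero hl⟩
      have hB : ∀ i, A (B i).1 = A (B i0).1 ∧ x (B i).1 = x (B i0).1 := by
        intro i
        have := e.injective ((B i).2.trans (B i0).2.symm)
        exact ⟨congrArg Prod.fst this, congrArg Prod.snd this⟩
      refine ⟨Fin.lastCases (fun i => (B i).1) (fun c => A (B i0).1 c), ?_, x (B i0).1, ?_⟩
      · refine Fin.lastCases ?_ fun c => ?_
        · beta_reduce
          rw [Fin.lastCases_last]
          exact Subtype.val_injective.comp B.injective
        · beta_reduce
          rw [Fin.lastCases_castSucc]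
          exact hA _ c
      · intro s
        rw [← (hB (s (Fin.last m))).2, ← hx (B (s (Fin.last m))).1 (fun c => s c.castSucc)]
        congr 1
        funext c
        refine Fin.lastCases ?_ (fun c => ?_) c
        · simp
        · simp [(hB (s (Fin.last m))).1]

/-- From a monochromatic grid one extracts a tuple following a given pattern with pairwise distinct
values. -/
theorem exists_pattern_injective {X Z : Type} {k m : ℕ} (P : Fin k → Fin m → Fin k)
    (hP : Function.Injective P) (A : Fin m → Fin (k ^ 2 + 1) → X) (hA : ∀ c, Function.Injective (A c))
    (Y : (Fin m → X) → Z)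
    (hY : ∀ (u : Fin m → X) (c : Fin m) (e : X), e ≠ u c → Y (Function.update u c e) ≠ Y u) :
    ∃ s : Fin k → Fin m → Fin (k ^ 2 + 1), Function.Injective
      (fun i : Fin k => Y (fun c => A c (s (P i c) c))) := by
  classical
  let pt : (Fin k × Fin m → Fin (k ^ 2 + 1)) → Fin k → Fin m → X :=
    fun s i c => A c (s (P i c, c))
  by_contra! h
  let bad : Fin k × Fin k → Finset (Fin k × Fin m → Fin (k ^ 2 + 1)) := fun q =>
    Finset.univ.filter fun s => q.1 ≠ q.2 ∧ Y (pt s q.1) = Y (pt s q.2)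
  have hbad : ∀ q, (bad q).card * (k ^ 2 + 1) ≤ Fintype.card (Fin k × Fin m → Fin (k ^ 2 + 1)) := by
    rintro ⟨i, i'⟩
    by_cases hi : i = i'
    · have : bad (i, i') = ∅ := by simp [bad, hi]
      simp [this]
    obtain ⟨c, hc⟩ := Function.ne_iff.1 (fun h => hi (hP h))
    rw [show (bad (i, i')).card * (k ^ 2 + 1) = ((bad (i, i')) ×ˢ (Finset.univ : Finset (Fin (k ^ 2 + 1)))).card by simp]
    refine Finset.card_le_card_of_injOn (t := Finset.univ) (fun z => Function.update z.1 (P i c, c) z.2) (by simp) ?_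
    rintro ⟨s, t⟩ hs ⟨s', t'⟩ hs' e
    simp only [Finset.coe_product, Set.mem_prod, Finset.mem_coe, bad, Finset.mem_filter, Finset.mem_univ, true_and, and_true] at hs hs'
    simp only at e
    have e1 : t = t' := by simpa using congrFun e (P i c, c)
    have e2 : ∀ z, z ≠ (P i c, c) → s z = s' z := by
      intro z hz
      simpa [hz] using congrFun e z
    have e3 : pt s i' = pt s' i' := by
      funext d
      simp only [pt]
      rw [e2]
      intro hh
      obtain ⟨h1, h2⟩ := Prod.mk.inj hh
      subst h2
      exact hc h1.symm
    have e4 : pt s i = Function.update (pt s' i) c (pt s i c) := by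
      funext d
      by_cases hd : d = c
      · subst hd; simp
      · simp only [Function.update_of_ne hd, pt]
        rw [e2]
        intro hh
        exact hd (Prod.mk.inj hh).2
    have e5 : pt s i c = pt s' i c := by
      by_contra hne
      refine hY _ _ _ hne ?_
      rw [← e4, hs.2, hs'.2, e3]
    have e6 : s (P i c, c) = s' (P i c, c) := hA c e5
    have : s = s' := by
      funext z
      by_cases hz : z = (P i c, c)
      · rw [hz, e6]
      · exact e2 z hz
    rw [this, e1]
  have hcov : (Finset.univ : Finset (Fin k × Fin m → Fin (k ^ 2 + 1))) ⊆ Finset.univ.biUnion bad := by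
    intro s _
    have := h (fun i c => s (i, c))
    rw [Function.not_injective_iff] at this
    obtain ⟨i, i', e, hne⟩ := this
    exact Finset.mem_biUnion.2 ⟨(i, i'), Finset.mem_univ _, by simpa [bad] using ⟨hne, e⟩⟩
  have h1 := (Finset.card_le_card hcov).trans Finset.card_biUnion_le
  rw [Finset.card_univ] at h1
  set N := Fintype.card (Fin k × Fin m → Fin (k ^ 2 + 1)) with hN
  have h2 : (∑ q, (bad q).card) * (k ^ 2 + 1) ≤ k ^ 2 * N := by
    rw [Finset.sum_mul]
    refine (Finset.sum_le_sum fun q _ => hbad q).trans ?_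
    simp [sq]
  have h3 : 0 < N := Fintype.card_pos
  nlinarith

theorem exists_monochromatic_tuple {X Z C : Type} {κ : Cardinal.{0}} (hκ : ℵ₀ ≤ κ) (hC : #C ≤ κ)
    {k m : ℕ} (hX : Order.succ^[m] κ ≤ #X) (P : Fin k → Fin m → Fin k)
    (hP : Function.Injective P) (Y : (Fin m → X) → Z)
    (hY : ∀ (u : Fin m → X) (c : Fin m) (e : X), e ≠ u c → Y (Function.update u c e) ≠ Y u)
    (φ : Z → C) :
    ∃ v : Fin k → Fin m → X, Function.Injective (fun i : Fin k => Y (fun c => v (P i c) c)) ∧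
      ∀ i j : Fin k, φ (Y (fun c => v (P i c) c)) = φ (Y (fun c => v (P j c) c)) := by
  have : ∀ c : Fin m, ∃ L : Set X, #L = Order.succ^[c + 1] κ := fun c =>
    le_mk_iff_exists_set.1 ((succ_iterate_mono c.2).trans hX)
  choose L hL using this
  obtain ⟨A, hA, x, hx⟩ := exists_monochromatic_grid hκ hC (k ^ 2 + 1) m L hL (fun u => φ (Y u))
  obtain ⟨s, hs⟩ := exists_pattern_injective P hP (fun c i => (A c i : X))
    (fun c => Subtype.val_injective.comp (hA c)) Y hY
  exact ⟨fun i c => A c (s i c), hs, fun i j => (hx _).trans (hx _).symm⟩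

end PolarizedPartition

section CoreColoring

open Cardinal

theorem exists_core_coloring {κ : Cardinal.{0}} (hκ : ℵ₀ ≤ κ) {D : Type} (hD : #D = κ) (r m : ℕ)
    (T : Type) (hT : #T ≤ Order.succ^[m] κ) :
    ∃ (γ : (Fin r → T) → D) (J : (Fin r → T) → Finset (Fin r)), (∀ σ, (J σ).card ≤ m) ∧
      ∀ σ σ', γ σ = γ σ' → J σ = J σ' → (∀ c ∈ J σ, σ c = σ' c) → σ = σ' := by
  classical
  induction m generalizing T with
  | zero =>
    obtain ⟨e⟩ : #(Fin r → T) ≤ #D := by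
      rw [hD, ← power_def, mk_fin]
      exact (power_le_power_right hT).trans (power_nat_le hκ)
    exact ⟨e, fun _ => ∅, by simp, fun σ σ' h _ _ => e.injective h⟩
  | succ m ih =>
    obtain ⟨lo, wo, hlo⟩ : ∃ (_ : LinearOrder T) (_ : WellFoundedLT T),
        ∀ x : T, #(Set.Iic x) ≤ Order.succ^[m] κ := by
      obtain ⟨W, hW, hW2⟩ := Cardinal.exists_ord_eq T
      let _ := linearOrderOfSTO W
      refine ⟨inferInstance, ⟨hW.wf⟩, fun x => ?_⟩
      have h1 : #(Set.Iio x) < #T := by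
        have := Ordinal.typein_lt_type W x
        rw [← hW2, Cardinal.lt_ord, Ordinal.card_typein] at this
        exact this
      have h2 : #(Set.Iio x) ≤ Order.succ^[m] κ := by
        rw [← Order.lt_succ_iff, ← Function.iterate_succ_apply' (f := Order.succ)]
        exact h1.trans_le hT
      have h3 : Set.Iic x = Set.Iio x ∪ {x} := by ext; simp [le_iff_lt_or_eq]
      rw [h3]
      refine (mk_union_le _ _).trans ?_
      rw [mk_singleton]
      exact (add_le_add h2 (one_le_aleph0.trans (aleph0_le_succ_iterate hκ m))).trans
        (add_eq_self (aleph0_le_succ_iterate hκ m)).le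
    rcases Nat.eq_zero_or_pos r with rfl | hr
    · obtain ⟨d⟩ : Nonempty D := by
        rw [← mk_ne_zero_iff, hD]; exact (aleph0_pos.trans_le hκ).ne'
      exact ⟨fun _ => d, fun _ => ∅, by simp, fun σ σ' _ _ _ => Subsingleton.elim _ _⟩
    have : Nonempty (Fin r) := ⟨⟨0, hr⟩⟩
    choose γ J hJ h using fun x : T => ih (Set.Iic x) (hlo x)
    choose c hc using fun σ : Fin r → T => Finite.exists_max σ
    let res : ∀ σ : Fin r → T, Fin r → Set.Iic (σ (c σ)) := fun σ i => ⟨σ i, hc σ i⟩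
    obtain ⟨e⟩ : #(Fin r × Finset (Fin r) × D) ≤ #D := by
      have i1 : Infinite D := by rw [infinite_iff, hD]; exact hκ
      simp only [mk_prod, lift_id, mk_finset_of_fintype, mk_fin]
      have h1 : ((2 ^ Fintype.card (Fin r) : ℕ) : Cardinal.{0}) * #D ≤ #D :=
        (mul_le_mul_left (natCast_lt_aleph0.le.trans (by rw [hD]; exact hκ)) _).trans (mul_eq_self (by rw [hD]; exact hκ)).le
      have h2 : (r : Cardinal.{0}) * #D ≤ #D :=
        (mul_le_mul_left (natCast_lt_aleph0.le.trans (by rw [hD]; exact hκ)) _).trans (mul_eq_self (by rw [hD]; exact hκ)).le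
      exact (mul_le_mul_right (by simpa using h1) _).trans h2
    refine ⟨fun σ => e (c σ, J _ (res σ), γ _ (res σ)), fun σ => insert (c σ) (J _ (res σ)), ?_, ?_⟩
    · intro σ
      exact (Finset.card_insert_le _ _).trans (Nat.succ_le_succ (hJ _ _))
    · intro σ σ' h1 h2 h3
      have h4 := e.injective h1
      simp only [Prod.mk.injEq] at h4
      obtain ⟨e1, e2, e3⟩ := h4
      have hx : σ (c σ) = σ' (c σ') := by
        rw [← e1]; exact h3 _ (Finset.mem_insert_self _ _)
      have hgen : ∀ x x' (s : Fin r → Set.Iic x) (s' : Fin r → Set.Iic x'), x = x' → J x s = J x' s' →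
          γ x s = γ x' s' → (∀ c ∈ J x s, (s c : T) = s' c) → ∀ c, (s c : T) = s' c := by
        rintro x _ s s' rfl a1 a2 a3 c
        rw [h x s s' a2 a1 fun c hc => Subtype.ext (a3 c hc)]
      funext i
      exact hgen _ _ (res σ) (res σ') hx e2 e3 (fun c hc => h3 c (Finset.mem_insert_of_mem hc)) i

/-- A coloring of `r`-tuples by at most `κ` colors such that monochromatic `k`-tuples of pairwise
distinct tuples are separated by at most `B` coordinates. -/
def SeparatedColoring (κ : Cardinal.{0}) (T : Type) (B k : ℕ) : Prop :=
  ∀ r : ℕ, ∃ (D : Type) (γ : (Fin r → T) → D), #D ≤ κ ∧ ∀ σ : Fin k → Fin r → T,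
    Function.Injective σ → (∀ i j, γ (σ i) = γ (σ j)) →
    ∃ J : Finset (Fin r), J.card ≤ B ∧ ∀ i j, (∀ c ∈ J, σ i c = σ j c) → i = j

theorem separatedColoring_of_le {κ : Cardinal.{0}} (hκ : ℵ₀ ≤ κ) {T : Type} {m : ℕ} (k : ℕ)
    (hT : #T ≤ Order.succ^[m] κ) : SeparatedColoring κ T m k := by
  intro r
  obtain ⟨D, hD⟩ : ∃ D : Type, #D = κ := ⟨κ.out, mk_out _⟩
  obtain ⟨γ, J, hJ, h⟩ := exists_core_coloring hκ hD r m T hT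
  refine ⟨D × Finset (Fin r), fun σ => (γ σ, J σ), ?_, ?_⟩
  · simp only [mk_prod, lift_id, mk_finset_of_fintype]
    rw [hD]
    have h1 : ((2 ^ Fintype.card (Fin r) : ℕ) : Cardinal.{0}) ≤ κ := natCast_lt_aleph0.le.trans hκ
    exact (mul_le_mul_right (by simpa using h1) _).trans (mul_eq_self hκ).le
  · intro σ hσ hc
    rcases Nat.eq_zero_or_pos k with rfl | hk
    · exact ⟨∅, by simp, fun i => i.elim0⟩
    · have hc1 : ∀ i j, γ (σ i) = γ (σ j) ∧ J (σ i) = J (σ j) := fun i j =>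
        ⟨congrArg Prod.fst (hc i j), congrArg Prod.snd (hc i j)⟩
      refine ⟨J (σ ⟨0, hk⟩), hJ _, fun i j hij => hσ (h _ _ (hc1 i j).1 (hc1 i j).2 ?_)⟩
      rwa [(hc1 i ⟨0, hk⟩).2]

theorem separatedColoring_mul_self {κ : Cardinal.{0}} (hκ : ℵ₀ ≤ κ) (T : Type) (k : ℕ) :
    SeparatedColoring κ T (k * k) k := by
  classical
  intro r
  refine ⟨Unit, fun _ => (), by simpa using one_le_aleph0.trans hκ, fun σ hσ _ => ?_⟩
  have : ∀ q : Fin k × Fin k, ∃ J : Finset (Fin r), J.card ≤ 1 ∧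
      ((∀ c ∈ J, σ q.1 c = σ q.2 c) → q.1 = q.2) := by
    rintro ⟨i, j⟩
    by_cases h : i = j
    · exact ⟨∅, by simp, fun _ => h⟩
    · obtain ⟨c, hc⟩ := Function.ne_iff.1 (fun e => h (hσ e))
      exact ⟨{c}, by simp, fun h => (hc (by simpa using h)).elim⟩
  choose J hJ hJ2 using this
  refine ⟨Finset.univ.biUnion J, ?_, fun i j h => hJ2 (i, j) fun c hc => h c
    (Finset.mem_biUnion.2 ⟨_, Finset.mem_univ _, hc⟩)⟩
  refine Finset.card_biUnion_le.trans ((Finset.sum_le_sum fun q _ => hJ q).trans ?_)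
  simp

end CoreColoring

section LocalPolynomials

open MvPolynomial

theorem totalDegree_pderiv_lt {R σ : Type*} [CommRing R] {f : MvPolynomial σ R} {i : σ}
    (h : pderiv i f ≠ 0) : (pderiv i f).totalDegree < f.totalDegree := by
  obtain ⟨m, hm, hm2⟩ := Finset.exists_mem_eq_sup (pderiv i f).support
    (by simpa [Finset.nonempty_iff_ne_empty] using h) fun s => s.sum fun _ e => e
  rw [mem_support_iff, coeff_pderiv] at hm
  have h1 := le_totalDegree (mem_support_iff.2 (left_ne_zero_of_mul hm))
  rw [Finsupp.sum_add_index' (by simp) (by simp), Finsupp.sum_single_index rfl] at h1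
  rw [totalDegree, hm2]
  omega

theorem notMem_vars_of_pderiv_eq_zero {R σ : Type*} [CommRing R] [IsDomain R] [CharZero R]
    {f : MvPolynomial σ R} {i : σ} (h : pderiv i f = 0) : i ∉ f.vars := by
  intro hi
  obtain ⟨m, hm, hmi⟩ := (mem_vars_iff_mem_support i).1 hi
  have h1 := congrArg (coeff (m - Finsupp.single i 1)) h
  have h2 : m - Finsupp.single i 1 + Finsupp.single i 1 = m := by
    refine tsub_add_cancel_of_le ?_
    rw [Finsupp.single_le_iff]
    exact Nat.one_le_iff_ne_zero.2 (Finsupp.mem_support_iff.1 hmi)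
  rw [coeff_pderiv, h2, coeff_zero, mul_eq_zero] at h1
  rcases h1 with h1 | h1
  · exact mem_support_iff.1 hm h1
  · exact (Nat.cast_add_one_ne_zero (R := R) _) (by simpa using h1)

variable {K T : Type} [Field K] [Algebra ℚ K]

/-- Every tuple in `K` has annihilating polynomials over finitely many elements of a
transcendence basis for which the nonzero partial derivatives do not vanish. -/
theorem exists_local_polynomials {x : T → K} (hx : IsTranscendenceBasis ℚ x) {n : ℕ}
    (a : Fin n → K) : ∃ (r : ℕ) (σ : Fin r → T) (Q : Fin n → MvPolynomial (Option (Fin r)) ℚ),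
      Function.Injective σ ∧
      (∀ j, aeval (fun o : Option (Fin r) => o.elim (a j) (x ∘ σ)) (Q j) = 0) ∧
      (∀ j, aeval (fun o : Option (Fin r) => o.elim (a j) (x ∘ σ)) (pderiv none (Q j)) ≠ 0) ∧
      ∀ c, ∃ j,
        aeval (fun o : Option (Fin r) => o.elim (a j) (x ∘ σ)) (pderiv (some c) (Q j)) ≠ 0 := by
  classical
  let G : ℕ → Prop := fun r => ∃ σ : Fin r → T, Function.Injective σ ∧
    ∀ j, ∃ q : MvPolynomial (Option (Fin r)) ℚ, q ≠ 0 ∧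
      aeval (fun o : Option (Fin r) => o.elim (a j) (x ∘ σ)) q = 0
  have hG : ∃ r, G r := by
    have h1 : ∀ j, ∃ q : MvPolynomial (Option T) ℚ, q ≠ 0 ∧
        aeval (fun o : Option T => o.elim (a j) x) q = 0 := by
      intro j
      have h2 : ¬ AlgebraicIndependent ℚ (fun o : Option T => o.elim (a j) x) := by
        rw [hx.1.option_iff_transcendental]
        exact not_not.2 (hx.isAlgebraic.isAlgebraic (a j))
      rw [algebraicIndependent_iff] at h2
      push Not at h2
      obtain ⟨q, h3, h4⟩ := h2
      exact ⟨q, h4, h3⟩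
    choose q hq0 hq using h1
    let s : Finset T := Finset.univ.biUnion fun j => Finset.eraseNone (q j).vars
    let e := s.equivFin
    refine ⟨s.card, fun c => (e.symm c).1, Subtype.val_injective.comp e.symm.injective,
      fun j => ?_⟩
    obtain ⟨g, hg⟩ := exists_rename_eq_of_vars_subset_range (q j)
      (Option.map fun c => (e.symm c).1)
      (Option.map_injective (Subtype.val_injective.comp e.symm.injective)) (by
        rintro (_ | t) ht
        · exact ⟨none, rfl⟩
        · have hts : t ∈ s := Finset.mem_biUnion.2 ⟨j, Finset.mem_univ j, by simpa using ht⟩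
          exact ⟨some (e ⟨t, hts⟩), by simp⟩)
    refine ⟨g, ?_, ?_⟩
    · rintro rfl
      exact hq0 j (by rw [← hg, map_zero])
    · rw [← hq j, ← hg, aeval_rename]
      congr 1
      congr 1
      funext o
      cases o <;> rfl
  obtain ⟨σ, hσ, h1⟩ := Nat.find_spec hG
  have hmin := fun r (hr : r < Nat.find hG) => Nat.find_min hG hr
  generalize Nat.find hG = r at *
  have h2 : ∀ j, ∃ q : MvPolynomial (Option (Fin r)) ℚ, q ≠ 0 ∧
      aeval (fun o : Option (Fin r) => o.elim (a j) (x ∘ σ)) q = 0 ∧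
      ∀ o, pderiv o q ≠ 0 →
        aeval (fun o : Option (Fin r) => o.elim (a j) (x ∘ σ)) (pderiv o q) ≠ 0 := by
    intro j
    have hj : ∃ d, ∃ q : MvPolynomial (Option (Fin r)) ℚ, q.totalDegree = d ∧ q ≠ 0 ∧
      aeval (fun o : Option (Fin r) => o.elim (a j) (x ∘ σ)) q = 0 :=
      let ⟨q, h, h'⟩ := h1 j
      ⟨_, q, rfl, h, h'⟩
    obtain ⟨q, hd, h0, hq⟩ := Nat.find_spec hj
    refine ⟨q, h0, hq, fun o ho h => ?_⟩
    exact Nat.find_min hj (hd ▸ totalDegree_pderiv_lt ho) ⟨_, rfl, ho, h⟩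
  choose Q hQ0 hQ hQd using h2
  refine ⟨r, σ, Q, hσ, hQ, fun j => hQd j none fun h => ?_, fun c => ?_⟩
  · obtain ⟨g, hg⟩ := exists_rename_eq_of_vars_subset_range (Q j) some (Option.some_injective _) (by
      rintro (_ | t) ht
      · exact (notMem_vars_of_pderiv_eq_zero h ht).elim
      · exact ⟨t, rfl⟩)
    have h3 := hQ j
    rw [← hg, aeval_rename] at h3
    have h4 := (algebraicIndependent_iff.1 (hx.1.comp σ hσ)) g h3
    exact hQ0 j (by rw [← hg, h4, map_zero])
  · by_contra! hc
    have hc' : ∀ j, pderiv (some c) (Q j) = 0 := fun j => by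
      by_contra h
      exact hQd j _ h (hc j)
    obtain ⟨r, rfl⟩ : ∃ s, r = s + 1 := ⟨r - 1, by have := c.2; omega⟩
    refine hmin r (Nat.lt_succ_self r) ⟨σ ∘ c.succAbove,
      hσ.comp Fin.succAbove_right_injective, fun j => ?_⟩
    obtain ⟨g, hg⟩ := exists_rename_eq_of_vars_subset_range (Q j) (Option.map c.succAbove)
      (Option.map_injective Fin.succAbove_right_injective) (by
        rintro (_ | t) ht
        · exact ⟨none, rfl⟩
        · have htc : t ≠ c := by
            rintro rfl
            exact notMem_vars_of_pderiv_eq_zero (hc' j) ht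
          obtain ⟨z, hz⟩ := Fin.exists_succAbove_eq htc
          exact ⟨some z, by simp [hz]⟩)
    refine ⟨g, ?_, ?_⟩
    · rintro rfl
      exact hQ0 j (by rw [← hg, map_zero])
    · rw [← hQ j, ← hg, aeval_rename]
      congr 1
      congr 1
      funext o
      cases o <;> rfl

end LocalPolynomials

section LocalGrids

open MvPolynomial Cardinal

theorem rename_mem_eqIdeal {K V V' W : Type*} [CommRing K] {q : W → MvPolynomial (Option V) K}
    (h : V → V') {f : MvPolynomial (V ⊕ W) K} (hf : f ∈ eqIdeal q) :
    rename (Sum.map h id) f ∈ eqIdeal fun w => rename (Option.map h) (q w) := by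
  have h1 := Ideal.mem_map_of_mem (rename (Sum.map h id) : _ →ₐ[K] MvPolynomial (V' ⊕ W) K) hf
  rw [eqIdeal, Ideal.map_span] at h1
  refine Ideal.span_mono ?_ h1
  rintro _ ⟨_, ⟨w, rfl⟩, rfl⟩
  refine ⟨w, ?_⟩
  change rename _ (rename _ _) = rename (Sum.map h id) (rename _ _)
  rw [rename_rename, rename_rename]
  congr 1
  congr 1
  funext o
  cases o <;> rfl

theorem aeval_eq_zero_of_mem_eqIdeal {K R V W : Type*} [CommRing K] [CommRing R] [Algebra K R]
    {q : W → MvPolynomial (Option V) K} {z : V ⊕ W → R}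
    (hz : ∀ w, aeval (fun o : Option V => o.elim (z (.inr w)) fun v => z (.inl v)) (q w) = 0)
    {f : MvPolynomial (V ⊕ W) K} (hf : f ∈ eqIdeal q) : aeval z f = 0 := by
  have h1 : eqIdeal q ≤ RingHom.ker (aeval z : _ →ₐ[K] R) := by
    refine Ideal.span_le.2 ?_
    rintro _ ⟨w, rfl⟩
    refine (RingHom.mem_ker).2 ?_
    rw [aeval_eqVar]
    exact hz w
  exact (RingHom.mem_ker).1 (h1 hf)

variable {K : Type} [Field K] [Algebra ℚ K] {k n : ℕ}

/-- Colorings of `K ^ n` with at most `κ` colors avoiding distinct zeros of `p`. -/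
def AvoidableOver (K : Type) [Field K] [Algebra ℚ K] (κ : Cardinal.{0})
    (p : MvPolynomial (Fin k × Fin n) ℚ) : Prop :=
  ∃ (C : Type) (φ : (Fin n → K) → C), #C ≤ κ ∧ ∀ a : Fin k → Fin n → K, Function.Injective a →
    aeval (fun v : Fin k × Fin n => a v.1 v.2) p = 0 → ∃ i j, φ (a i) ≠ φ (a j)

/-- The equations of a grid: row `i` uses the copy `P i c` of the parameter `c`. -/
noncomputable def gridEquations {m r : ℕ} (P : Fin k → Fin m → Fin k)
    (Q : Fin n → MvPolynomial (Option (Fin m ⊕ Fin r)) ℚ) (w : Fin k × Fin n) :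
    MvPolynomial (Option ((Fin m × Fin k) ⊕ Fin r)) ℚ :=
  rename (Option.map (Sum.map (fun c => (c, P w.1 c)) id)) (Q w.2)

/-- Germs at a point of `K` of a grid of zeros of `p` with pattern `P`. -/
def LocalGrid (K : Type) [Field K] [Algebra ℚ K] (p : MvPolynomial (Fin k × Fin n) ℚ) (m : ℕ)
    (P : Fin k → Fin m → Fin k) : Prop :=
  ∃ (r : ℕ) (Q : Fin n → MvPolynomial (Option (Fin m ⊕ Fin r)) ℚ) (σ : Fin m ⊕ Fin r → K)
    (b : Fin n → K) (S : MvPolynomial (((Fin m × Fin k) ⊕ Fin r) ⊕ (Fin k × Fin n)) ℚ),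
    (∀ j, aeval (fun o : Option (Fin m ⊕ Fin r) => o.elim (b j) σ) (Q j) = 0) ∧
    (∀ j, aeval (fun o : Option (Fin m ⊕ Fin r) => o.elim (b j) σ) (pderiv none (Q j)) ≠ 0) ∧
    (∀ c, ∃ j, aeval (fun o : Option (Fin m ⊕ Fin r) => o.elim (b j) σ)
      (pderiv (some (.inl c)) (Q j)) ≠ 0) ∧
    aeval (Sum.elim (Sum.elim (fun v : Fin m × Fin k => σ (.inl v.1)) fun d => σ (.inr d))
      fun w : Fin k × Fin n => b w.2) S ≠ 0 ∧
    S * rename Sum.inr p ∈ eqIdeal (gridEquations P Q)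

theorem exists_localGrid_of_pattern {r : ℕ} (p : MvPolynomial (Fin k × Fin n) ℚ)
    (Q : Fin n → MvPolynomial (Option (Fin r)) ℚ) (t : Fin r → K) (b : Fin n → K)
    (h0 : ∀ j, aeval (fun o : Option (Fin r) => o.elim (b j) t) (Q j) = 0)
    (h1 : ∀ j, aeval (fun o : Option (Fin r) => o.elim (b j) t) (pderiv none (Q j)) ≠ 0)
    (h2 : ∀ c, ∃ j, aeval (fun o : Option (Fin r) => o.elim (b j) t) (pderiv (some c) (Q j)) ≠ 0)
    (g : Fin k × Fin r → Fin k × Fin r) (hg : ∀ v, (g v).2 = v.2) (J : Finset (Fin r))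
    (hJ : ∀ i i', (∀ c ∈ J, g (i, c) = g (i', c)) → i = i')
    (S : MvPolynomial (Set.range g ⊕ (Fin k × Fin n)) ℚ)
    (hS : aeval (Sum.elim (fun v : Set.range g => t v.1.2) fun w : Fin k × Fin n => b w.2) S ≠ 0)
    (hSp : S * rename Sum.inr p ∈ eqIdeal fun w : Fin k × Fin n =>
      rename (Option.map fun c => (⟨g (w.1, c), ⟨_, rfl⟩⟩ : Set.range g)) (Q w.2)) :
    ∃ P : Fin k → Fin J.card → Fin k, Function.Injective P ∧ LocalGrid K p J.card P := by
  classical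
  let e := J.equivFin
  let P : Fin k → Fin J.card → Fin k := fun i d => (g (i, (e.symm d).1)).1
  let f : Fin r → Fin J.card ⊕ Fin r := fun c => if h : c ∈ J then .inl (e ⟨c, h⟩) else .inr c
  let h : Set.range g → (Fin J.card × Fin k) ⊕ Fin r := fun v =>
    if h : v.1.2 ∈ J then .inl (e ⟨v.1.2, h⟩, v.1.1) else .inr v.1.2
  let s : Fin J.card ⊕ Fin r → K := Sum.elim (fun d => t (e.symm d).1) t
  have hf : Function.Injective f := by
    intro c c' hcc
    simp only [f] at hcc
    split_ifs at hcc with h3 h4 h4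
    · simpa using hcc
    · simpa using hcc
  have hsf : ∀ c, s (f c) = t c := by
    intro c
    simp only [f, s]
    split_ifs <;> simp
  have hel : ∀ j, (fun o : Option (Fin J.card ⊕ Fin r) => o.elim (b j) s) ∘ Option.map f =
      fun o : Option (Fin r) => o.elim (b j) t := by
    intro j
    funext o
    cases o with
    | none => rfl
    | some c => exact hsf c
  have hfo : Function.Injective (Option.map f) := Option.map_injective hf
  refine ⟨P, ?_, r, fun j => rename (Option.map f) (Q j), s, b, rename (Sum.map h id) S,
    fun j => ?_, fun j => ?_, fun c => ?_, ?_, ?_⟩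
  · intro i i' hii
    refine hJ i i' fun c hc => ?_
    have h3 := congrFun hii (e ⟨c, hc⟩)
    simp only [P, Equiv.symm_apply_apply] at h3
    exact Prod.ext h3 ((hg (i, c)).trans (hg (i', c)).symm)
  · rw [aeval_rename, hel, h0]
  · have := pderiv_rename hfo none (Q j)
    rw [Option.map_none] at this
    rw [this, aeval_rename, hel]
    exact h1 j
  · obtain ⟨j, hj⟩ := h2 (e.symm c).1
    refine ⟨j, ?_⟩
    have h3 : f (e.symm c).1 = .inl c := by simp [f]
    have := pderiv_rename hfo (some (e.symm c).1) (Q j)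
    rw [Option.map_some, h3] at this
    rw [this, aeval_rename, hel]
    exact hj
  · rw [aeval_rename]
    convert hS using 3
    funext v
    rcases v with v | w
    · simp only [Function.comp, Sum.map_inl, Sum.elim_inl, h]
      split_ifs <;> simp [s]
    · rfl
  · have h3 := rename_mem_eqIdeal h hSp
    rw [map_mul, rename_rename] at h3
    have h4 : Sum.map h id ∘ (Sum.inr : Fin k × Fin n → Set.range g ⊕ (Fin k × Fin n)) = Sum.inr :=
      rfl
    rw [h4] at h3
    convert h3 using 1
    · congr 1
      funext w
      rw [gridEquations, rename_rename, rename_rename]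
      congr 1
      congr 1
      funext o
      cases o with
      | none => rfl
      | some c =>
        simp only [Function.comp, Option.map_some, f, h, P]
        congr 1
        by_cases hc : c ∈ J
        · have hc' : (g (w.1, c)).2 ∈ J := by rw [hg]; exact hc
          have h5 : (⟨(g (w.1, c)).2, hc'⟩ : J) = ⟨c, hc⟩ := Subtype.ext (hg _)
          rw [dif_pos hc, dif_pos hc', h5]
          simp
        · have hc' : (g (w.1, c)).2 ∉ J := by rw [hg]; exact hc
          rw [dif_neg hc, dif_neg hc', hg]
          rfl

end LocalGrids

section GridExtraction

open MvPolynomial Cardinal Filter Topology Metric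

theorem continuous_aeval_point {V R : Type*} [CommRing R] [TopologicalSpace R]
    [IsTopologicalRing R] [Algebra ℚ R] (f : MvPolynomial V ℚ) :
    Continuous fun z : V → R => aeval z f := by
  simp_rw [aeval_def, ← eval_map]
  exact MvPolynomial.continuous_eval _

theorem eventually_aeval_ne_zero {V I : Type} [Finite V] (pt : I → ℂ) (π : V → I)
    (S : MvPolynomial V ℚ) (h : aeval (fun v => pt (π v)) S ≠ 0) :
    ∀ᶠ ε in 𝓝[>] (0 : ℝ), ∀ z : V → ℂ, (∀ v, z v ∈ ball (pt (π v)) ε) → aeval z S ≠ 0 := by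
  have _ := Fintype.ofFinite V
  have ho : IsOpen {z : V → ℂ | aeval z S ≠ 0} :=
    isOpen_ne_fun (continuous_aeval_point S) continuous_const
  obtain ⟨ε, hε, h1⟩ := Metric.isOpen_iff.1 ho (fun v => pt (π v)) h
  filter_upwards [Ioo_mem_nhdsGT hε] with δ hδ z hz
  refine h1 (mem_ball.2 ((dist_pi_lt_iff hε).2 fun v => ?_))
  exact (mem_ball.1 (hz v)).trans hδ.2

/-- Basic open boxes around a point which isolate it. -/
theorem exists_basic_boxes {I : Type} [Finite I] (pt : I → ℂ) {p : ℝ → Prop}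
    (hp : ∀ᶠ ε in 𝓝[>] (0 : ℝ), p ε) : ∃ ε, p ε ∧
      ∃ β : I → TopologicalSpace.countableBasis ℂ,
        ∀ o, pt o ∈ (β o : Set ℂ) ∧ (β o : Set ℂ) ⊆ ball (pt o) ε := by
  obtain ⟨ε, h1, h2⟩ := (hp.and self_mem_nhdsWithin).exists
  refine ⟨ε, h1, ?_⟩
  have h3 : ∀ o, ∃ b : TopologicalSpace.countableBasis ℂ,
      pt o ∈ (b : Set ℂ) ∧ (b : Set ℂ) ⊆ ball (pt o) ε := by
    intro o
    obtain ⟨v, hv, h4, h5⟩ := (TopologicalSpace.isBasis_countableBasis ℂ).exists_subset_of_mem_open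
      (mem_ball_self h2 : pt o ∈ ball (pt o) ε) isOpen_ball
    exact ⟨⟨v, hv⟩, h4, h5⟩
  choose β hβ using h3
  exact ⟨β, hβ⟩

variable {K : Type} [Field K] [Algebra ℚ K] {k n : ℕ}

/-- The equations attached to a pattern `g`. -/
noncomputable def patternEquations {r : ℕ} (Q : Fin n → MvPolynomial (Option (Fin r)) ℚ)
    (g : Fin k × Fin r → Fin k × Fin r) (w : Fin k × Fin n) :
    MvPolynomial (Option (Set.range g)) ℚ :=
  rename (Option.map fun c => (⟨g (w.1, c), ⟨_, rfl⟩⟩ : Set.range g)) (Q w.2)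

/-- A pattern whose rows are separated by at most `B` columns. -/
def SeparatedPattern {r : ℕ} (B : ℕ) (g : Fin k × Fin r → Fin k × Fin r) : Prop :=
  (∀ v, (g v).2 = v.2) ∧ ∃ J : Finset (Fin r), J.card ≤ B ∧
    ∀ i i', (∀ c ∈ J, g (i, c) = g (i', c)) → i = i'

/-- Eliminating the tuple entries from the equations of a pattern. -/
def EliminationOn {r : ℕ} (p : MvPolynomial (Fin k × Fin n) ℚ)
    (Q : Fin n → MvPolynomial (Option (Fin r)) ℚ) (g : Fin k × Fin r → Fin k × Fin r)
    (β : Fin r ⊕ Fin n → Set ℂ) : Prop :=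
  ∃ (S ψ : MvPolynomial (Set.range g ⊕ (Fin k × Fin n)) ℚ) (χ : MvPolynomial (Set.range g) ℚ),
    χ ≠ 0 ∧ S * (rename Sum.inr p * ψ - rename Sum.inl χ) ∈ eqIdeal (patternEquations Q g) ∧
    ∀ z : Set.range g ⊕ (Fin k × Fin n) → ℂ, (∀ v : Set.range g, z (.inl v) ∈ β (.inl v.1.2)) →
      (∀ w : Fin k × Fin n, z (.inr w) ∈ β (.inr w.2)) → aeval z S ≠ 0

theorem EliminationOn.mono {r : ℕ} {p : MvPolynomial (Fin k × Fin n) ℚ}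
    {Q : Fin n → MvPolynomial (Option (Fin r)) ℚ} {g : Fin k × Fin r → Fin k × Fin r}
    {β β' : Fin r ⊕ Fin n → Set ℂ} (h : EliminationOn p Q g β) (hβ : ∀ o, β' o ⊆ β o) :
    EliminationOn p Q g β' := by
  obtain ⟨S, ψ, χ, h1, h2, h3⟩ := h
  exact ⟨S, ψ, χ, h1, h2, fun z hz hz' => h3 z (fun v => hβ _ (hz v)) fun w => hβ _ (hz' w)⟩

theorem eventually_eliminationOn {B r : ℕ} (e : K →ₐ[ℚ] ℂ) (p : MvPolynomial (Fin k × Fin n) ℚ)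
    (hp : ∀ m ≤ B, ∀ P : Fin k → Fin m → Fin k, Function.Injective P → ¬ LocalGrid K p m P)
    (Q : Fin n → MvPolynomial (Option (Fin r)) ℚ) (t : Fin r → K) (b : Fin n → K)
    (h0 : ∀ j, aeval (fun o : Option (Fin r) => o.elim (b j) t) (Q j) = 0)
    (h1 : ∀ j, aeval (fun o : Option (Fin r) => o.elim (b j) t) (pderiv none (Q j)) ≠ 0)
    (h2 : ∀ c, ∃ j, aeval (fun o : Option (Fin r) => o.elim (b j) t) (pderiv (some c) (Q j)) ≠ 0)
    (g : Fin k × Fin r → Fin k × Fin r) (hg : SeparatedPattern B g) :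
    ∀ᶠ ε in 𝓝[>] (0 : ℝ), EliminationOn p Q g fun o => ball (e (Sum.elim t b o)) ε := by
  have hel : ∀ w : Fin k × Fin n, (fun o : Option (Set.range g) => o.elim (b w.2)
      fun v => t v.1.2) ∘ (Option.map fun c => (⟨g (w.1, c), ⟨_, rfl⟩⟩ : Set.range g)) =
      fun o : Option (Fin r) => o.elim (b w.2) t := by
    intro w
    funext o
    cases o with
    | none => rfl
    | some c =>
      simp only [Function.comp, Option.map_some, Option.elim_some]
      rw [hg.1]
  have hinj : ∀ i : Fin k, Function.Injective
      (Option.map fun c => (⟨g (i, c), ⟨_, rfl⟩⟩ : Set.range g)) := by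
    refine fun i => Option.map_injective fun c c' hcc => ?_
    have h3 := congrArg (fun v : Set.range g => v.1.2) hcc
    simpa only [hg.1] using h3
  obtain ⟨hg2, J, hJ, hsep⟩ := hg
  rcases eqIdeal_dichotomy (patternEquations Q g) (fun v => t v.1.2) (fun w => b w.2)
    (fun w => by rw [patternEquations, aeval_rename, hel, h0])
    (fun w => by
      have := pderiv_rename (hinj w.1) none (Q w.2)
      rw [Option.map_none] at this
      rw [patternEquations, this, aeval_rename, hel]
      exact h1 _) (rename Sum.inr p) with ⟨S, hS, h3⟩ | ⟨S, ψ, χ, hχ, hS, h3⟩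
  · obtain ⟨P, hP, hP2⟩ := exists_localGrid_of_pattern p Q t b h0 h1 h2 g hg2 J hsep S hS h3
    exact (hp _ hJ P hP hP2).elim
  · let π : Set.range g ⊕ (Fin k × Fin n) → Fin r ⊕ Fin n := Sum.map (fun v => v.1.2) Prod.snd
    have h4 : aeval (fun v => e (Sum.elim t b (π v))) S ≠ 0 := by
      have h5 : (fun v => Sum.elim t b (π v)) =
          Sum.elim (fun v : Set.range g => t v.1.2) fun w : Fin k × Fin n => b w.2 := by
        funext v
        cases v <;> rfl
      change aeval (fun v => e ((fun v => Sum.elim t b (π v)) v)) S ≠ 0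
      rw [← comp_aeval_apply, h5]
      exact fun h => hS (e.toRingHom.injective (h.trans (map_zero e).symm))
    filter_upwards [eventually_aeval_ne_zero (fun o => e (Sum.elim t b o)) π S h4] with ε hε
    refine ⟨S, ψ, χ, hχ, h3, fun z hz hz' => hε z ?_⟩
    rintro (v | w)
    · exact hz v
    · exact hz' w

/-- The data of a color class: `a` has parameters `σ` compatible with the given polynomials,
boxes and color `d`. -/
def GoodBoxes {T D : Type} {r : ℕ} (B : ℕ) (e : K →ₐ[ℚ] ℂ) (p : MvPolynomial (Fin k × Fin n) ℚ)
    (x : T → K) (a : Fin n → K) (γ : (Fin r → T) → D)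
    (Q : Fin n → MvPolynomial (Option (Fin r)) ℚ) (β : Fin r ⊕ Fin n → Set ℂ) (d : D) : Prop :=
  ∃ σ : Fin r → T, γ σ = d ∧
    (∀ j, aeval (fun o : Option (Fin r) => o.elim (a j) (x ∘ σ)) (Q j) = 0) ∧
    (∀ o, e (Sum.elim (x ∘ σ) a o) ∈ β o) ∧
    (∀ c c', c ≠ c' → Disjoint (β (.inl c)) (β (.inl c'))) ∧
    (∀ j b, aeval (fun o : Option (Fin r) => o.elim b (x ∘ σ)) (Q j) = 0 → e b ∈ β (.inr j) →
      b = a j) ∧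
    ∀ g : Fin k × Fin r → Fin k × Fin r, SeparatedPattern B g → EliminationOn p Q g β

theorem exists_goodBoxes {B : ℕ} (e : K →ₐ[ℚ] ℂ) (p : MvPolynomial (Fin k × Fin n) ℚ)
    (hp : ∀ m ≤ B, ∀ P : Fin k → Fin m → Fin k, Function.Injective P → ¬ LocalGrid K p m P)
    {T : Type} {x : T → K} (hx : IsTranscendenceBasis ℚ x) {D : ℕ → Type}
    (γ : ∀ r, (Fin r → T) → D r) (a : Fin n → K) :
    ∃ (r : ℕ) (Q : Fin n → MvPolynomial (Option (Fin r)) ℚ)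
      (β : Fin r ⊕ Fin n → TopologicalSpace.countableBasis ℂ) (d : D r),
      GoodBoxes B e p x a (γ r) Q (fun o => (β o : Set ℂ)) d := by
  classical
  obtain ⟨r, σ, Q, hσ, h0, h1, h2⟩ := exists_local_polynomials hx a
  have heinj : Function.Injective e := e.toRingHom.injective
  let pt : Fin r ⊕ Fin n → ℂ := fun o => e (Sum.elim (x ∘ σ) a o)
  have hA : ∀ᶠ ε in 𝓝[>] (0 : ℝ), ∀ c c' : Fin r, c ≠ c' →
      Disjoint (ball (pt (.inl c)) ε) (ball (pt (.inl c')) ε) := by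
    refine eventually_all.2 fun c => eventually_all.2 fun c' => ?_
    by_cases hc : c = c'
    · exact Eventually.of_forall fun _ h => (h hc).elim
    have h3 : 0 < dist (pt (.inl c)) (pt (.inl c')) := by
      refine dist_pos.2 fun h => hc ?_
      exact hσ (hx.1.injective (heinj h))
    filter_upwards [Ioo_mem_nhdsGT (half_pos h3)] with ε hε _
    exact ball_disjoint_ball (by linarith [hε.2])
  have hB : ∀ᶠ ε in 𝓝[>] (0 : ℝ), ∀ j b,
      aeval (fun o : Option (Fin r) => o.elim b (x ∘ σ)) (Q j) = 0 →
      e b ∈ ball (pt (.inr j)) ε → b = a j := by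
    refine eventually_all.2 fun j => ?_
    have h3 : uniPoly (x ∘ σ) (Q j) ≠ 0 := by
      intro h
      apply h1 j
      rw [← eval_uniPoly, ← derivative_uniPoly, h]
      simp
    have h4 : ∀ᶠ ε in 𝓝[>] (0 : ℝ), ∀ b ∈ (uniPoly (x ∘ σ) (Q j)).roots.toFinset,
        e b ∈ ball (pt (.inr j)) ε → b = a j := by
      refine (Finset.eventually_all _).2 fun b _ => ?_
      by_cases hb : b = a j
      · exact Eventually.of_forall fun _ _ => hb
      have h5 : 0 < dist (e b) (pt (.inr j)) := dist_pos.2 fun h => hb (heinj h)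
      filter_upwards [Ioo_mem_nhdsGT h5] with ε hε h
      exact ((mem_ball.1 h).trans hε.2).false.elim
    filter_upwards [h4] with ε hε b hb
    refine hε b ?_
    rw [Multiset.mem_toFinset, Polynomial.mem_roots h3, Polynomial.IsRoot, eval_uniPoly, hb]
  have hC : ∀ᶠ ε in 𝓝[>] (0 : ℝ), ∀ g : Fin k × Fin r → Fin k × Fin r, SeparatedPattern B g →
      EliminationOn p Q g fun o => ball (pt o) ε := by
    refine eventually_all.2 fun g => ?_
    by_cases hg : SeparatedPattern B g
    · filter_upwards [eventually_eliminationOn e p hp Q (x ∘ σ) a h0 h1 h2 g hg] with ε hε _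
      exact hε
    · exact Eventually.of_forall fun _ h => (hg h).elim
  obtain ⟨ε, ⟨hA, hB, hC⟩, β, hβ⟩ := exists_basic_boxes pt (hA.and (hB.and hC))
  exact ⟨r, Q, β, γ r σ, σ, rfl, h0, fun o => (hβ o).1,
    fun c c' hc => (hA c c' hc).mono (hβ _).2 (hβ _).2, fun j b hb hb' => hB j b hb ((hβ _).2 hb'),
    fun g hg => (hC g hg).mono fun o => (hβ o).2⟩

theorem eq_of_goodBoxes {T D : Type} {B r : ℕ} (i₀ : Fin k) {e : K →ₐ[ℚ] ℂ}
    {p : MvPolynomial (Fin k × Fin n) ℚ} {x : T → K} (hx : IsTranscendenceBasis ℚ x)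
    {γ : (Fin r → T) → D} {Q : Fin n → MvPolynomial (Option (Fin r)) ℚ}
    {β : Fin r ⊕ Fin n → Set ℂ} {d : D} (a : Fin k → Fin n → K)
    (hγ : ∀ σ : Fin k → Fin r → T, Function.Injective σ → (∀ i j, γ (σ i) = γ (σ j)) →
      ∃ J : Finset (Fin r), J.card ≤ B ∧ ∀ i j, (∀ c ∈ J, σ i c = σ j c) → i = j)
    (h : ∀ i, GoodBoxes B e p x (a i) γ Q β d) (ha : Function.Injective a)
    (h0 : aeval (fun v : Fin k × Fin n => a v.1 v.2) p = 0) : False := by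
  choose σ hd hQ hβ hdis hiso helim using h
  have hσ : Function.Injective σ := by
    intro i i' hii
    refine ha (funext fun j => hiso i' j _ ?_ (hβ i (.inr j)))
    rw [← hii]
    exact hQ i j
  obtain ⟨J, hJ, hJ2⟩ := hγ σ hσ fun i j => (hd i).trans (hd j).symm
  let u : Fin k × Fin r → T := fun v => σ v.1 v.2
  let g : Fin k × Fin r → Fin k × Fin r := fun v => (Quotient.mk (Setoid.ker u) v).out
  have hug : ∀ v, u (g v) = u v := fun v => Quotient.mk_out (s := Setoid.ker u) v
  have hgu : ∀ v v', u v = u v' → g v = g v' := by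
    intro v v' hv
    exact congrArg Quotient.out (Quotient.sound (s := Setoid.ker u) hv)
  have hsep : SeparatedPattern B g := by
    refine ⟨fun v => ?_, J, hJ, fun i i' hii => hJ2 i i' fun c hc => ?_⟩
    · by_contra hv
      have h1 := hβ (g v).1 (.inl (g v).2)
      have h2 := hβ v.1 (.inl v.2)
      have h3 : x (σ (g v).1 (g v).2) = x (σ v.1 v.2) := congrArg x (hug v)
      simp only [Sum.elim_inl, Function.comp] at h1 h2
      rw [h3] at h1
      exact Set.disjoint_left.1 (hdis i₀ _ _ hv) h1 h2
    · have h1 := hug (i, c)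
      rw [hii c hc, hug] at h1
      exact h1.symm
  obtain ⟨S, ψ, χ, hχ, hmem, hS⟩ := helim i₀ g hsep
  let z : Set.range g ⊕ (Fin k × Fin n) → K := Sum.elim (fun v => x (u v.1)) fun w => a w.1 w.2
  have hz : aeval z S ≠ 0 := by
    have h1 := hS (fun v => e (z v)) (fun v => hβ v.1.1 (.inl v.1.2)) fun w => hβ w.1 (.inr w.2)
    rw [← comp_aeval_apply] at h1
    exact fun h => h1 (by rw [h, map_zero])
  have h1 := aeval_eq_zero_of_mem_eqIdeal (z := z) (fun w => by
    rw [patternEquations, aeval_rename, ← hQ w.1 w.2]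
    congr 1
    congr 1
    funext o
    cases o with
    | none => rfl
    | some c =>
      simp only [Function.comp, Option.map_some, Option.elim_some, z, Sum.elim_inl, hug]
      rfl) hmem
  rw [map_mul, mul_eq_zero, or_iff_right hz, map_sub, map_mul, aeval_rename, aeval_rename] at h1
  have h2 : aeval (z ∘ Sum.inr) p = 0 := h0
  rw [h2, zero_mul, zero_sub, neg_eq_zero] at h1
  refine hχ ((algebraicIndependent_iff.1 (hx.1.comp (fun v : Set.range g => u v.1) ?_)) χ h1)
  rintro ⟨_, v, rfl⟩ ⟨_, v', rfl⟩ hv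
  refine Subtype.ext (hgu v v' ?_)
  simpa only [hug] using hv

/-- If `p` is not avoidable over `K` then it has a local grid. -/
theorem exists_localGrid {κ : Cardinal.{0}} (hκ : ℵ₀ ≤ κ) (e : K →ₐ[ℚ] ℂ) {T : Type} {x : T → K}
    (hx : IsTranscendenceBasis ℚ x) {B : ℕ} (i₀ : Fin k) (hT : SeparatedColoring κ T B k)
    (p : MvPolynomial (Fin k × Fin n) ℚ) (hp : ¬ AvoidableOver K κ p) :
    ∃ m ≤ B, ∃ P : Fin k → Fin m → Fin k, Function.Injective P ∧ LocalGrid K p m P := by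
  by_contra! hno
  choose D γ hD hγ using hT
  choose r Q β d hgood using exists_goodBoxes e p hno hx γ
  refine hp ⟨Σ r, (Fin n → MvPolynomial (Option (Fin r)) ℚ) ×
    (Fin r ⊕ Fin n → TopologicalSpace.countableBasis ℂ) × D r,
    fun a => ⟨r a, Q a, β a, d a⟩, ?_, fun a ha h0 => ?_⟩
  · rw [mk_sigma]
    refine (sum_le_sum _ (fun _ => κ) fun s => ?_).trans ?_
    · have h1 : Countable (MvPolynomial (Option (Fin s)) ℚ) := by
        rw [← mk_le_aleph0_iff]
        exact MvPolynomial.cardinalMk_le_max.trans (by simp)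
      rw [mk_prod, mk_prod, lift_id, lift_id, lift_id, lift_id]
      exact mul_le_of_le hκ ((mk_le_aleph0).trans hκ)
        (mul_le_of_le hκ ((mk_le_aleph0).trans hκ) (hD s))
    · rw [sum_const, lift_id, lift_id, mk_nat]
      exact mul_le_of_le hκ hκ le_rfl
  · by_contra! hcol
    have h1 : ∀ i, GoodBoxes B e p x (a i) (γ (r (a i₀))) (Q (a i₀))
        (fun o => (β (a i₀) o : Set ℂ)) (d (a i₀)) := by
      intro i
      have h2 : ∀ c : Σ r, (Fin n → MvPolynomial (Option (Fin r)) ℚ) ×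
          (Fin r ⊕ Fin n → TopologicalSpace.countableBasis ℂ) × D r,
          ⟨r (a i), Q (a i), β (a i), d (a i)⟩ = c →
          GoodBoxes B e p x (a i) (γ c.1) c.2.1 (fun o => (c.2.2.1 o : Set ℂ)) c.2.2.2 := by
        rintro _ rfl
        exact hgood (a i)
      exact h2 _ (hcol i i₀)
    exact eq_of_goodBoxes i₀ hx a (hγ _) h1 ha h0

end GridExtraction

section SignedPolynomials

open MvPolynomial

/-- Integer polynomials as lists of signed monomials; a monomial is a list of variables. -/
abbrev SPoly := List (Bool × List ℕ)

namespace SPoly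

variable {R R' : Type*} [CommRing R] [CommRing R']

/-- The sign of a term. -/
def sgn (R : Type*) [CommRing R] (b : Bool) : R := if b then 1 else -1

/-- Evaluation of a signed polynomial. -/
def ev (x : ℕ → R) (L : SPoly) : R := (L.map fun e => sgn R e.1 * (e.2.map x).prod).sum

/-- The product of signed polynomials. -/
def mul (A B : SPoly) : SPoly := A.flatMap fun a => B.map fun b => (a.1 == b.1, a.2 ++ b.2)

/-- The negative of a signed polynomial. -/
def neg (A : SPoly) : SPoly := A.map fun a => (!a.1, a.2)

/-- Renaming of variables. -/
def ren (f : ℕ → ℕ) (A : SPoly) : SPoly := A.map fun a => (a.1, a.2.map f)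

/-- The constant `c` or `-c`. -/
def const (b : Bool) (c : ℕ) : SPoly := (List.range c).map fun _ => (b, [])

/-- All coefficients vanish. -/
def IsZero (L : SPoly) : Prop := ∀ e ∈ L,
  (L.filter fun f => f.2.Perm e.2 ∧ f.1 = true).length =
    (L.filter fun f => f.2.Perm e.2 ∧ f.1 = false).length

/-- The constant coefficient is larger than the sum of the others in absolute value. -/
def Dom (L : SPoly) : Prop := L.length < 2 * (L.filter fun f => f = (true, [])).length

@[simp] theorem ev_nil (x : ℕ → R) : ev x [] = 0 := rfl

@[simp] theorem ev_cons (x : ℕ → R) (e : Bool × List ℕ) (L : SPoly) :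
    ev x (e :: L) = sgn R e.1 * (e.2.map x).prod + ev x L := by simp [ev]

@[simp] theorem ev_append (x : ℕ → R) (A B : SPoly) : ev x (A ++ B) = ev x A + ev x B := by
  simp [ev]

theorem sgn_beq (a b : Bool) : sgn R (a == b) = sgn R a * sgn R b := by
  cases a <;> cases b <;> simp [sgn]

theorem sgn_not (a : Bool) : sgn R (!a) = - sgn R a := by cases a <;> simp [sgn]

@[simp] theorem ev_mul (x : ℕ → R) (A B : SPoly) : ev x (mul A B) = ev x A * ev x B := by
  induction A with
  | nil => simp [mul]
  | cons a A ih =>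
    have h : ev x (B.map fun b => (a.1 == b.1, a.2 ++ b.2)) =
        sgn R a.1 * (a.2.map x).prod * ev x B := by
      clear ih
      induction B with
      | nil => simp
      | cons b B ih => simp [ih, sgn_beq]; ring
    rw [mul, List.flatMap_cons, ev_append, h, ← mul, ih, ev_cons]
    ring

@[simp] theorem ev_neg (x : ℕ → R) (A : SPoly) : ev x (neg A) = - ev x A := by
  induction A with
  | nil => simp [neg]
  | cons a A ih => rw [neg, List.map_cons, ev_cons, ← neg, ih]; simp [sgn_not]; ring

@[simp] theorem ev_ren (x : ℕ → R) (f : ℕ → ℕ) (A : SPoly) :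
    ev x (ren f A) = ev (fun v => x (f v)) A := by
  simp [ev, ren, Function.comp_def]

@[simp] theorem ev_const (x : ℕ → R) (b : Bool) (c : ℕ) : ev x (const b c) = sgn R b * c := by
  simp [ev, const, mul_comm]

theorem ev_flatMap {α : Type*} (x : ℕ → R) (l : List α) (f : α → SPoly) :
    ev x (l.flatMap f) = (l.map fun a => ev x (f a)).sum := by
  induction l with
  | nil => simp
  | cons a l ih => simp [ih]

theorem map_ev (φ : R →+* R') (x : ℕ → R) (L : SPoly) : φ (ev x L) = ev (fun v => φ (x v)) L := by
  induction L with
  | nil => simp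
  | cons e L ih =>
    rw [ev_cons, ev_cons, map_add, ih, map_mul, map_list_prod, List.map_map]
    congr 2
    cases e.1 <;> simp [sgn]

theorem prod_map_X (l : List ℕ) : (l.map (X : ℕ → MvPolynomial ℕ ℤ)).prod =
    monomial (Multiset.toFinsupp (l : Multiset ℕ)) 1 := by
  induction l with
  | nil => simp
  | cons a l ih =>
    rw [List.map_cons, List.prod_cons, ih, ← Multiset.cons_coe, ← Multiset.singleton_add, map_add,
      Multiset.toFinsupp_singleton, X, monomial_mul, one_mul]

theorem coeff_ev_X (L : SPoly) (l : List ℕ) :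
    coeff (Multiset.toFinsupp (l : Multiset ℕ)) (ev (X : ℕ → MvPolynomial ℕ ℤ) L) =
      ((L.filter fun f => f.2.Perm l ∧ f.1 = true).length : ℤ) -
        (L.filter fun f => f.2.Perm l ∧ f.1 = false).length := by
  induction L with
  | nil => simp
  | cons e L ih =>
    obtain ⟨b, m⟩ := e
    rw [ev_cons, coeff_add, ih, prod_map_X]
    have h : Multiset.toFinsupp (m : Multiset ℕ) = Multiset.toFinsupp (l : Multiset ℕ) ↔
        m.Perm l := by
      rw [EmbeddingLike.apply_eq_iff_eq, Multiset.coe_eq_coe]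
    by_cases hm : m.Perm l
    · cases b <;> simp [sgn, coeff_monomial, h, hm] <;> ring
    · cases b <;> simp [sgn, coeff_monomial, h, hm]

theorem isZero_iff (L : SPoly) : IsZero L ↔ ev (X : ℕ → MvPolynomial ℕ ℤ) L = 0 := by
  constructor
  · intro h
    ext m
    obtain ⟨s, rfl⟩ := Multiset.toFinsupp.surjective m
    obtain ⟨l, rfl⟩ := Quot.exists_rep s
    have h1 := coeff_ev_X L l
    change coeff (Multiset.toFinsupp (l : Multiset ℕ)) _ = _
    rw [h1, coeff_zero]
    by_cases hl : ∃ e ∈ L, e.2.Perm l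
    · obtain ⟨e, he, hel⟩ := hl
      have h2 := h e he
      have h3 : ∀ f : Bool × List ℕ, f.2.Perm e.2 ↔ f.2.Perm l := fun f =>
        ⟨fun h => h.trans hel, fun h => h.trans hel.symm⟩
      simp only [h3] at h2
      rw [h2, sub_self]
    · push Not at hl
      have h4 : ∀ b, (L.filter fun f => f.2.Perm l ∧ f.1 = b) = [] := by
        intro b
        rw [List.filter_eq_nil_iff]
        intro f hf
        simp [hl f hf]
      rw [h4, h4, sub_self]
  · intro h e _
    have h1 := coeff_ev_X L e.2
    rw [h, coeff_zero] at h1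
    omega

theorem IsZero.ev_eq_zero {L : SPoly} (h : IsZero L) (x : ℕ → R) : ev x L = 0 := by
  have h1 := map_ev (aeval x : MvPolynomial ℕ ℤ →ₐ[ℤ] R).toRingHom X L
  rw [(isZero_iff L).1 h, map_zero] at h1
  simpa using h1.symm

theorem isZero_of_forall {L : SPoly}
    (h : ev (X : ℕ → MvPolynomial ℕ ℚ) L = 0) : IsZero L := by
  rw [isZero_iff]
  apply map_injective (Int.castRingHom ℚ) Int.cast_injective
  rw [map_ev (map (Int.castRingHom ℚ))]
  simpa using h

theorem Dom.pos {L : SPoly} (h : Dom L) {x : ℕ → ℝ} (hx : ∀ v, |x v| ≤ 1) : 0 < ev x L := by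
  have h1 : ∀ L : SPoly, 2 * ((L.filter fun f => f = (true, [])).length : ℝ) - L.length ≤
      ev x L := by
    intro L
    induction L with
    | nil => simp
    | cons e L ih =>
      rw [ev_cons]
      by_cases he : e = (true, [])
      · subst he
        simp only [List.filter_cons, decide_true, if_true, List.length_cons]
        push_cast
        simp only [sgn, List.map_nil, List.prod_nil, if_true]
        linarith
      · have h2 : |sgn ℝ e.1 * (e.2.map x).prod| ≤ 1 := by
          rw [abs_mul]
          have h3 : |sgn ℝ e.1| = 1 := by cases e.1 <;> simp [sgn]
          rw [h3, one_mul]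
          induction e.2 with
          | nil => simp
          | cons v l ih =>
            rw [List.map_cons, List.prod_cons, abs_mul]
            exact mul_le_one₀ (hx v) (abs_nonneg _) ih
        simp only [List.filter_cons, he, decide_false, List.length_cons]
        push_cast
        have := (abs_le.1 h2).1
        linarith
  have h2 : (L.length : ℝ) < 2 * (L.filter fun f => f = (true, [])).length := by exact_mod_cast h
  linarith [h1 L]

theorem exists_ev_eq_rat (f : MvPolynomial ℕ ℚ) :
    ∃ (d : ℕ) (L : SPoly), 0 < d ∧ ev X L = (d : MvPolynomial ℕ ℚ) * f := by
  induction f using MvPolynomial.induction_on with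
  | C a =>
    refine ⟨a.den, const (decide (0 ≤ a.num)) a.num.natAbs, a.den_pos, ?_⟩
    rw [ev_const]
    have h : (a.den : ℚ) * a = sgn ℚ (decide (0 ≤ a.num)) * (a.num.natAbs : ℚ) := by
      rw [mul_comm, Rat.mul_den_eq_num, ← Int.cast_natCast, Int.natCast_natAbs]
      by_cases h : 0 ≤ a.num
      · rw [abs_of_nonneg h]; simp [sgn, h]
      · rw [abs_of_nonpos (le_of_not_ge h)]; simp [sgn, h]
    have h2 := congrArg (C : ℚ → MvPolynomial ℕ ℚ) h
    rw [map_mul, map_mul] at h2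
    rw [← map_natCast (C : ℚ →+* MvPolynomial ℕ ℚ) a.den, h2]
    congr 1
    · by_cases h : 0 ≤ a.num <;> simp [sgn, h]
  | add p q hp hq =>
    obtain ⟨d, A, hd, hA⟩ := hp
    obtain ⟨e, B, he, hB⟩ := hq
    refine ⟨d * e, mul (const true e) A ++ mul (const true d) B, Nat.mul_pos hd he, ?_⟩
    simp only [ev_append, ev_mul, ev_const, hA, hB, sgn, if_true]
    push_cast
    ring
  | mul_X p i hp =>
    obtain ⟨d, A, hd, hA⟩ := hp
    exact ⟨d, mul A [(true, [i])], hd, by simp [sgn, hA, mul_assoc]⟩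

end SPoly

end SignedPolynomials

section IntegerForm

open MvPolynomial

namespace SPoly

/-- The sign, absolute numerator and denominator of a rational number. -/
def ratData (q : ℚ) : Bool × ℕ × ℕ := (decide (0 ≤ q.num), q.num.natAbs, q.den)

/-- The common denominator of the coefficients. -/
def codeDen (c : PolyCode) : ℕ := c.foldr (fun e s => (ratData e.1).2.2 * s) 1

/-- The list of variables of a monomial given by its exponents. -/
def codeMonomial (N : ℕ) (l : List ℕ) : List ℕ :=
  (List.range N).flatMap fun e => (List.range (l.getD e 0)).map fun _ => e

/-- A polynomial code with denominators cleared. -/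
def codePoly (N : ℕ) (c : PolyCode) : SPoly := c.flatMap fun e =>
  (List.range ((ratData e.1).2.1 * (codeDen c / (ratData e.1).2.2))).map fun _ =>
    ((ratData e.1).1, codeMonomial N e.2)

theorem codeDen_pos (c : PolyCode) : 0 < codeDen c := by
  induction c with
  | nil => simp [codeDen]
  | cons e c ih => exact Nat.mul_pos e.1.den_pos ih

theorem den_dvd_codeDen {c : PolyCode} {e : ℚ × List ℕ} (he : e ∈ c) : e.1.den ∣ codeDen c := by
  induction c with
  | nil => simp at he
  | cons f c ih =>
    rcases List.mem_cons.1 he with rfl | he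
    · exact Dvd.intro _ rfl
    · exact (ih he).mul_left _

variable {R : Type*} [CommRing R]

theorem prod_codeMonomial (x : ℕ → R) (k n : ℕ) (l : List ℕ) :
    ((codeMonomial (k * n) l).map x).prod =
      ∏ v : Fin k × Fin n, x (v.1.1 * n + v.2.1) ^ l.getD (v.1.1 * n + v.2.1) 0 := by
  have h1 : ∀ N, ((codeMonomial N l).map x).prod = ∏ e : Fin N, x e ^ l.getD e 0 := by
    intro N
    rw [Fin.prod_univ_eq_prod_range (fun e => x e ^ l.getD e 0) N, codeMonomial]
    induction N with
    | zero => simp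
    | succ N ih =>
      rw [List.range_succ, List.flatMap_append, List.map_append, List.prod_append, ih,
        Finset.prod_range_succ]
      simp
  rw [h1, ← finProdFinEquiv.prod_comp]
  refine Finset.prod_congr rfl fun v _ => ?_
  have h2 : (finProdFinEquiv v).1 = v.1.1 * n + v.2.1 := by
    simp [finProdFinEquiv, add_comm, mul_comm]
  rw [h2]

theorem ratData_spec [Algebra ℚ R] (q : ℚ) (D : ℕ) (h : q.den ∣ D) :
    sgn R (ratData q).1 * ((ratData q).2.1 * (D / (ratData q).2.2) : ℕ) =
      (D : R) * algebraMap ℚ R q := by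
  obtain ⟨d, rfl⟩ := h
  have h1 : (q.den : ℚ) * q = sgn ℚ (ratData q).1 * ((ratData q).2.1 : ℚ) := by
    rw [mul_comm, Rat.mul_den_eq_num, ratData, ← Int.cast_natCast, Int.natCast_natAbs]
    by_cases h : 0 ≤ q.num
    · rw [abs_of_nonneg h]; simp [sgn, Rat.num_nonneg.1 h]
    · have : ¬ 0 ≤ q := fun h' => h (Rat.num_nonneg.2 h')
      rw [abs_of_nonpos (le_of_not_ge h)]; simp [sgn, this]
  have h2 := congrArg (algebraMap ℚ R) h1
  have h3 : algebraMap ℚ R (sgn ℚ (ratData q).1) = sgn R (ratData q).1 := by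
    cases (ratData q).1 <;> simp [sgn]
  rw [map_mul, map_mul, h3, map_natCast, map_natCast] at h2
  have h4 : q.den * d / (ratData q).2.2 = d := Nat.mul_div_cancel_left _ q.den_pos
  rw [h4]
  push_cast
  rw [← mul_assoc, ← h2]
  ring

theorem ev_codePoly [Algebra ℚ R] (x : ℕ → R) (k n : ℕ) (c : PolyCode) :
    ev x (codePoly (k * n) c) = (codeDen c : R) *
      aeval (fun v : Fin k × Fin n => x (v.1.1 * n + v.2.1)) (decodePoly k n c) := by
  rw [codePoly, ev_flatMap, decodePoly, map_list_sum, ← List.sum_map_mul_left, List.map_map]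
  congr 1
  refine List.map_congr_left fun e he => ?_
  have h1 : ∀ N : ℕ, ev x ((List.range N).map fun _ => ((ratData e.1).1, codeMonomial (k * n) e.2)) =
      sgn R (ratData e.1).1 * N * ((codeMonomial (k * n) e.2).map x).prod := by
    intro N
    simp [ev]
    ring
  rw [h1, prod_codeMonomial, ratData_spec _ _ (den_dvd_codeDen he)]
  simp [mul_assoc]

end SPoly

end IntegerForm

section Grids

open MvPolynomial Cardinal

variable {k n : ℕ}

/-- The zeros of `p` contain all the tuples of points of a grid, indexed by the functions from
`Fin m` to `X`, whose labels agree as prescribed by `P`; points on a line of the grid are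
distinct. -/
def GridOver (K : Type) [Field K] [Algebra ℚ K] (X : Type) (p : MvPolynomial (Fin k × Fin n) ℚ)
    (m : ℕ) (P : Fin k → Fin m → Fin k) : Prop :=
  ∃ Y : (Fin m → X) → Fin n → K,
    (∀ v : Fin k → Fin m → X, aeval (fun w : Fin k × Fin n => Y (fun c => v (P w.1 c) c) w.2) p = 0) ∧
    ∀ (u : Fin m → X) (c : Fin m) (e : X), e ≠ u c → Y (Function.update u c e) ≠ Y u

theorem GridOver.not_avoidableOver {K : Type} [Field K] [Algebra ℚ K] {X : Type}
    {p : MvPolynomial (Fin k × Fin n) ℚ} {m : ℕ} {P : Fin k → Fin m → Fin k}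
    (h : GridOver K X p m P) (hP : Function.Injective P) {κ : Cardinal.{0}} (hκ : ℵ₀ ≤ κ)
    (hX : Order.succ^[m] κ ≤ #X) : ¬ AvoidableOver K κ p := by
  rintro ⟨C, φ, hC, hφ⟩
  obtain ⟨Y, hp, hY⟩ := h
  obtain ⟨v, hv, hm⟩ := exists_monochromatic_tuple hκ hC hX P hP Y hY φ
  obtain ⟨i, j, hij⟩ := hφ _ hv (hp v)
  exact hij (hm i j)

end Grids

section PositiveCertificates

open MvPolynomial

namespace SPoly

theorem continuous_ev {Z : Type*} [TopologicalSpace Z] {x : Z → ℕ → ℝ}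
    (hx : ∀ v, Continuous fun z => x z v) (L : SPoly) : Continuous fun z => ev (x z) L := by
  induction L with
  | nil => simpa using continuous_const
  | cons e L ih =>
    simp only [ev_cons]
    refine Continuous.add (continuous_const.mul ?_) ih
    exact continuous_list_prod _ fun v _ => hx v

theorem Dom.pos_of_mem {L : SPoly} (h : Dom L) {x : ℕ → ℝ} (hx : ∀ v, x v ∈ Set.Icc (-1 : ℝ) 1) :
    0 < ev x L := h.pos fun v => abs_le.2 (hx v)

/-- The entry at `c` of the row `i` of the matrix coded by `N`. -/
def rowOf (k m N i c : ℕ) : ℕ := N / k ^ (i * m + c) % k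

/-- The data for one coordinate of the points of the grid: a denominator, a radius and a centre,
a polynomial defining the coordinate, and witnesses for its signs at the ends of the interval. -/
abbrev Link := ℕ × ℕ × (Bool × ℕ) × SPoly × SPoly × SPoly × SPoly × SPoly

/-- The polynomial defining a coordinate. -/
abbrev Link.poly (l : Link) : SPoly := l.2.2.2.1

/-- The polynomial changes its sign between the ends of the interval. -/
def Link.OK (l : Link) : Prop :=
  1 ≤ l.1 ∧ 1 ≤ l.2.1 ∧ Dom l.2.2.2.2.1 ∧ Dom l.2.2.2.2.2.2.1 ∧
  IsZero (l.2.2.2.1 ++ neg (l.2.2.2.2.1 ++ mul [(true, [0]), (false, [])] l.2.2.2.2.2.1)) ∧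
  IsZero (l.2.2.2.1 ++ (l.2.2.2.2.2.2.1 ++ neg (mul [(true, [0]), (true, [])] l.2.2.2.2.2.2.2)))

/-- The polynomial determines the label `c`. -/
def DirOK (Q : SPoly) (c : ℕ) (R : ℕ × SPoly) : Prop :=
  (Dom R.2 ∨ Dom (neg R.2)) ∧ IsZero (mul (const true R.1)
    (ren Nat.succ Q ++ neg (ren (fun v => if v = c + 1 then 0 else v + 1) Q)) ++
      neg (mul [(true, [c + 2]), (false, [0])] R.2))

/-- The variable for a coordinate or a label of a point of a row. -/
def boxVar (k m N i j v : ℕ) : ℕ :=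
  2 * Nat.pair v (if v = 0 then Nat.pair i j else rowOf k m N i (v - 1))

/-- The equations of the grid. -/
def posGen (k n m N : ℕ) (ls : List Link) (g : Bool × ℕ × ℕ) : SPoly :=
  if g.1 = true then ren (boxVar k m N g.2.1 g.2.2) (ls.getD g.2.2 default).poly
  else mul (const true (ls.getD g.2.2 default).1) [(true, [2 * (g.2.1 * n + g.2.2) + 1])] ++
    (neg (const (ls.getD g.2.2 default).2.2.1.1 (ls.getD g.2.2 default).2.2.1.2) ++
      neg (mul (const true (ls.getD g.2.2 default).2.1) [(true, [boxVar k m N g.2.1 g.2.2 0])]))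

/-- A certificate for the existence of a grid over the reals. -/
abbrev PosCert := List Link × List (ℕ × ℕ × SPoly) × SPoly × List (SPoly × Bool × ℕ × ℕ)

/-- The validity of a certificate. -/
def PosCheck (k n m N : ℕ) (pI : SPoly) (z : PosCert) : Prop :=
  (∀ j < n, (z.1.getD j default).OK) ∧
  (∀ c < m, (z.2.1.getD c default).1 < n ∧
    DirOK (z.1.getD (z.2.1.getD c default).1 default).poly c (z.2.1.getD c default).2) ∧
  Dom z.2.2.1 ∧ (∀ h ∈ z.2.2.2, h.2.2.1 < k ∧ h.2.2.2 < n) ∧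
  IsZero (mul (ren (fun v => 2 * v) z.2.2.1) (ren (fun v => 2 * v + 1) pI) ++
    neg (z.2.2.2.flatMap fun h => mul h.1 (posGen k n m N z.1 h.2)))

theorem Link.OK.exists_root {l : Link} (h : l.OK) {t : ℕ → ℝ}
    (ht : ∀ v, t v ∈ Set.Icc (-1 : ℝ) 1) :
    ∃ y ∈ Set.Icc (-1 : ℝ) 1, ev (fun v => if v = 0 then y else t v) l.poly = 0 := by
  obtain ⟨-, -, h1, h2, h3, h4⟩ := h
  set f : ℝ → ℝ := fun y => ev (fun v => if v = 0 then y else t v) l.poly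
  have hf : Continuous f := by
    refine continuous_ev (fun v => ?_) _
    by_cases hv : v = 0 <;> simp only [hv, if_true, if_false]
    · exact continuous_id
    · exact continuous_const
  have hb : ∀ y ∈ Set.Icc (-1 : ℝ) 1, ∀ v,
      (if v = 0 then y else t v) ∈ Set.Icc (-1 : ℝ) 1 := by
    intro y hy v
    split_ifs
    · exact hy
    · exact ht v
  have hp : 0 < f 1 := by
    have e1 := h3.ev_eq_zero (fun v => if v = 0 then (1 : ℝ) else t v)
    have e2 := h1.pos_of_mem (hb 1 (by norm_num))
    simp only [ev_append, ev_neg, ev_mul, ev_cons, ev_nil, sgn] at e1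
    simp only [f]
    norm_num at e1
    linarith
  have hn : f (-1) < 0 := by
    have e1 := h4.ev_eq_zero (fun v => if v = 0 then (-1 : ℝ) else t v)
    have e2 := h2.pos_of_mem (hb (-1) (by norm_num))
    simp only [ev_append, ev_neg, ev_mul, ev_cons, ev_nil, sgn] at e1
    simp only [f]
    norm_num at e1
    linarith
  obtain ⟨y, hy, hy0⟩ := intermediate_value_Icc (show (-1 : ℝ) ≤ 1 by norm_num) hf.continuousOn
    ⟨hn.le, hp.le⟩
  exact ⟨y, hy, hy0⟩

theorem DirOK.eq_of_root {Q : SPoly} {R : ℕ × SPoly} {c : ℕ} (h : DirOK Q c R) {x : ℕ → ℝ}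
    (hx : ∀ v, x v ∈ Set.Icc (-1 : ℝ) 1) {e : ℝ} (he : e ∈ Set.Icc (-1 : ℝ) 1)
    (h0 : ev x Q = 0) (h1 : ev (fun v => if v = c + 1 then e else x v) Q = 0) : e = x (c + 1) := by
  set z : ℕ → ℝ := fun v => if v = 0 then e else x (v - 1)
  have hz : ∀ v, z v ∈ Set.Icc (-1 : ℝ) 1 := by
    intro v
    simp only [z]
    split_ifs
    · exact he
    · exact hx _
  have e1 := h.2.ev_eq_zero z
  have e2 : ev z R.2 ≠ 0 := by
    rcases h.1 with h | h
    · exact (h.pos_of_mem hz).ne'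
    · have := h.pos_of_mem hz
      rw [ev_neg] at this
      exact (neg_pos.1 this).ne
  simp only [ev_append, ev_neg, ev_mul, ev_cons, ev_nil, sgn, ev_ren] at e1
  have e3 : (fun v => z (Nat.succ v)) = x := by funext v; simp [z]
  have e4 : (fun v => z (if v = c + 1 then 0 else v + 1)) =
      fun v => if v = c + 1 then e else x v := by
    funext v
    by_cases hv : v = c + 1 <;> simp [hv, z]
  rw [e3, e4, h0, h1] at e1
  simp [z] at e1
  rcases e1 with e1 | e1
  · linarith
  · exact absurd e1 e2

variable {k n m N : ℕ}

theorem PosCheck.gridOver {z : PosCert} {co : PolyCode}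
    (h : PosCheck k n m N (codePoly (k * n) co) z) {P : Fin k → Fin m → Fin k}
    (hP : ∀ i c, (P i c : ℕ) = rowOf k m N i c) :
    GridOver ℝ (Set.Icc (-1 : ℝ) 1) (decodePoly k n co) m P := by
  obtain ⟨hl, hd, hS, hg, hid⟩ := h
  set l : Fin n → Link := fun j => z.1.getD j default with hldef
  have hl' : ∀ j, (l j).OK := fun j => hl j j.2
  set t : (Fin m → Set.Icc (-1 : ℝ) 1) → ℕ → ℝ := fun u v =>
    if hv : v - 1 < m then u ⟨v - 1, hv⟩ else 0 with htdef
  have ht : ∀ u v, t u v ∈ Set.Icc (-1 : ℝ) 1 := by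
    intro u v
    simp only [t]
    split_ifs
    · exact (u _).2
    · norm_num
  have hroot := fun (j : Fin n) u => (hl' j).exists_root (ht u)
  choose y hy hy0 using hroot
  set b : Fin n → ℝ := fun j => sgn ℝ (l j).2.2.1.1 * (l j).2.2.1.2
  have hD : ∀ j, (0 : ℝ) < (l j).1 := fun j => by exact_mod_cast (hl' j).1
  have ha : ∀ j, (0 : ℝ) < (l j).2.1 := fun j => by exact_mod_cast (hl' j).2.1
  refine ⟨fun u j => (b j + (l j).2.1 * y j u) / (l j).1, ?_, ?_⟩
  · intro v
    set row : Fin k → Fin m → Set.Icc (-1 : ℝ) 1 := fun i c => v (P i c) c with hrow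
    set B : ℕ → ℕ → ℝ := fun s r => if s = 0 then
        (if hij : r.unpair.1 < k ∧ r.unpair.2 < n then y ⟨_, hij.2⟩ (row ⟨_, hij.1⟩) else 0)
      else if hc : s - 1 < m ∧ r < k then v ⟨r, hc.2⟩ ⟨s - 1, hc.1⟩ else 0 with hB
    set W : Fin k × Fin n → ℝ := fun w =>
      (b w.2 + (l w.2).2.1 * y w.2 (row w.1)) / (l w.2).1 with hW
    set x : ℕ → ℝ := fun w => if w % 2 = 0 then B (w / 2).unpair.1 (w / 2).unpair.2
      else if hij : w / 2 / n < k ∧ w / 2 % n < n then W (⟨_, hij.1⟩, ⟨_, hij.2⟩) else 0 with hx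
    have hxe : ∀ w, x (2 * w) = B w.unpair.1 w.unpair.2 := by intro w; simp [x]
    have hxo : ∀ w : Fin k × Fin n, x (2 * (w.1.1 * n + w.2.1) + 1) = W w := by
      intro w
      have hn : 0 < n := w.2.pos
      have e1 : (2 * (w.1.1 * n + w.2.1) + 1) / 2 = w.1.1 * n + w.2.1 := by omega
      have e2 : (w.1.1 * n + w.2.1) / n = w.1.1 := by
        rw [mul_comm, Nat.mul_add_div hn, Nat.div_eq_of_lt w.2.2, add_zero]
      have e3 : (w.1.1 * n + w.2.1) % n = w.2.1 := by
        rw [mul_comm, Nat.mul_add_mod, Nat.mod_eq_of_lt w.2.2]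
      simp only [x]
      rw [if_neg (by omega)]
      simp only [e1, e2, e3, w.1.2, w.2.2, and_self, dif_pos]
    have hBb : ∀ s r, B s r ∈ Set.Icc (-1 : ℝ) 1 := by
      intro s r
      simp only [B]
      split_ifs
      · exact hy _ _
      · norm_num
      · exact (v _ _).2
      · norm_num
    have hbox : ∀ (i : Fin k) (j : Fin n) (w : ℕ), w ≤ m → x (boxVar k m N i j w) =
        if w = 0 then y j (row i) else t (row i) w := by
      intro i j w hw
      rw [boxVar, hxe, Nat.unpair_pair]
      by_cases hw0 : w = 0
      · subst hw0
        simp [B]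
      · have h1 : w - 1 < m := by omega
        have h2 : rowOf k m N i (w - 1) < k := Nat.mod_lt _ i.pos
        simp only [B, hw0, if_false, h1, h2, and_self, dif_pos, t, row]
        congr 2
        have h3 : (⟨rowOf k m N i (w - 1), h2⟩ : Fin k) = P i ⟨w - 1, h1⟩ :=
          Fin.ext (hP i ⟨w - 1, h1⟩).symm
        rw [h3]
    have hbox' : ∀ (i : Fin k) (j : Fin n), (fun w => x (boxVar k m N i j w)) =
        fun w => if w = 0 then y j (row i) else t (row i) w := by
      intro i j
      funext w
      by_cases hw : w ≤ m
      · exact hbox i j w hw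
      · have h1 : ¬ (w - 1 < m) := by omega
        have h2 : w ≠ 0 := by omega
        rw [boxVar, hxe, Nat.unpair_pair]
        simp [B, t, h1, h2]
    have hgen : ∀ g : Bool × ℕ × ℕ, g.2.1 < k → g.2.2 < n → ev x (posGen k n m N z.1 g) = 0 := by
      rintro ⟨s, i, j⟩ hi hj
      have hh := hbox' ⟨i, hi⟩ ⟨j, hj⟩
      cases s
      · have h1 := hxo (⟨i, hi⟩, ⟨j, hj⟩)
        have h2 := congrFun hh 0
        simp only [if_true] at h1 h2
        simp only [posGen, Bool.false_eq_true, if_false, ev_append, ev_mul, ev_neg, ev_const, ev_cons,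
          ev_nil, List.map_cons, List.map_nil, List.prod_cons, List.prod_nil, h1, h2]
        have h3 := (hD ⟨j, hj⟩).ne'
        simp only [W, b, l] at h3 ⊢
        simp only [sgn, if_true]
        field_simp
        ring
      · simp only [posGen, if_true, ev_ren]
        rw [hh]
        exact hy0 ⟨j, hj⟩ (row ⟨i, hi⟩)
    have e1 := hid.ev_eq_zero x
    rw [ev_append, ev_neg, ev_mul, ev_ren, ev_ren, ev_flatMap, List.sum_eq_zero, neg_zero, add_zero,
      mul_eq_zero] at e1
    · have e2 : 0 < ev (fun v => x (2 * v)) z.2.2.1 := hS.pos_of_mem fun w => by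
        rw [hxe]; exact hBb _ _
      rcases e1 with e1 | e1
      · exact absurd e1 e2.ne'
      · rw [ev_codePoly, mul_eq_zero] at e1
        rcases e1 with e1 | e1
        · exact absurd e1 (by exact_mod_cast (codeDen_pos co).ne')
        · simp only [hxo] at e1
          exact e1
    · intro w hw
      obtain ⟨g, hg1, rfl⟩ := List.mem_map.1 hw
      rw [ev_mul, hgen _ (hg _ hg1).1 (hg _ hg1).2, mul_zero]
  · intro u c e he hY
    obtain ⟨hj, hR⟩ := hd c c.2
    set j : Fin n := ⟨_, hj⟩
    have h1 := congrFun hY j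
    simp only at h1
    have h2 : y j (Function.update u c e) = y j u := by
      rw [div_left_inj' (hD j).ne', add_right_inj] at h1
      exact mul_left_cancel₀ (ha j).ne' h1
    have h3 := hy0 j u
    have h4 := hy0 j (Function.update u c e)
    rw [h2] at h4
    refine he (Subtype.ext ?_)
    have h5 := hR.eq_of_root (x := fun v => if v = 0 then y j u else t u v) (e := e)
      (fun v => ?_) e.2 h3 ?_
    · rw [h5]
      simp [t]
    · split_ifs
      · exact hy _ _
      · exact ht _ _
    · rw [← h4]
      congr 1
      funext v
      by_cases hv : v = c + 1
      · subst hv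
        simp [t]
      · by_cases hv0 : v = 0
        · simp [hv0]
        · simp only [hv, hv0, if_false, t]
          split_ifs with hvm
          · rw [Function.update_of_ne]
            intro h
            apply hv
            have := congrArg Fin.val h
            simp at this
            omega
          · rfl

end SPoly

end PositiveCertificates

section NegativeCertificates

open MvPolynomial

namespace SPoly

/-- The variable for a coordinate of a point of the grid. -/
def gridVar (u : List ℕ) (j : ℕ) : ℕ :=
  Encodable.encode (Sum.inl (u, j) : (List ℕ × ℕ) ⊕ (List ℕ × ℕ × ℕ))

/-- The variable for the inverse of the squared distance of two points on a line of the grid. -/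
def lineVar (u : List ℕ × ℕ × ℕ) : ℕ :=
  Encodable.encode (Sum.inr u : (List ℕ × ℕ) ⊕ (List ℕ × ℕ × ℕ))

/-- The label of the row `i` of a tuple of points of the grid. -/
def rowLabel (k m N : ℕ) (v : List (List ℕ)) (i : ℕ) : List ℕ :=
  (List.range m).map fun c => (v.getD c []).getD (rowOf k m N i c) 0

/-- The label with the entry at `c` replaced by `e`. -/
def lineLabel (m : ℕ) (u : List ℕ) (c e : ℕ) : List ℕ :=
  (List.range m).map fun d => if d = c then e else u.getD d 0

/-- The squared distance of two points of the grid. -/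
def distSq (n : ℕ) (u u' : List ℕ) : SPoly := (List.range n).flatMap fun j =>
  mul [(true, [gridVar u j]), (false, [gridVar u' j])]
    [(true, [gridVar u j]), (false, [gridVar u' j])]

/-- The equations of a generic grid. -/
def negGen (k n m N : ℕ) (pI : SPoly) (g : List (List ℕ) ⊕ (List ℕ × ℕ × ℕ)) : SPoly :=
  Sum.elim (fun v => ren (fun e => gridVar (rowLabel k m N v (e / n)) (e % n)) pI)
    (fun u => if u.2.1 < m ∧ u.2.2 ≠ u.1.getD u.2.1 0 then
      mul [(true, [lineVar u])] (distSq n u.1 (lineLabel m u.1 u.2.1 u.2.2)) ++ const false 1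
      else []) g

/-- A certificate for the nonexistence of infinite grids over the reals. -/
abbrev NegCert := ℕ × List SPoly × List (SPoly × (List (List ℕ) ⊕ (List ℕ × ℕ × ℕ)))

/-- The validity of a certificate. -/
def NegCheck (k n m N : ℕ) (pI : SPoly) (z : NegCert) : Prop :=
  IsZero (const true (z.1 + 1) ++ (z.2.1.flatMap (fun s => mul s s) ++
    z.2.2.flatMap fun h => mul h.1 (negGen k n m N pI h.2)))

variable {k n m N : ℕ}

theorem ev_distSq {R : Type*} [CommRing R] (x : ℕ → R) (n : ℕ) (u u' : List ℕ) :
    ev x (distSq n u u') = ∑ j : Fin n, (x (gridVar u j) - x (gridVar u' j)) ^ 2 := by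
  rw [distSq, ev_flatMap, Fin.sum_univ_eq_sum_range
    (fun j => (x (gridVar u j) - x (gridVar u' j)) ^ 2), Finset.sum_range, ← List.sum_ofFn,
    List.ofFn_eq_map, ← List.map_coe_finRange_eq_range, List.map_map]
  congr 1
  refine List.map_congr_left fun j _ => ?_
  simp [sgn]
  ring

theorem not_negCheck {p : PolyCode} {X : Type} [Infinite X] {P : Fin k → Fin m → Fin k}
    (hP : ∀ i c, (P i c : ℕ) = rowOf k m N i c) (h : GridOver ℝ X (decodePoly k n p) m P)
    (z : NegCert) : ¬ NegCheck k n m N (codePoly (k * n) p) z := by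
  intro hz
  obtain ⟨Y, hp, hY⟩ := h
  set θ : ℕ → X := ⇑(Infinite.natEmbedding X) with hθ
  have hθi : Function.Injective θ := (Infinite.natEmbedding X).injective
  set pt : List ℕ → Fin m → X := fun u c => θ (u.getD c 0) with hpt
  set G : List ℕ → ℕ → ℝ := fun u j => if hj : j < n then Y (pt u) ⟨j, hj⟩ else 0
  set x : ℕ → ℝ := fun w =>
    match (Encodable.decode w : Option ((List ℕ × ℕ) ⊕ (List ℕ × ℕ × ℕ))) with
    | some (Sum.inl (u, j)) => G u j
    | some (Sum.inr (u, c, e)) =>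
      (∑ j : Fin n, (G u j - G (lineLabel m u c e) j) ^ 2)⁻¹
    | none => 0 with hx
  have hxg : ∀ u j, x (gridVar u j) = G u j := by intro u j; simp only [x, gridVar, Encodable.encodek]
  have hxl : ∀ u, x (lineVar u) =
      (∑ j : Fin n, (G u.1 j - G (lineLabel m u.1 u.2.1 u.2.2) j) ^ 2)⁻¹ := by
    intro u; simp only [x, lineVar, Encodable.encodek]
  have hgen : ∀ g, ev x (negGen k n m N (codePoly (k * n) p) g) = 0 := by
    rintro (v | ⟨u, c, e⟩)
    · rw [negGen, Sum.elim_inl, ev_ren, ev_codePoly]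
      have h1 := hp fun i c => θ ((v.getD c []).getD i 0)
      rw [mul_eq_zero]
      right
      rw [← h1]
      congr 2
      funext w
      have hn : 0 < n := w.2.pos
      have e2 : (w.1.1 * n + w.2.1) / n = w.1.1 := by
        rw [mul_comm, Nat.mul_add_div hn, Nat.div_eq_of_lt w.2.2, add_zero]
      have e3 : (w.1.1 * n + w.2.1) % n = w.2.1 := by
        rw [mul_comm, Nat.mul_add_mod, Nat.mod_eq_of_lt w.2.2]
      rw [e2, e3, hxg]
      simp only [G, w.2.2, dif_pos]
      apply congrFun
      congr 1
      funext c
      simp [pt, rowLabel, hP]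
    · rw [negGen, Sum.elim_inr]
      split_ifs with hv
      · rw [ev_append, ev_mul, ev_distSq, ev_const, ev_cons, ev_nil]
        simp only [hxg, List.map_cons, List.map_nil, List.prod_cons, List.prod_nil, hxl, sgn]
        have h1 : (∑ j : Fin n, (G u j - G (lineLabel m u c e) j) ^ 2) ≠ 0 := by
          intro h0
          rw [Finset.sum_eq_zero_iff_of_nonneg fun _ _ => sq_nonneg _] at h0
          have h2 : pt (lineLabel m u c e) = Function.update (pt u) ⟨c, hv.1⟩ (θ e) := by
            funext d
            by_cases hd : d = ⟨c, hv.1⟩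
            · subst hd
              simp [pt, lineLabel, hv.1]
            · have hd' : (d : ℕ) ≠ c := fun h => hd (Fin.ext h)
              simp [pt, lineLabel, hd, hd']
          refine hY (pt u) ⟨c, hv.1⟩ (θ e) (fun h => hv.2 (hθi h)) ?_
          rw [← h2]
          funext j
          have h3 := h0 j (Finset.mem_univ _)
          rw [sq_eq_zero_iff, sub_eq_zero] at h3
          simpa [G] using h3.symm
        simp [h1]
      · simp
  have e1 := hz.ev_eq_zero x
  rw [ev_append, ev_append, ev_const, ev_flatMap, ev_flatMap] at e1
  have e2 : ((z.2.2.map fun h => ev x (mul h.1 (negGen k n m N (codePoly (k * n) p) h.2)))).sum = 0 := by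
    apply List.sum_eq_zero
    intro w hw
    obtain ⟨g, -, rfl⟩ := List.mem_map.1 hw
    rw [ev_mul, hgen, mul_zero]
  have e3 : 0 ≤ (z.2.1.map fun s => ev x (mul s s)).sum := by
    apply List.sum_nonneg
    intro w hw
    obtain ⟨g, -, rfl⟩ := List.mem_map.1 hw
    rw [ev_mul]
    exact mul_self_nonneg _
  rw [e2] at e1
  have e4 : (0 : ℝ) ≤ z.1 := Nat.cast_nonneg _
  simp only [sgn, if_true, one_mul, add_zero] at e1
  push_cast at e1
  linarith

theorem exists_common_denominator (l : List (MvPolynomial ℕ ℚ)) :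
    ∃ D : ℕ, 0 < D ∧ ∀ f ∈ l, ∃ L : SPoly, ev X L = (D : MvPolynomial ℕ ℚ) * f := by
  induction l with
  | nil => exact ⟨1, one_pos, by simp⟩
  | cons f l ih =>
    obtain ⟨D, hD, h⟩ := ih
    obtain ⟨d, L, hd, hL⟩ := exists_ev_eq_rat f
    refine ⟨D * d, Nat.mul_pos hD hd, fun g hg => ?_⟩
    rcases List.mem_cons.1 hg with rfl | hg
    · exact ⟨mul (const true D) L, by simp [hL, sgn, mul_assoc]⟩
    · obtain ⟨L', hL'⟩ := h g hg
      exact ⟨mul (const true d) L', by simp [hL', sgn]; ring⟩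

theorem exists_list_of_isSumSq {R S : Type*} [CommRing R] [CommRing S] (f : R →+* S)
    (hf : Function.Surjective f) {a : S} (ha : IsSumSq a) :
    ∃ l : List R, f (l.map fun s => s * s).sum = a := by
  induction ha with
  | zero => exact ⟨[], by simp⟩
  | sq_add a _ ih =>
    obtain ⟨l, hl⟩ := ih
    obtain ⟨b, rfl⟩ := hf a
    exact ⟨b :: l, by simp [hl]⟩

theorem exists_list_of_mem_span {R ι : Type*} [CommRing R] (g : ι → R) {a : R}
    (ha : a ∈ Ideal.span (Set.range g)) : ∃ l : List (R × ι), (l.map fun h => h.1 * g h.2).sum = a := by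
  induction ha using Submodule.span_induction with
  | mem x hx =>
    obtain ⟨i, rfl⟩ := hx
    exact ⟨[(1, i)], by simp⟩
  | zero => exact ⟨[], by simp⟩
  | add x y _ _ hx hy =>
    obtain ⟨l, rfl⟩ := hx
    obtain ⟨l', rfl⟩ := hy
    exact ⟨l ++ l', by simp⟩
  | smul r x _ hx =>
    obtain ⟨l, rfl⟩ := hx
    refine ⟨l.map fun h => (r * h.1, h.2), ?_⟩
    rw [List.map_map, smul_eq_mul, ← List.sum_map_mul_left]
    simp [Function.comp_def, mul_assoc]

end SPoly

end NegativeCertificates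

section GenericGrid

open MvPolynomial Cardinal

namespace SPoly

variable {k n m N : ℕ} {X : Type}

/-- The equations of the generic grid with labels in `X`. -/
noncomputable def genericEquation (p : MvPolynomial (Fin k × Fin n) ℚ) (P : Fin k → Fin m → Fin k)
    (g : (Fin k → Fin m → X) ⊕ {t : (Fin m → X) × Fin m × X // t.2.2 ≠ t.1 t.2.1}) :
    MvPolynomial (((Fin m → X) × Fin n) ⊕ ((Fin m → X) × Fin m × X)) ℚ :=
  Sum.elim
    (fun v => rename (fun w : Fin k × Fin n => Sum.inl (fun c => v (P w.1 c) c, w.2)) p)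
    (fun t => MvPolynomial.X (Sum.inr t.1) * ∑ j : Fin n, (MvPolynomial.X (Sum.inl (t.1.1, j)) -
      MvPolynomial.X (Sum.inl (Function.update t.1.1 t.1.2.1 t.1.2.2, j))) ^ 2 - 1) g

/-- The numbers of the variables of the generic grid. -/
def genericVar (θ : X → ℕ) : ((Fin m → X) × Fin n) ⊕ ((Fin m → X) × Fin m × X) → ℕ :=
  Sum.elim (fun u => gridVar (List.ofFn fun c => θ (u.1 c)) u.2)
    fun u => lineVar (List.ofFn fun c => θ (u.1 c), u.2.1, θ u.2.2)

theorem exists_negGen_eq (p : PolyCode) {P : Fin k → Fin m → Fin k}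
    (hP : ∀ i c, (P i c : ℕ) = rowOf k m N i c) (θ : X → ℕ)
    (g : (Fin k → Fin m → X) ⊕ {t : (Fin m → X) × Fin m × X // t.2.2 ≠ t.1 t.2.1})
    (hg : ∀ t, g = Sum.inr t → θ t.1.2.2 ≠ θ (t.1.1 t.1.2.1)) :
    ∃ g' : List (List ℕ) ⊕ (List ℕ × ℕ × ℕ), ∃ q : ℚ,
      rename (genericVar θ) (genericEquation (decodePoly k n p) P g) =
        C q * ev MvPolynomial.X (negGen k n m N (codePoly (k * n) p) g') := by
  classical
  rcases g with v | ⟨⟨u, c, e⟩, ht⟩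
  · refine ⟨Sum.inl (List.ofFn fun c => List.ofFn fun i => θ (v i c)), (codeDen p : ℚ)⁻¹, ?_⟩
    rw [negGen, Sum.elim_inl, ev_ren, ev_codePoly, ← mul_assoc,
      ← map_natCast (C : ℚ →+* MvPolynomial ℕ ℚ), ← map_mul, inv_mul_cancel₀, map_one, one_mul,
      genericEquation, Sum.elim_inl, rename_rename, ← aeval_X_left_apply (rename _ _), aeval_rename]
    · congr 2
      funext w
      have hn : 0 < n := w.2.pos
      have e2 : (w.1.1 * n + w.2.1) / n = w.1.1 := by
        rw [mul_comm, Nat.mul_add_div hn, Nat.div_eq_of_lt w.2.2, add_zero]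
      have e3 : (w.1.1 * n + w.2.1) % n = w.2.1 := by
        rw [mul_comm, Nat.mul_add_mod, Nat.mod_eq_of_lt w.2.2]
      simp only [Function.comp, genericVar, Sum.elim_inl, e2, e3]
      congr 2
      apply List.ext_getElem
      · simp [rowLabel]
      · intro c h1 h2
        have hc : c < m := by simpa using h1
        have h3 := hP w.1 ⟨c, hc⟩
        simp only at h3
        simp [rowLabel, hc, ← h3]
    · exact_mod_cast (codeDen_pos p).ne'
  · have hne := hg _ rfl
    refine ⟨Sum.inr (List.ofFn fun c => θ (u c), c, θ e), 1, ?_⟩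
    have h1 : lineLabel m (List.ofFn fun c => θ (u c)) c (θ e) =
        List.ofFn fun d => θ (Function.update u c e d) := by
      apply List.ext_getElem
      · simp [lineLabel]
      · intro d h1 h2
        have hd : d < m := by simpa using h2
        by_cases hdc : d = c
        · subst hdc
          simp [lineLabel]
        · have : (⟨d, hd⟩ : Fin m) ≠ c := fun h => hdc (by rw [← h])
          simp [lineLabel, hdc, hd, this]
    rw [map_one, one_mul, negGen, Sum.elim_inr, if_pos, ev_append, ev_mul, ev_distSq, h1, ev_const]
    · simp [genericEquation, genericVar, sgn, sub_eq_add_neg]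
    · refine ⟨c.2, ?_⟩
      simpa using hne

theorem exists_gridOver_field [Infinite X] (hX : #X ≤ continuum) {p : PolyCode}
    {P : Fin k → Fin m → Fin k} (hP : ∀ i c, (P i c : ℕ) = rowOf k m N i c)
    (h : ∀ z, ¬ NegCheck k n m N (codePoly (k * n) p) z) :
    ∃ (F : Type) (_ : Field F) (_ : Algebra ℚ F), ¬ IsSumSq (-1 : F) ∧ #F ≤ continuum ∧
      GridOver F X (decodePoly k n p) m P := by
  classical
  set I := Ideal.span (Set.range (genericEquation (X := X) (decodePoly k n p) P)) with hI
  have hA : ¬ IsSumSq (-1 : MvPolynomial _ ℚ ⧸ I) := by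
    intro hs
    obtain ⟨l, hl⟩ := exists_list_of_isSumSq (Ideal.Quotient.mk I) Ideal.Quotient.mk_surjective hs
    have h1 : 1 + (l.map fun s => s * s).sum ∈ I := by
      rw [← Ideal.Quotient.eq_zero_iff_mem, map_add, hl, map_one, add_neg_cancel]
    obtain ⟨hs, hhs⟩ := exists_list_of_mem_span _ h1
    have hθ : ∃ θ : X → ℕ, ∀ h ∈ hs, ∀ t, h.2 = Sum.inr t → θ t.1.2.2 ≠ θ (t.1.1 t.1.2.1) := by
      set E : List X := hs.flatMap fun h => Sum.elim (fun _ => []) (fun t => [t.1.2.2, t.1.1 t.1.2.1]) h.2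
        with hE
      refine ⟨fun x => E.idxOf x, fun h hh t ht hidx => t.2 ((List.idxOf_inj ?_).1 hidx)⟩
      rw [hE, List.mem_flatMap]
      exact ⟨h, hh, by simp [ht]⟩
    obtain ⟨θ, hθ⟩ := hθ
    set ρ : MvPolynomial (((Fin m → X) × Fin n) ⊕ ((Fin m → X) × Fin m × X)) ℚ →ₐ[ℚ] MvPolynomial ℕ ℚ :=
      rename (genericVar θ) with hρ
    have h2 : ∀ hs : List (MvPolynomial (((Fin m → X) × Fin n) ⊕ ((Fin m → X) × Fin m × X)) ℚ ×
        ((Fin k → Fin m → X) ⊕ {t : (Fin m → X) × Fin m × X // t.2.2 ≠ t.1 t.2.1})),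
        (∀ h ∈ hs, ∀ t, h.2 = Sum.inr t → θ t.1.2.2 ≠ θ (t.1.1 t.1.2.1)) →
        ∃ l' : List (MvPolynomial ℕ ℚ × (List (List ℕ) ⊕ (List ℕ × ℕ × ℕ))),
          (l'.map fun h => h.1 * ev MvPolynomial.X (negGen k n m N (codePoly (k * n) p) h.2)).sum =
            ρ (hs.map fun h => h.1 * genericEquation (decodePoly k n p) P h.2).sum := by
      intro hs
      induction hs with
      | nil => exact fun _ => ⟨[], by simp⟩
      | cons a hs ih =>
        intro hh
        obtain ⟨l', hl'⟩ := ih fun h hm => hh h (List.mem_cons_of_mem _ hm)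
        obtain ⟨g', q, hg'⟩ := exists_negGen_eq (N := N) p hP θ a.2 (hh a List.mem_cons_self)
        refine ⟨(ρ a.1 * C q, g') :: l', ?_⟩
        rw [List.map_cons, List.sum_cons, hl', List.map_cons, List.sum_cons, map_add, map_mul, hρ, hg']
        ring
    obtain ⟨l', hl'⟩ := h2 hs hθ
    rw [hhs, map_add, map_one, map_list_sum, List.map_map] at hl'
    obtain ⟨D, hD, hDl⟩ := exists_common_denominator (l.map ρ ++ l'.map Prod.fst)
    have h3 : ∃ S : List SPoly, (S.map fun s => ev (R := MvPolynomial ℕ ℚ) MvPolynomial.X (mul s s)).sum =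
        (D : MvPolynomial ℕ ℚ) ^ 2 * (l.map (ρ ∘ fun s => s * s)).sum := by
      have h4 : ∀ f ∈ l, ∃ L : SPoly, ev MvPolynomial.X L = (D : MvPolynomial ℕ ℚ) * ρ f := fun f hf =>
        hDl _ (List.mem_append_left _ (List.mem_map_of_mem hf))
      clear hl' hDl hl h1 hhs
      induction l with
      | nil => exact ⟨[], by simp⟩
      | cons f l ih =>
        obtain ⟨S, hS⟩ := ih fun g hg => h4 g (List.mem_cons_of_mem _ hg)
        obtain ⟨L, hL⟩ := h4 f List.mem_cons_self
        refine ⟨L :: S, ?_⟩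
        rw [List.map_cons, List.sum_cons, hS, ev_mul, hL, List.map_cons, List.sum_cons]
        simp
        ring
    have h5 : ∃ H : List (SPoly × (List (List ℕ) ⊕ (List ℕ × ℕ × ℕ))),
        (H.map fun h => ev (R := MvPolynomial ℕ ℚ) MvPolynomial.X
          (mul h.1 (negGen k n m N (codePoly (k * n) p) h.2))).sum = - ((D : MvPolynomial ℕ ℚ) ^ 2 *
        (l'.map fun h => h.1 * ev MvPolynomial.X (negGen k n m N (codePoly (k * n) p) h.2)).sum) := by
      have h4 : ∀ f ∈ l', ∃ L : SPoly, ev MvPolynomial.X L = (D : MvPolynomial ℕ ℚ) * f.1 := fun f hf =>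
        hDl _ (List.mem_append_right _ (List.mem_map_of_mem hf))
      clear hl' hDl
      induction l' with
      | nil => exact ⟨[], by simp⟩
      | cons f l' ih =>
        obtain ⟨S, hS⟩ := ih fun g hg => h4 g (List.mem_cons_of_mem _ hg)
        obtain ⟨L, hL⟩ := h4 f List.mem_cons_self
        refine ⟨(mul (const false D) L, f.2) :: S, ?_⟩
        rw [List.map_cons, List.sum_cons, hS, ev_mul, ev_mul, hL, List.map_cons, List.sum_cons, ev_const]
        simp [sgn]
        ring
    obtain ⟨S, hS⟩ := h3
    obtain ⟨H, hH⟩ := h5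
    refine h (D ^ 2 - 1, S, H) (isZero_of_forall ?_)
    have h6 : D ^ 2 - 1 + 1 = D ^ 2 := Nat.sub_add_cancel (Nat.pow_pos hD)
    rw [ev_append, ev_append, ev_const, ev_flatMap, ev_flatMap, hS, hH, hl', h6]
    simp [sgn]
    ring
  obtain ⟨F, _, φ, hF, hcard⟩ := exists_formallyReal_field hA
  let _ : Algebra ℚ F := (φ.comp (algebraMap ℚ _)).toAlgebra
  set ψ : MvPolynomial (((Fin m → X) × Fin n) ⊕ ((Fin m → X) × Fin m × X)) ℚ →ₐ[ℚ] F :=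
    { toRingHom := φ.comp (Ideal.Quotient.mk I), commutes' := fun r => rfl } with hψ
  have hψg : ∀ g, ψ (genericEquation (decodePoly k n p) P g) = 0 := by
    intro g
    have : Ideal.Quotient.mk I (genericEquation (decodePoly k n p) P g) = 0 :=
      Ideal.Quotient.eq_zero_iff_mem.2 (Ideal.subset_span ⟨g, rfl⟩)
    change φ (Ideal.Quotient.mk I _) = 0
    rw [this, map_zero]
  refine ⟨F, inferInstance, inferInstance, hF, ?_, fun u j => ψ (MvPolynomial.X (Sum.inl (u, j))), ?_, ?_⟩
  · have h1 : #(MvPolynomial (((Fin m → X) × Fin n) ⊕ ((Fin m → X) × Fin m × X)) ℚ ⧸ I) ≤ continuum := by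
      refine (mk_le_of_surjective Ideal.Quotient.mk_surjective).trans ?_
      refine MvPolynomial.cardinalMk_le_max.trans ?_
      have hu : #(Fin m → X) ≤ continuum := by
        rw [← power_def, mk_fin]
        exact (power_le_power_right hX).trans (by
          rw [← two_power_aleph0, ← power_mul]
          exact power_le_power_left two_ne_zero (mul_le_max_of_aleph0_le_left le_rfl |>.trans
            (max_le le_rfl (natCast_lt_aleph0).le)))
      have hfin : ∀ a : ℕ, #(Fin a) ≤ continuum := fun a => by
        rw [mk_fin]; exact (natCast_lt_aleph0).le.trans aleph0_le_continuum
      have hmul : ∀ {a b : Cardinal}, a ≤ continuum → b ≤ continuum → a * b ≤ continuum :=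
        fun ha hb => (mul_le_mul' ha hb).trans (continuum_mul_self).le
      refine max_le (max_le ?_ ?_) aleph0_le_continuum
      · exact (mk_le_aleph0).trans aleph0_le_continuum
      · rw [mk_sum, lift_id, lift_id, mk_prod, mk_prod, mk_prod]
        simp only [lift_id]
        exact (add_le_add (hmul hu (hfin n)) (hmul hu (hmul (hfin m) hX))).trans
          (continuum_add_self).le
    exact hcard.trans ((mul_le_mul' h1 h1).trans (continuum_mul_self).le)
  · intro v
    have h1 := hψg (Sum.inl v)
    rw [genericEquation, Sum.elim_inl] at h1
    have h2 := DFunLike.congr_fun (aeval_unique (ψ.comp (rename fun w : Fin k × Fin n =>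
      (Sum.inl (fun c => v (P w.1 c) c, w.2) :
        ((Fin m → X) × Fin n) ⊕ ((Fin m → X) × Fin m × X))))) (decodePoly k n p)
    rw [AlgHom.comp_apply, h1] at h2
    rw [h2]
    congr 2
    funext w
    simp
  · intro u c e he hY
    have h1 := hψg (Sum.inr ⟨(u, c, e), he⟩)
    rw [genericEquation, Sum.elim_inr, map_sub, map_mul, map_sum, Finset.sum_eq_zero] at h1
    · simp at h1
    · intro j _
      have h2 := congrFun hY j
      simp only at h2
      rw [map_pow, map_sub, sub_eq_zero.2, zero_pow two_ne_zero]
      rw [← h2]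

end SPoly

end GenericGrid

section TransferToReals

open MvPolynomial

theorem LocalGrid.transfer {F : Type} [Field F] [Algebra ℚ F] (hF : ¬ IsSumSq (-1 : F)) {k n m : ℕ}
    {p : MvPolynomial (Fin k × Fin n) ℚ} {P : Fin k → Fin m → Fin k} (h : LocalGrid F p m P) :
    LocalGrid ℝ p m P := by
  classical
  obtain ⟨r, Q, σ, b, S, h0, h1, h2, hS, hp⟩ := h
  choose d hd using h2
  let s : ((Fin m × Fin k) ⊕ Fin r) ⊕ (Fin k × Fin n) → (Fin m ⊕ Fin r) ⊕ Fin n :=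
    Sum.map (Sum.map Prod.fst id) Prod.snd
  have hs : ∀ {R : Type} [CommRing R] [Algebra ℚ R] (y : (Fin m ⊕ Fin r) ⊕ Fin n → R),
      aeval y (rename s S) = aeval (Sum.elim (Sum.elim (fun v : Fin m × Fin k => y (.inl (.inl v.1)))
        fun d => y (.inl (.inr d))) fun w : Fin k × Fin n => y (.inr w.2)) S := by
    intro R _ _ y
    rw [aeval_rename]
    congr 2
    funext o
    rcases o with (o | o) | o <;> rfl
  obtain ⟨y, hE, hG⟩ := artin_lang hF (Sum.elim σ b)
    (Finset.univ.image fun j => rename (eqVar _ j) (Q j))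
    (insert (rename s S) (Finset.univ.image (fun j => rename (eqVar _ j) (pderiv none (Q j))) ∪
      Finset.univ.image fun c => rename (eqVar _ (d c)) (pderiv (some (.inl c)) (Q (d c)))))
    (by
      intro f hf
      obtain ⟨j, -, rfl⟩ := Finset.mem_image.1 hf
      rw [aeval_eqVar]
      exact h0 j)
    (by
      intro f hf
      rcases Finset.mem_insert.1 hf with rfl | hf
      · rw [hs]
        exact hS
      rcases Finset.mem_union.1 hf with hf | hf
      · obtain ⟨j, -, rfl⟩ := Finset.mem_image.1 hf
        rw [aeval_eqVar]
        exact h1 j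
      · obtain ⟨c, -, rfl⟩ := Finset.mem_image.1 hf
        rw [aeval_eqVar]
        exact hd c)
  refine ⟨r, Q, fun v => y (.inl v), fun j => y (.inr j), S, fun j => ?_, fun j => ?_,
    fun c => ⟨d c, ?_⟩, ?_, hp⟩
  · rw [← aeval_eqVar]
    exact hE _ (Finset.mem_image_of_mem _ (Finset.mem_univ j))
  · rw [← aeval_eqVar]
    exact hG _ (Finset.mem_insert_of_mem (Finset.mem_union_left _
      (Finset.mem_image_of_mem _ (Finset.mem_univ j))))
  · have h3 := hG (rename (eqVar (Fin m ⊕ Fin r) (d c)) (pderiv (some (.inl c)) (Q (d c))))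
      (by rw [Finset.mem_insert, Finset.mem_union, Finset.mem_image, Finset.mem_image]
          exact Or.inr (Or.inr ⟨c, Finset.mem_univ c, rfl⟩))
    rw [aeval_eqVar] at h3
    exact h3
  · have h3 := hG (rename s S) (Finset.mem_insert_self _ _)
    rw [hs] at h3
    exact h3

end TransferToReals

section BoundedPolynomials

open MvPolynomial

namespace SPoly

/-- The sum of the absolute values of the coefficients is at most `r`. -/
def Bd (F : MvPolynomial ℕ ℚ) (r : ℝ) : Prop :=
  ∃ (d : ℕ) (L : SPoly), 0 < d ∧ ev X L = (d : MvPolynomial ℕ ℚ) * F ∧ (L.length : ℝ) ≤ r * d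

/-- Some multiple has a constant coefficient larger than the sum of the others. -/
def DomRep (F : MvPolynomial ℕ ℚ) : Prop :=
  ∃ (d : ℕ) (L : SPoly), 0 < d ∧ ev X L = (d : MvPolynomial ℕ ℚ) * F ∧ Dom L

theorem length_mul (A B : SPoly) : (mul A B).length = A.length * B.length := by
  induction A with
  | nil => simp [mul]
  | cons a A ih =>
    rw [mul, List.flatMap_cons, List.length_append, ← mul, ih]
    simp
    ring

theorem length_const (b : Bool) (c : ℕ) : (const b c).length = c := by simp [const]

theorem Bd.mono {F : MvPolynomial ℕ ℚ} {r s : ℝ} (h : Bd F r) (hrs : r ≤ s) : Bd F s := by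
  obtain ⟨d, L, hd, hL, hl⟩ := h
  exact ⟨d, L, hd, hL, hl.trans (mul_le_mul_of_nonneg_right hrs (Nat.cast_nonneg _))⟩

theorem Bd.add {F G : MvPolynomial ℕ ℚ} {r s : ℝ} (hF : Bd F r) (hG : Bd G s) :
    Bd (F + G) (r + s) := by
  obtain ⟨d, L, hd, hL, hl⟩ := hF
  obtain ⟨e, M, he, hM, hm⟩ := hG
  refine ⟨d * e, mul (const true e) L ++ mul (const true d) M, Nat.mul_pos hd he, ?_, ?_⟩
  · simp only [ev_append, ev_mul, ev_const, hL, hM, sgn, if_true]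
    push_cast
    ring
  · rw [List.length_append, length_mul, length_mul, length_const, length_const]
    push_cast
    have h1 : (e : ℝ) * L.length ≤ e * (r * d) := by gcongr
    have h2 : (d : ℝ) * M.length ≤ d * (s * e) := by gcongr
    linarith

theorem Bd.mul {F G : MvPolynomial ℕ ℚ} {r s : ℝ} (hF : Bd F r) (hG : Bd G s) :
    Bd (F * G) (r * s) := by
  obtain ⟨d, L, hd, hL, hl⟩ := hF
  obtain ⟨e, M, he, hM, hm⟩ := hG
  refine ⟨d * e, SPoly.mul L M, Nat.mul_pos hd he, ?_, ?_⟩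
  · simp only [ev_mul, hL, hM]
    push_cast
    ring
  · rw [length_mul]
    push_cast
    calc (L.length : ℝ) * M.length ≤ (r * d) * (s * e) :=
          mul_le_mul hl hm (Nat.cast_nonneg _) ((Nat.cast_nonneg _).trans hl)
      _ = _ := by ring

theorem Bd.C (q : ℚ) : Bd (C q) |(q : ℝ)| := by
  refine ⟨q.den, const (decide (0 ≤ q.num)) q.num.natAbs, q.den_pos, ?_, ?_⟩
  · rw [ev_const]
    have h : (q.den : ℚ) * q = sgn ℚ (decide (0 ≤ q.num)) * (q.num.natAbs : ℚ) := by
      rw [mul_comm, Rat.mul_den_eq_num, ← Int.cast_natCast, Int.natCast_natAbs]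
      by_cases h : 0 ≤ q.num
      · rw [abs_of_nonneg h]; simp [sgn, h]
      · rw [abs_of_nonpos (le_of_not_ge h)]; simp [sgn, h]
    have h2 := congrArg (MvPolynomial.C : ℚ → MvPolynomial ℕ ℚ) h
    rw [map_mul, map_mul] at h2
    rw [← map_natCast (MvPolynomial.C : ℚ →+* MvPolynomial ℕ ℚ) q.den, h2]
    congr 1
    · by_cases h : 0 ≤ q.num <;> simp [sgn, h]
  · rw [length_const]
    have h1 : |(q : ℝ)| * q.den = |((q.num : ℤ) : ℝ)| := by
      rw [← Nat.abs_cast q.den, ← abs_mul]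
      congr 1
      have := Rat.mul_den_eq_num q
      exact_mod_cast this
    rw [h1, Nat.cast_natAbs]
    push_cast
    exact le_rfl

theorem Bd.X (v : ℕ) : Bd (X v) 1 :=
  ⟨1, [(true, [v])], one_pos, by simp [sgn], by simp⟩

theorem exists_bound {ι : Type*} (f : MvPolynomial ι ℚ) (K : ℝ) (hK : 0 ≤ K) :
    ∃ M : ℝ, 0 ≤ M ∧ ∀ (g : ι → ℕ) (c ρ : ι → ℚ) (δ : ℝ), 0 ≤ δ → δ ≤ 1 → (∀ i, |(c i : ℝ)| ≤ K) →
      (∀ i, |(ρ i : ℝ)| ≤ δ) →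
      Bd (aeval (fun i => MvPolynomial.C (c i) + MvPolynomial.C (ρ i) * MvPolynomial.X (g i)) f -
        MvPolynomial.C (aeval c f)) (M * δ) ∧ |((aeval c f : ℚ) : ℝ)| ≤ M := by
  induction f using MvPolynomial.induction_on with
  | C a =>
    refine ⟨|(a : ℝ)|, abs_nonneg _, fun g c ρ δ h0 _ _ _ => ⟨?_, by simp⟩⟩
    have h : (aeval (fun i => MvPolynomial.C (c i) + MvPolynomial.C (ρ i) * MvPolynomial.X (g i)))
        (MvPolynomial.C a) - MvPolynomial.C ((aeval c) (MvPolynomial.C a)) = MvPolynomial.C (0 : ℚ) := by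
      simp [algebraMap_eq]
    rw [h]
    refine (Bd.C 0).mono ?_
    simp only [Rat.cast_zero, abs_zero]
    positivity
  | add p q hp hq =>
    obtain ⟨M, hM, h1⟩ := hp
    obtain ⟨M', hM', h2⟩ := hq
    refine ⟨M + M', add_nonneg hM hM', fun g c ρ δ h0 hδ hc hρ => ?_⟩
    obtain ⟨a1, b1⟩ := h1 g c ρ δ h0 hδ hc hρ
    obtain ⟨a2, b2⟩ := h2 g c ρ δ h0 hδ hc hρ
    constructor
    · rw [map_add, map_add, map_add, add_sub_add_comm, add_mul]
      exact a1.add a2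
    · rw [map_add, Rat.cast_add]
      exact (abs_add_le _ _).trans (add_le_add b1 b2)
  | mul_X p i hp =>
    obtain ⟨M, hM, h1⟩ := hp
    refine ⟨M * (K + 1) + M, by positivity, fun g c ρ δ h0 hδ hc hρ => ?_⟩
    obtain ⟨a1, b1⟩ := h1 g c ρ δ h0 hδ hc hρ
    constructor
    · have h2 := (a1.mul ((Bd.C (c i)).add ((Bd.C (ρ i)).mul (Bd.X (g i))))).add
        ((Bd.C (aeval c p)).mul ((Bd.C (ρ i)).mul (Bd.X (g i))))
      have h3 : ∀ F : MvPolynomial ℕ ℚ, (F - MvPolynomial.C (aeval c p)) *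
          (MvPolynomial.C (c i) + MvPolynomial.C (ρ i) * MvPolynomial.X (g i)) +
          MvPolynomial.C (aeval c p) * (MvPolynomial.C (ρ i) * MvPolynomial.X (g i)) =
          F * (MvPolynomial.C (c i) + MvPolynomial.C (ρ i) * MvPolynomial.X (g i)) -
            MvPolynomial.C (aeval c (p * MvPolynomial.X i)) := by
        intro F
        simp only [map_mul, aeval_X]
        ring
      rw [h3] at h2
      rw [map_mul, aeval_X]
      refine h2.mono ?_
      rw [add_mul, mul_one]
      refine add_le_add ?_ (mul_le_mul b1 (hρ i) (abs_nonneg _) hM)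
      rw [mul_assoc, mul_assoc, mul_comm δ]
      refine mul_le_mul_of_nonneg_left ?_ hM
      exact mul_le_mul_of_nonneg_right (add_le_add (hc i) ((hρ i).trans hδ)) h0
    · rw [map_mul, aeval_X, Rat.cast_mul, abs_mul]
      have := mul_le_mul b1 (hc i) (abs_nonneg _) hM
      nlinarith

theorem dom_const_append {a : ℕ} {L : SPoly} (h : L.length < a) : Dom (const true a ++ L) := by
  rw [Dom, List.length_append, length_const, List.filter_append, List.length_append]
  have : (List.filter (fun f => decide (f = (true, []))) (const true a)).length = a := by
    rw [List.filter_eq_self.2, length_const]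
    intro f hf
    simp [const] at hf
    simp [hf.2]
  omega

theorem DomRep.of_bd {q : ℚ} {F : MvPolynomial ℕ ℚ} {r : ℝ} (h : Bd (F - MvPolynomial.C q) r)
    (hr : r < q) : DomRep F := by
  obtain ⟨d, L, hd, hL, hl⟩ := h
  have hr0 : 0 ≤ r := by
    by_contra h
    have h1 : r * d < 0 := mul_neg_of_neg_of_pos (not_le.1 h) (by exact_mod_cast hd)
    have h2 : (0 : ℝ) ≤ L.length := Nat.cast_nonneg _
    linarith
  have hq : 0 < q := by exact_mod_cast hr0.trans_lt hr
  have hnum : (q.num.natAbs : ℚ) = q * q.den := by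
    rw [Rat.mul_den_eq_num, Nat.cast_natAbs, abs_of_pos (Rat.num_pos.2 hq)]
  refine ⟨d * q.den, const true (d * q.num.natAbs) ++ mul (const true q.den) L,
    Nat.mul_pos hd q.den_pos, ?_, dom_const_append ?_⟩
  · rw [ev_append, ev_const, ev_mul, ev_const, hL]
    have h2 := congrArg (MvPolynomial.C : ℚ → MvPolynomial ℕ ℚ) hnum
    rw [map_natCast, map_mul, map_natCast] at h2
    push_cast
    rw [h2]
    simp [sgn]
    ring
  · rw [length_mul, length_const]
    have h3 : (q.num.natAbs : ℝ) = q * q.den := by exact_mod_cast hnum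
    have h4 : (q.den : ℝ) * L.length < d * q.num.natAbs := by
      rw [h3]
      have h5 : (0 : ℝ) < q.den := by exact_mod_cast q.den_pos
      have h6 : (0 : ℝ) < d := by exact_mod_cast hd
      calc (q.den : ℝ) * L.length ≤ q.den * (r * d) := by gcongr
        _ < q.den * (q * d) := by gcongr
        _ = _ := by ring
    exact_mod_cast h4

theorem exists_domRep {ι : Type} [Finite ι] (f : MvPolynomial ι ℚ) (s : ι → ℝ)
    (hf : 0 < aeval s f) :
    ∃ δ : ℝ, 0 < δ ∧ ∀ (g : ι → ℕ) (c ρ : ι → ℚ), (∀ i, |(c i : ℝ) - s i| ≤ δ) →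
      (∀ i, |(ρ i : ℝ)| ≤ δ) →
      DomRep (aeval (fun i => MvPolynomial.C (c i) + MvPolynomial.C (ρ i) * MvPolynomial.X (g i)) f) := by
  have := Fintype.ofFinite ι
  obtain ⟨ε, hε, h1⟩ := Metric.isOpen_iff.1 (isOpen_lt continuous_const
    (continuous_aeval_point (R := ℝ) f)) s (show aeval s f / 2 < aeval s f by linarith)
  obtain ⟨M, hM, h2⟩ := exists_bound f (‖s‖ + 1) (by positivity)
  set v : ℝ := aeval s f
  refine ⟨min (min 1 (ε / 2)) (v / (4 * (M + 1))), by positivity, fun g c ρ hc hρ => ?_⟩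
  set δ := min (min 1 (ε / 2)) (v / (4 * (M + 1))) with hδ
  have hδ1 : δ ≤ 1 := (min_le_left _ _).trans (min_le_left _ _)
  have hδ2 : δ ≤ ε / 2 := (min_le_left _ _).trans (min_le_right _ _)
  have hδ3 : δ ≤ v / (4 * (M + 1)) := min_le_right _ _
  have hδ0 : 0 ≤ δ := by positivity
  have h3 := h2 g c ρ δ hδ0 hδ1 (fun i => ?_) hρ
  · have h4 : v / 2 < aeval (fun i => (c i : ℝ)) f := by
      apply h1
      rw [Metric.mem_ball, dist_pi_lt_iff hε]
      intro i
      rw [Real.dist_eq]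
      exact (hc i).trans_lt (by linarith)
    have h5 : aeval (fun i => (c i : ℝ)) f = ((aeval c f : ℚ) : ℝ) := by
      have := (aeval_algebraMap_apply ℝ c f)
      simpa [Function.comp_def] using this
    refine DomRep.of_bd h3.1 ?_
    rw [← h5]
    refine lt_of_le_of_lt ?_ h4
    have h6 : M * δ ≤ M * (v / (4 * (M + 1))) := mul_le_mul_of_nonneg_left hδ3 hM
    have h7 : M * (v / (4 * (M + 1))) ≤ v / 2 := by
      rw [mul_div_assoc', div_le_div_iff₀ (by positivity) (by positivity)]
      nlinarith
    linarith
  · have h4 := abs_sub_abs_le_abs_sub (c i : ℝ) (s i)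
    have h5 := norm_le_pi_norm s i
    rw [Real.norm_eq_abs] at h5
    have := hc i
    linarith

theorem Dom.mul_const {L : SPoly} (h : Dom L) {e : ℕ} (he : 0 < e) : Dom (mul (const true e) L) := by
  have h1 : ((mul (const true e) L).filter fun f => f = (true, [])).length =
      e * (L.filter fun f => f = (true, [])).length := by
    have h2 : ∀ M : SPoly, M.map (fun b : Bool × List ℕ => (true == b.1, ([] : List ℕ) ++ b.2)) = M := by
      intro M
      simp
    rw [mul, const]
    induction e with
    | zero => omega
    | succ e ih =>
      rw [List.range_succ, List.map_append, List.flatMap_append, List.filter_append,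
        List.length_append]
      rcases Nat.eq_zero_or_pos e with rfl | h0
      · simp
      · rw [ih h0]
        simp
        ring
  rw [Dom, length_mul, length_const, h1]
  unfold Dom at h
  nlinarith

theorem DomRep.mul_C {F : MvPolynomial ℕ ℚ} (h : DomRep F) {q : ℚ} (hq : 0 < q) :
    DomRep (MvPolynomial.C q * F) := by
  obtain ⟨d, L, hd, hL, hdom⟩ := h
  have hnum : (q.num.natAbs : ℚ) = q * q.den := by
    rw [Rat.mul_den_eq_num, Nat.cast_natAbs, abs_of_pos (Rat.num_pos.2 hq)]
  refine ⟨d * q.den, mul (const true q.num.natAbs) L, Nat.mul_pos hd q.den_pos, ?_,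
    hdom.mul_const (Int.natAbs_pos.2 (Rat.num_pos.2 hq).ne')⟩
  have h2 := congrArg (MvPolynomial.C : ℚ → MvPolynomial ℕ ℚ) hnum
  rw [map_natCast, map_mul, map_natCast] at h2
  rw [ev_mul, ev_const, hL, h2]
  simp [sgn]
  ring

end SPoly

end BoundedPolynomials

section RealGridCertificates

open MvPolynomial

theorem aeval_sub_aeval_mem {ι R A : Type*} [CommRing R] [CommRing A] [Algebra R A] (I : Ideal A)
    {x y : ι → A} (h : ∀ i, x i - y i ∈ I) (f : MvPolynomial ι R) : aeval x f - aeval y f ∈ I := by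
  induction f using MvPolynomial.induction_on with
  | C a => simp
  | add p q hp hq =>
    rw [map_add, map_add, add_sub_add_comm]
    exact I.add_mem hp hq
  | mul_X p i hp =>
    rw [map_mul, map_mul, aeval_X, aeval_X]
    have h1 : aeval x p * x i - aeval y p * y i =
        x i * (aeval x p - aeval y p) + aeval y p * (x i - y i) := by ring
    rw [h1]
    exact I.add_mem (I.mul_mem_left _ hp) (I.mul_mem_left _ (h i))

theorem exists_divided_difference {ι : Type} [DecidableEq ι] (f : MvPolynomial ι ℚ) (o : ι) :
    ∃ R : MvPolynomial (Option ι) ℚ, rename some f -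
      rename (fun v => if v = o then none else some v) f = (X (some o) - X none) * R ∧
      ∀ z : ι → ℝ, aeval (fun w : Option ι => w.elim (z o) z) R = aeval z (pderiv o f) := by
  have h1 : (X (some o) - X none : MvPolynomial (Option ι) ℚ) ∣ rename some f -
      rename (fun v => if v = o then none else some v) f := by
    rw [← Ideal.mem_span_singleton, ← aeval_X_left_apply (rename some f),
      ← aeval_X_left_apply (rename (fun v => if v = o then none else some v) f), aeval_rename,
      aeval_rename]
    refine aeval_sub_aeval_mem _ (fun i => ?_) f
    by_cases hi : i = o
    · subst hi
      simp
    · simp [hi]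
  obtain ⟨R, hR⟩ := h1
  refine ⟨R, hR, fun z => ?_⟩
  have h2 := congrArg (fun g => aeval (fun w : Option ι => w.elim (z o) z) (pderiv (some o) g)) hR
  simp only [map_sub, pderiv_mul, map_add, map_mul, aeval_X, Option.elim_some, Option.elim_none,
    sub_self, zero_mul, add_zero] at h2
  rw [pderiv_rename (Option.some_injective _), pderiv_eq_zero_of_notMem_vars (f := rename (fun v =>
    if v = o then none else some v) f), aeval_rename] at h2
  · simp only [pderiv_X_self, pderiv_X_of_ne (show (none : Option ι) ≠ some o by simp), map_zero,
      map_one, sub_zero, one_mul] at h2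
    exact h2.symm
  · intro h3
    have h4 := vars_rename _ _ h3
    rw [Finset.mem_image] at h4
    obtain ⟨v, -, hv⟩ := h4
    by_cases hvo : v = o
    · simp [hvo] at hv
    · simp [hvo] at hv

theorem exists_sign_change {V : Type} [DecidableEq V] (f : MvPolynomial (Option V) ℚ) (z : V → ℝ)
    (b : ℝ) (h0 : aeval (fun o : Option V => o.elim b z) f = 0)
    (h1 : aeval (fun o : Option V => o.elim b z) (pderiv none f) ≠ 0) {δ : ℝ} (hδ : 0 < δ) :
    ∃ l u ε : ℚ, l < u ∧ |(l : ℝ) - b| ≤ δ ∧ |(u : ℝ) - b| ≤ δ ∧ (ε ≠ 0) ∧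
      0 < aeval (fun o : Option V => o.elim (u : ℝ) z) (C ε * f) ∧
      0 < aeval (fun o : Option V => o.elim (l : ℝ) z) (- (C ε * f)) := by
  obtain ⟨R, hR, hd⟩ := exists_divided_difference f none
  have hd0 := hd fun o => o.elim b z
  simp only [Option.elim_none] at hd0
  set G : ℝ → ℝ := fun y => aeval (fun w : Option (Option V) => w.elim y fun o => o.elim b z) R with hG
  have hGc : Continuous G := by
    refine (continuous_aeval_point R).comp (continuous_pi fun w => ?_)
    cases w with
    | none => exact continuous_id
    | some o => exact continuous_const
  have hfG : ∀ y : ℝ, aeval (fun o : Option V => o.elim y z) f = (y - b) * G y := by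
    intro y
    have h2 := congrArg (aeval fun w : Option (Option V) => w.elim y fun o => o.elim b z) hR
    rw [map_sub, aeval_rename, aeval_rename, map_mul, map_sub, aeval_X, aeval_X] at h2
    have e1 : (fun w : Option (Option V) => w.elim y fun o => o.elim b z) ∘ some =
        fun o : Option V => o.elim b z := rfl
    have e2 : (fun w : Option (Option V) => w.elim y fun o => o.elim b z) ∘
        (fun v : Option V => if v = none then none else some v) =
        fun o : Option V => o.elim y z := by
      funext o
      cases o <;> simp
    rw [e1, e2, h0] at h2
    simp only [Option.elim_some, Option.elim_none] at h2
    simp only [G]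
    linarith
  have hGb : G b ≠ 0 := by rw [hG]; simp only; rw [hd0]; exact h1
  obtain ⟨ε, hε, hεG⟩ : ∃ ε : ℚ, ε ≠ 0 ∧ 0 < (ε : ℝ) * G b := by
    rcases lt_or_gt_of_ne hGb with h | h
    · exact ⟨-1, by norm_num, by simpa using h⟩
    · exact ⟨1, by norm_num, by simpa using h⟩
  obtain ⟨η, hη, hball⟩ := Metric.isOpen_iff.1 (isOpen_lt continuous_const
    (continuous_const.mul hGc)) b (show (0 : ℝ) < ε * G b from hεG)
  have hm : 0 < min δ (η / 2) := by positivity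
  obtain ⟨l, hl1, hl2⟩ := exists_rat_btwn (show b - min δ (η / 2) < b by linarith)
  obtain ⟨u, hu1, hu2⟩ := exists_rat_btwn (show b < b + min δ (η / 2) by linarith)
  have m1 := min_le_left δ (η / 2)
  have m2 := min_le_right δ (η / 2)
  have hl : 0 < (ε : ℝ) * G l := hball (by
    rw [Metric.mem_ball, Real.dist_eq, abs_lt]; constructor <;> linarith)
  have hu : 0 < (ε : ℝ) * G u := hball (by
    rw [Metric.mem_ball, Real.dist_eq, abs_lt]; constructor <;> linarith)
  refine ⟨l, u, ε, by exact_mod_cast hl2.trans hu1, ?_, ?_, hε, ?_, ?_⟩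
  · rw [abs_le]; constructor <;> linarith
  · rw [abs_le]; constructor <;> linarith
  · rw [map_mul, hfG, aeval_C, eq_ratCast]
    have : (ε : ℝ) * ((u - b) * G u) = (u - b) * (ε * G u) := by ring
    rw [this]
    exact mul_pos (by linarith) hu
  · rw [map_neg, map_mul, hfG, aeval_C, eq_ratCast]
    have : -((ε : ℝ) * ((l - b) * G l)) = (b - l) * (ε * G l) := by ring
    rw [this]
    exact mul_pos (by linarith) hl

namespace SPoly

/-- A polynomial in rescaled variables. -/
noncomputable def scaled {ι : Type} (g : ι → ℕ) (c ρ : ι → ℚ) :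
    MvPolynomial ι ℚ →ₐ[ℚ] MvPolynomial ℕ ℚ := aeval fun i => C (c i) + C (ρ i) * X (g i)

theorem scaled_rename {ι ι' : Type} (g : ι' → ℕ) (c ρ : ι' → ℚ) (h : ι → ι')
    (f : MvPolynomial ι ℚ) : scaled g c ρ (rename h f) = scaled (g ∘ h) (c ∘ h) (ρ ∘ h) f := by
  rw [scaled, scaled, aeval_rename]
  rfl

theorem rename_scaled {ι : Type} (g : ι → ℕ) (c ρ : ι → ℚ) (h : ℕ → ℕ) (f : MvPolynomial ι ℚ) :
    rename h (scaled g c ρ f) = scaled (h ∘ g) c ρ f := by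
  rw [← AlgHom.comp_apply]
  congr 1
  apply MvPolynomial.algHom_ext
  intro i
  simp [scaled]

theorem ev_X_ren (h : ℕ → ℕ) (L : SPoly) :
    ev (X : ℕ → MvPolynomial ℕ ℚ) (ren h L) = rename h (ev X L) := by
  rw [ev_ren]
  have := map_ev (rename h : MvPolynomial ℕ ℚ →ₐ[ℚ] MvPolynomial ℕ ℚ).toRingHom X L
  simp at this
  exact this.symm

theorem exists_domRep_of_ne {ι : Type} [Finite ι] (f : MvPolynomial ι ℚ) (s : ι → ℝ)
    (hf : aeval s f ≠ 0) :
    ∃ ε : ℚ, ε ≠ 0 ∧ ∃ δ : ℝ, 0 < δ ∧ ∀ (g : ι → ℕ) (c ρ : ι → ℚ), (∀ i, |(c i : ℝ) - s i| ≤ δ) →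
      (∀ i, |(ρ i : ℝ)| ≤ δ) → DomRep (C ε * scaled g c ρ f) := by
  obtain ⟨ε, hε, hεf⟩ : ∃ ε : ℚ, ε ≠ 0 ∧ 0 < (ε : ℝ) * aeval s f := by
    rcases lt_or_gt_of_ne hf with h | h
    · exact ⟨-1, by norm_num, by simpa using h⟩
    · exact ⟨1, by norm_num, by simpa using h⟩
  obtain ⟨δ, hδ, h⟩ := exists_domRep (C ε * f) s (by
    rw [map_mul, aeval_C, eq_ratCast]; exact hεf)
  refine ⟨ε, hε, δ, hδ, fun g c ρ h1 h2 => ?_⟩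
  have h3 := h g c ρ h1 h2
  rw [map_mul, aeval_C, algebraMap_eq] at h3
  exact h3

theorem neg_neg (L : SPoly) : neg (neg L) = L := by
  simp [neg, Function.comp_def]

/-- The variables of the equation of a coordinate. -/
def stdVar {m r : ℕ} (o : Option (Fin m ⊕ Fin r)) : ℕ := o.elim 0 (Sum.elim (fun c => c + 1) fun _ => 0)

theorem exists_link {m r : ℕ} (f : MvPolynomial (Option (Fin m ⊕ Fin r)) ℚ) {l u ε : ℚ}
    (hlu : l < u) (hε : ε ≠ 0) (c ρ : Fin m ⊕ Fin r → ℚ)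
    (hu : DomRep (scaled stdVar (fun o => o.elim u c) (fun o => o.elim 0 ρ) (C ε * f)))
    (hl : DomRep (scaled stdVar (fun o => o.elim l c) (fun o => o.elim 0 ρ) (- (C ε * f)))) :
    ∃ lk : Link, lk.OK ∧ (∃ q : ℚ, q ≠ 0 ∧ ev X lk.poly = C q * scaled stdVar
      (fun o => o.elim ((l + u) / 2) c) (fun o => o.elim ((u - l) / 2) ρ) f) ∧
      (lk.1 : ℚ) * ((l + u) / 2) = sgn ℚ lk.2.2.1.1 * lk.2.2.1.2 ∧
      (lk.1 : ℚ) * ((u - l) / 2) = lk.2.1 := by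
  set F := scaled stdVar (fun o => o.elim ((l + u) / 2) c) (fun o => o.elim ((u - l) / 2) ρ) (C ε * f)
  set A := scaled stdVar (fun o => o.elim u c) (fun o => o.elim 0 ρ) (C ε * f) with hA
  set A' := scaled stdVar (fun o => o.elim l c) (fun o => o.elim 0 ρ) (C ε * f) with hA'
  rw [map_neg, ← hA'] at hl
  have h1 : (X 0 - 1 : MvPolynomial ℕ ℚ) ∣ F - A := by
    rw [← Ideal.mem_span_singleton]
    refine aeval_sub_aeval_mem _ (fun o => ?_) _
    rw [Ideal.mem_span_singleton]
    cases o with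
    | none =>
      refine ⟨C ((u - l) / 2), ?_⟩
      have e : (u : ℚ) = (l + u) / 2 + (u - l) / 2 := by ring
      have e' := congrArg (C : ℚ → MvPolynomial ℕ ℚ) e
      rw [map_add] at e'
      simp only [Option.elim_none, stdVar, map_zero, zero_mul, add_zero]
      rw [e']
      ring
    | some v => simp
  have h2 : (X 0 + 1 : MvPolynomial ℕ ℚ) ∣ F - A' := by
    rw [← Ideal.mem_span_singleton]
    refine aeval_sub_aeval_mem _ (fun o => ?_) _
    rw [Ideal.mem_span_singleton]
    cases o with
    | none =>
      refine ⟨C ((u - l) / 2), ?_⟩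
      have e : (l : ℚ) = (l + u) / 2 - (u - l) / 2 := by ring
      have e' := congrArg (C : ℚ → MvPolynomial ℕ ℚ) e
      rw [map_sub] at e'
      simp only [Option.elim_none, stdVar, map_zero, zero_mul, add_zero]
      rw [e']
      ring
    | some v => simp
  obtain ⟨B, hB⟩ := h1
  obtain ⟨B', hB'⟩ := h2
  obtain ⟨d1, L1, hd1, hL1, hD1⟩ := hu
  obtain ⟨d2, L2, hd2, hL2, hD2⟩ := hl
  obtain ⟨d3, L3, hd3, hL3⟩ := exists_ev_eq_rat F
  obtain ⟨d4, L4, hd4, hL4⟩ := exists_ev_eq_rat B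
  obtain ⟨d5, L5, hd5, hL5⟩ := exists_ev_eq_rat B'
  set β := (l + u) / 2 with hβ
  set α := (u - l) / 2 with hα
  have hα0 : 0 < α := by rw [hα]; linarith
  refine ⟨(α.den * β.den, α.num.natAbs * β.den, (decide (0 ≤ β.num), β.num.natAbs * α.den),
    mul (const true (d1 * d2 * d4 * d5)) L3, mul (const true (d2 * d3 * d4 * d5)) L1,
    mul (const true (d1 * d2 * d3 * d5)) L4, mul (const true (d1 * d3 * d4 * d5)) L2,
    mul (const true (d1 * d2 * d3 * d4)) L5), ⟨?_, ?_, ?_, ?_, ?_, ?_⟩, ?_, ?_, ?_⟩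
  · exact Nat.mul_pos α.den_pos β.den_pos
  · exact Nat.mul_pos (Int.natAbs_pos.2 (Rat.num_pos.2 hα0).ne') β.den_pos
  · exact hD1.mul_const (by positivity)
  · exact hD2.mul_const (by positivity)
  · apply isZero_of_forall
    have e : F = A + (X 0 - 1) * B := by rw [← hB]; ring
    simp only [ev_append, ev_neg, ev_mul, ev_const, hL1, hL3, hL4, ev_cons, ev_nil, e]
    simp [sgn]
    ring
  · apply isZero_of_forall
    have e : F = A' + (X 0 + 1) * B' := by rw [← hB']; ring
    simp only [ev_append, ev_neg, ev_mul, ev_const, hL2, hL3, hL5, ev_cons, ev_nil, e]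
    simp [sgn]
    ring
  · refine ⟨d1 * d2 * d4 * d5 * d3 * ε, by positivity, ?_⟩
    change ev X (mul _ L3) = _
    rw [ev_mul, ev_const, hL3]
    simp only [F, map_mul]
    simp [sgn, scaled, algebraMap_eq]
    ring
  · have h : (β.den : ℚ) * β = sgn ℚ (decide (0 ≤ β.num)) * (β.num.natAbs : ℚ) := by
      rw [mul_comm, Rat.mul_den_eq_num, ← Int.cast_natCast, Int.natCast_natAbs]
      by_cases h : 0 ≤ β.num
      · rw [abs_of_nonneg h]; simp [sgn, h]
      · rw [abs_of_nonpos (le_of_not_ge h)]; simp [sgn, h]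
    push_cast
    rw [mul_assoc, h]
    ring
  · have hnum : (α.num.natAbs : ℚ) = α * α.den := by
      rw [Rat.mul_den_eq_num, Nat.cast_natAbs, abs_of_pos (Rat.num_pos.2 hα0)]
    push_cast
    rw [hnum]
    ring

theorem exists_dirOK {m r : ℕ} (f : MvPolynomial (Option (Fin m ⊕ Fin r)) ℚ)
    (R : MvPolynomial (Option (Option (Fin m ⊕ Fin r))) ℚ) (d : Fin m)
    (hR : rename some f - rename (fun v => if v = some (.inl d) then none else some v) f =
      (X (some (some (.inl d))) - X none) * R) {c ρ : Option (Fin m ⊕ Fin r) → ℚ} {q ε : ℚ}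
    (hq : q ≠ 0) (hε : ε ≠ 0) (hρ : ρ (some (.inl d)) ≠ 0) {L : SPoly}
    (hL : ev X L = C q * scaled stdVar c ρ f)
    (hD : DomRep (C ε * scaled (fun o => o.elim 0 fun v => stdVar v + 1)
      (fun o => o.elim (c (some (.inl d))) c) (fun o => o.elim (ρ (some (.inl d))) ρ) R)) :
    ∃ Rd, DirOK L d Rd := by
  set G := scaled (fun o : Option (Option (Fin m ⊕ Fin r)) => o.elim 0 fun v => stdVar v + 1)
      (fun o => o.elim (c (some (.inl d))) c) (fun o => o.elim (ρ (some (.inl d))) ρ) with hG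
  have h1 := congrArg G hR
  rw [map_sub, hG, scaled_rename, scaled_rename, map_mul, ← hG] at h1
  have h2 : G (X (some (some (.inl d))) - X none) = C (ρ (some (.inl d))) * (X ((d : ℕ) + 2) - X 0) := by
    simp [G, scaled, stdVar]
    ring
  have h3 : ev X (ren Nat.succ L) - ev X (ren (fun v => if v = d + 1 then 0 else v + 1) L) =
      (X (d + 2 : ℕ) - X 0) * (C (q * ρ (some (.inl d))) * G R) := by
    rw [ev_X_ren, ev_X_ren, hL, map_mul, map_mul, rename_C, rename_C, rename_scaled, rename_scaled,
      ← mul_sub, map_mul]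
    have e1 : (fun v => if v = (d : ℕ) + 1 then 0 else v + 1) ∘ (stdVar (m := m) (r := r)) =
        (fun o : Option (Option (Fin m ⊕ Fin r)) => o.elim 0 fun v => stdVar v + 1) ∘
          fun v => if v = some (.inl d) then none else some v := by
      funext o
      rcases o with _ | a | a
      · simp [stdVar]
      · by_cases ha : a = d
        · subst ha; simp [stdVar]
        · have : (a : ℕ) ≠ d := fun h => ha (Fin.ext h)
          simp [stdVar, ha, this]
      · simp [stdVar]
    have e2 : ∀ z : Option (Fin m ⊕ Fin r) → ℚ,
        (fun o : Option (Option (Fin m ⊕ Fin r)) => o.elim (z (some (.inl d))) z) ∘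
          (fun v => if v = some (.inl d) then none else some v) = z := by
      intro z
      funext o
      by_cases ho : o = some (.inl d)
      · simp [ho]
      · simp [ho]
    rw [e2, e2, ← e1, h2] at h1
    have e3 : ∀ z : Option (Fin m ⊕ Fin r) → ℚ,
      (fun o : Option (Option (Fin m ⊕ Fin r)) => o.elim (z (some (.inl d))) z) ∘ some = z :=
      fun z => rfl
    have e4 : (fun o : Option (Option (Fin m ⊕ Fin r)) => o.elim 0 fun v => stdVar v + 1) ∘ some =
      Nat.succ ∘ (stdVar (m := m) (r := r)) := rfl
    rw [e3, e3, e4] at h1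
    rw [h1]
    ring
  have h4 : ∃ s : ℚ, s ≠ 0 ∧ q * ρ (some (.inl d)) = s * ε :=
    ⟨q * ρ (some (.inl d)) / ε, by positivity, by field_simp⟩
  obtain ⟨s, hs, hsq⟩ := h4
  rw [hsq] at h3
  rcases lt_or_gt_of_ne hs with hs | hs
  · obtain ⟨D, M, hD, hM, hdom⟩ := hD.mul_C (neg_pos.2 hs)
    refine ⟨(D, neg M), Or.inr (by rw [neg_neg]; exact hdom), isZero_of_forall ?_⟩
    simp only [ev_append, ev_neg, ev_mul, ev_const, ev_cons, ev_nil, hM]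
    rw [← sub_eq_add_neg (ev X (ren Nat.succ L)), h3]
    simp [sgn]
    ring
  · obtain ⟨D, M, hD, hM, hdom⟩ := hD.mul_C hs
    refine ⟨(D, M), Or.inl hdom, isZero_of_forall ?_⟩
    simp only [ev_append, ev_neg, ev_mul, ev_const, ev_cons, ev_nil, hM]
    rw [← sub_eq_add_neg (ev X (ren Nat.succ L)), h3]
    simp [sgn]
    ring

end SPoly

end RealGridCertificates

section RealGridCertificatesExist

open MvPolynomial

namespace SPoly

theorem scaled_congr {ι : Type} {g g' : ι → ℕ} {c ρ : ι → ℚ} (h : ∀ i, ρ i = 0 ∨ g i = g' i)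
    (f : MvPolynomial ι ℚ) : scaled g c ρ f = scaled g' c ρ f := by
  rw [scaled, scaled]
  congr 2
  funext i
  rcases h i with h | h <;> simp [h]

theorem exists_pos_le {ι : Type*} [Finite ι] (f : ι → ℝ) (hf : ∀ i, 0 < f i) :
    ∃ δ : ℝ, 0 < δ ∧ ∀ i, δ ≤ f i := by
  cases isEmpty_or_nonempty ι with
  | inl h => exact ⟨1, one_pos, fun i => (h.false i).elim⟩
  | inr h =>
    obtain ⟨i, hi⟩ := Finite.exists_min f
    exact ⟨f i, hf i, hi⟩

theorem exists_rat_near (x : ℝ) {δ : ℝ} (hδ : 0 < δ) : ∃ q : ℚ, |(q : ℝ) - x| ≤ δ := by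
  obtain ⟨q, h1, h2⟩ := exists_rat_btwn (show x < x + δ by linarith)
  exact ⟨q, by rw [abs_le]; constructor <;> linarith⟩

/-- The variables of the cofactor of a certificate. -/
def boxIndex {k n m r : ℕ} : ((Fin m × Fin k) ⊕ Fin r) ⊕ (Fin k × Fin n) → ℕ :=
  Sum.elim (Sum.elim (fun v => Nat.pair (v.1 + 1) v.2) fun _ => 0)
    fun w => Nat.pair 0 (Nat.pair w.1 w.2)

/-- Rational data on the coordinates of a grid, copied to all rows. -/
def boxData {k n m r : ℕ} (z : Fin m ⊕ Fin r → ℚ) (y : Fin n → ℚ) :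
    ((Fin m × Fin k) ⊕ Fin r) ⊕ (Fin k × Fin n) → ℚ :=
  Sum.elim (Sum.elim (fun v => z (.inl v.1)) fun d => z (.inr d)) fun w => y w.2

theorem exists_certificate_of_links {k n m r N : ℕ} {co : PolyCode} {P : Fin k → Fin m → Fin k}
    (hP : ∀ i c, (P i c : ℕ) = rowOf k m N i c)
    {Q : Fin n → MvPolynomial (Option (Fin m ⊕ Fin r)) ℚ}
    {S : MvPolynomial (((Fin m × Fin k) ⊕ Fin r) ⊕ (Fin k × Fin n)) ℚ}
    (hp : S * rename Sum.inr (decodePoly k n co) ∈ eqIdeal (gridEquations P Q))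
    (lk : Fin n → Link) (hlk : ∀ j, (lk j).OK) {β α q : Fin n → ℚ} {c ρ : Fin m ⊕ Fin r → ℚ}
    (hq : ∀ j, q j ≠ 0) (hρ : ∀ d, ρ (.inr d) = 0)
    (hpoly : ∀ j, ev X (lk j).poly =
      C (q j) * scaled stdVar (fun o => o.elim (β j) c) (fun o => o.elim (α j) ρ) (Q j))
    (hβ : ∀ j, ((lk j).1 : ℚ) * β j = sgn ℚ (lk j).2.2.1.1 * (lk j).2.2.1.2)
    (hα : ∀ j, ((lk j).1 : ℚ) * α j = (lk j).2.1) {ε : ℚ}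
    (hS : DomRep (C ε * scaled boxIndex (boxData c β) (boxData ρ α) S)) :
    ∃ (L : SPoly) (hs : List (SPoly × Bool × ℕ × ℕ)), Dom L ∧
      (∀ h ∈ hs, h.2.2.1 < k ∧ h.2.2.2 < n) ∧
      IsZero (mul (ren (fun v => 2 * v) L) (ren (fun v => 2 * v + 1) (codePoly (k * n) co)) ++
        neg (hs.flatMap fun h => mul h.1 (posGen k n m N (List.ofFn lk) h.2))) := by
  set G : Bool × Fin k × Fin n → MvPolynomial ℕ ℚ := fun w =>
    ev X (posGen k n m N (List.ofFn lk) (w.1, w.2.1, w.2.2)) with hG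
  set J := Ideal.span (Set.range G) with hJ
  have hGJ : ∀ w, G w ∈ J := fun w => Ideal.subset_span ⟨w, rfl⟩
  have hgetD : ∀ j : Fin n, (List.ofFn lk).getD j default = lk j := by
    intro j
    simp
  set Φ := scaled (fun w => 2 * boxIndex w) (boxData (k := k) c β) (boxData ρ α) with hΦ
  have hΦJ : ∀ f ∈ eqIdeal (gridEquations P Q), Φ f ∈ J := by
    intro f hf
    have h1 : eqIdeal (gridEquations P Q) ≤ J.comap Φ := by
      refine Ideal.span_le.2 ?_
      rintro _ ⟨⟨i, j⟩, rfl⟩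
      change Φ (rename _ (rename _ (Q j))) ∈ J
      rw [rename_rename, hΦ, scaled_rename]
      have h2 := hGJ (true, i, j)
      have h3 : G (true, i, j) = C (q j) * scaled (boxVar k m N i j ∘ stdVar)
          (fun o => o.elim (β j) c) (fun o => o.elim (α j) ρ) (Q j) := by
        simp only [hG, posGen, if_true, hgetD]
        rw [ev_X_ren, hpoly, map_mul, rename_C, rename_scaled]
      rw [h3] at h2
      have h4 : C (q j)⁻¹ * (C (q j) * scaled (boxVar k m N i j ∘ stdVar)
          (fun o => o.elim (β j) c) (fun o => o.elim (α j) ρ) (Q j)) ∈ J := J.mul_mem_left _ h2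
      rw [← mul_assoc, ← C_mul, inv_mul_cancel₀ (hq j), C_1, one_mul] at h4
      convert h4 using 1
      have e1 : boxData (k := k) c β ∘ (eqVar ((Fin m × Fin k) ⊕ Fin r) (i, j) ∘
          Option.map (Sum.map (fun c => (c, P i c)) id)) = fun o => o.elim (β j) c := by
        funext o
        rcases o with _ | o | o <;> rfl
      have e2 : boxData (k := k) ρ α ∘ (eqVar ((Fin m × Fin k) ⊕ Fin r) (i, j) ∘
          Option.map (Sum.map (fun c => (c, P i c)) id)) = fun o => o.elim (α j) ρ := by
        funext o
        rcases o with _ | o | o <;> rfl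
      rw [e1, e2]
      refine scaled_congr (fun o => ?_) _
      rcases o with _ | o | o
      · right
        simp [boxIndex, eqVar, boxVar, stdVar]
      · right
        simp [boxIndex, eqVar, boxVar, stdVar, hP]
      · left
        exact hρ o
    exact h1 hf
  have hY : ∀ i j, Φ (X (.inr (i, j))) - X (2 * (i * n + j) + 1) ∈ J := by
    intro i j
    have hD : ((lk j).1 : ℚ) ≠ 0 := by
      have := (hlk j).1
      positivity
    have h3 : G (false, i, j) = C ((lk j).1 : ℚ) * (X (2 * ((i : ℕ) * n + j) + 1) -
        Φ (X (.inr (i, j)))) := by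
      have e1 := congrArg (C : ℚ → MvPolynomial ℕ ℚ) (hβ j)
      have e2 := congrArg (C : ℚ → MvPolynomial ℕ ℚ) (hα j)
      have e3 : (C (sgn ℚ (lk j).2.2.1.1) : MvPolynomial ℕ ℚ) =
        sgn (MvPolynomial ℕ ℚ) (lk j).2.2.1.1 := by cases (lk j).2.2.1.1 <;> simp [sgn]
      rw [map_mul, map_mul, e3, map_natCast, map_natCast] at e1
      rw [map_mul, map_natCast, map_natCast] at e2
      simp only [hG, posGen, hgetD, hΦ, scaled, aeval_X, boxIndex, boxData, Sum.elim_inr,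
        boxVar, if_true, map_natCast]
      simp only [Bool.false_eq_true, if_false, ev_append, ev_mul, ev_neg, ev_const, ev_cons, ev_nil,
        ← e1, ← e2]
      simp [sgn]
      ring
    have h4 : -C ((lk j).1 : ℚ)⁻¹ * G (false, i, j) ∈ J := J.mul_mem_left _ (hGJ _)
    rw [h3, ← mul_assoc, neg_mul, ← C_mul, inv_mul_cancel₀ hD, C_1, neg_mul, one_mul, neg_sub] at h4
    exact h4
  set pY := aeval (fun v : Fin k × Fin n => (X (2 * ((v.1 : ℕ) * n + v.2) + 1) : MvPolynomial ℕ ℚ))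
    (decodePoly k n co) with hpY
  have hSp : Φ S * pY ∈ J := by
    have h1 := hΦJ _ hp
    have h2 : Φ (rename Sum.inr (decodePoly k n co)) - pY ∈ J := by
      have e : Φ (rename Sum.inr (decodePoly k n co)) =
          aeval (fun v : Fin k × Fin n => Φ (X (.inr v))) (decodePoly k n co) := by
        rw [hΦ, scaled_rename, scaled]
        congr 2
        funext v
        simp [scaled]
      rw [e, hpY]
      refine aeval_sub_aeval_mem (R := ℚ) J
        (x := fun v : Fin k × Fin n => Φ (X (.inr v)))
        (y := fun v : Fin k × Fin n => X (2 * ((v.1 : ℕ) * n + v.2) + 1)) (fun v => ?_) _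
      exact hY v.1 v.2
    rw [map_mul] at h1
    have h3 := J.sub_mem h1 (J.mul_mem_left (Φ S) h2)
    rw [mul_sub, sub_sub_cancel] at h3
    exact h3
  obtain ⟨dS, L, hdS, hL, hLd⟩ := hS
  have hL2 : ev X (ren (fun v => 2 * v) L) = (dS : MvPolynomial ℕ ℚ) * (C ε * Φ S) := by
    rw [ev_X_ren, hL, map_mul, map_natCast, map_mul, rename_C, rename_scaled]
    rfl
  have hpI : ev X (ren (fun v => 2 * v + 1) (codePoly (k * n) co)) =
      (codeDen co : MvPolynomial ℕ ℚ) * pY := by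
    rw [ev_ren, ev_codePoly]
  have hmem : ev X (mul (ren (fun v => 2 * v) L) (ren (fun v => 2 * v + 1) (codePoly (k * n) co))) ∈
      J := by
    rw [ev_mul, hL2, hpI]
    have e : (dS : MvPolynomial ℕ ℚ) * (C ε * Φ S) * ((codeDen co : MvPolynomial ℕ ℚ) * pY) =
      ((dS : MvPolynomial ℕ ℚ) * C ε * (codeDen co : MvPolynomial ℕ ℚ)) * (Φ S * pY) := by ring
    rw [e]
    exact J.mul_mem_left _ hSp
  obtain ⟨l, hl⟩ := exists_list_of_mem_span G hmem
  obtain ⟨D, hD, hDl⟩ := exists_common_denominator (l.map Prod.fst)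
  choose! Lf hLf using hDl
  refine ⟨mul (const true D) L, l.map fun h => (Lf h.1, h.2.1, h.2.2.1, h.2.2.2), hLd.mul_const hD,
    ?_, isZero_of_forall ?_⟩
  · intro h hh
    obtain ⟨w, -, rfl⟩ := List.mem_map.1 hh
    exact ⟨w.2.2.1.2, w.2.2.2.2⟩
  · have e1 : ev (X : ℕ → MvPolynomial ℕ ℚ) ((l.map fun h => (Lf h.1, h.2.1, (h.2.2.1 : ℕ),
        (h.2.2.2 : ℕ))).flatMap fun h => mul h.1 (posGen k n m N (List.ofFn lk) h.2)) =
        (D : MvPolynomial ℕ ℚ) * ev X (mul (ren (fun v => 2 * v) L) (ren (fun v => 2 * v + 1) (codePoly (k * n) co))) := by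
      rw [ev_flatMap, List.map_map, ← hl, ← List.sum_map_mul_left]
      congr 1
      refine List.map_congr_left fun h hh => ?_
      simp only [Function.comp, ev_mul, hLf h.1 (List.mem_map_of_mem hh), hG]
      ring
    rw [ev_append, ev_neg, e1, ev_mul, ev_ren, ev_mul, ev_const, ev_mul, ev_ren]
    simp [sgn]
    ring

theorem exists_posCheck {k n m N : ℕ} {co : PolyCode} {P : Fin k → Fin m → Fin k}
    (hP : ∀ i c, (P i c : ℕ) = rowOf k m N i c) (h : LocalGrid ℝ (decodePoly k n co) m P) :
    ∃ z, PosCheck k n m N (codePoly (k * n) co) z := by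
  classical
  obtain ⟨r, Q, σ, b, S, h0, h1, h2, hS, hp⟩ := h
  choose d hd using h2
  choose R hR hRz using fun c => exists_divided_difference (Q (d c)) (some (.inl c))
  have hRne : ∀ c, aeval (fun w : Option (Option (Fin m ⊕ Fin r)) => w.elim (σ (.inl c))
      fun o => o.elim (b (d c)) σ) (R c) ≠ 0 := by
    intro c
    have := hRz c fun o => o.elim (b (d c)) σ
    simp only [Option.elim_some] at this
    rw [this]
    exact hd c
  choose εR hεR δR hδR hDR using fun c => exists_domRep_of_ne (R c) _ (hRne c)
  obtain ⟨εS, hεS, δS, hδS, hDS⟩ := exists_domRep_of_ne S _ hS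
  obtain ⟨δ1, hδ1, hδ1R⟩ := exists_pos_le δR hδR
  obtain ⟨δ0, hδ0, hδ01, hδ0S⟩ : ∃ δ0 : ℝ, 0 < δ0 ∧ δ0 ≤ δ1 ∧ δ0 ≤ δS :=
    ⟨min δ1 δS, lt_min hδ1 hδS, min_le_left _ _, min_le_right _ _⟩
  choose l u εQ hlu hl hu hεQ hpu hpl using fun j =>
    exists_sign_change (Q j) σ (b j) (h0 j) (h1 j) hδ0
  choose δu hδu hDu using fun j => exists_domRep (C (εQ j) * Q j) _ (hpu j)
  choose δl hδl hDl using fun j => exists_domRep (- (C (εQ j) * Q j)) _ (hpl j)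
  obtain ⟨δ2, hδ2, hδ2u⟩ := exists_pos_le δu hδu
  obtain ⟨δ3, hδ3, hδ3l⟩ := exists_pos_le δl hδl
  obtain ⟨δ, hδ, hδ0', hδ2', hδ3'⟩ : ∃ δ : ℝ, 0 < δ ∧ δ ≤ δ0 ∧ δ ≤ δ2 ∧ δ ≤ δ3 :=
    ⟨min δ0 (min δ2 δ3), by positivity, min_le_left _ _, (min_le_right _ _).trans (min_le_left _ _),
      (min_le_right _ _).trans (min_le_right _ _)⟩
  choose σ' hσ' using fun v => exists_rat_near (σ v) hδ
  obtain ⟨ρ0, hρ0, hρ0δ⟩ := exists_rat_btwn hδ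
  set ρ : Fin m ⊕ Fin r → ℚ := Sum.elim (fun _ => ρ0) fun _ => 0 with hρ
  have hρδ : ∀ v, |(ρ v : ℝ)| ≤ δ := by
    intro v
    rcases v with v | v
    · rw [hρ, Sum.elim_inl, abs_of_pos hρ0]
      exact hρ0δ.le
    · simp [hρ, hδ.le]
  have hβ : ∀ j, |(((l j + u j) / 2 : ℚ) : ℝ) - b j| ≤ δ0 := by
    intro j
    have h3 := abs_le.1 (hl j)
    have h4 := abs_le.1 (hu j)
    push_cast
    rw [abs_le]
    constructor <;> linarith
  have hα : ∀ j, |(((u j - l j) / 2 : ℚ) : ℝ)| ≤ δ0 := by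
    intro j
    have h3 := abs_le.1 (hl j)
    have h4 := abs_le.1 (hu j)
    push_cast
    rw [abs_le]
    constructor <;> linarith
  choose lk hlk hlkq hlkβ hlkα using fun j => exists_link (Q j) (hlu j) (hεQ j) σ' ρ
    (hDu j stdVar (fun o => o.elim (u j) σ') (fun o => o.elim 0 ρ)
      (by
        rintro (_ | v)
        · simpa using (hδu j).le
        · exact (hσ' v).trans (hδ2'.trans (hδ2u j)))
      (by
        rintro (_ | v)
        · simpa using (hδu j).le
        · exact (hρδ v).trans (hδ2'.trans (hδ2u j))))
    (hDl j stdVar (fun o => o.elim (l j) σ') (fun o => o.elim 0 ρ)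
      (by
        rintro (_ | v)
        · simpa using (hδl j).le
        · exact (hσ' v).trans (hδ3'.trans (hδ3l j)))
      (by
        rintro (_ | v)
        · simpa using (hδl j).le
        · exact (hρδ v).trans (hδ3'.trans (hδ3l j))))
  choose q hlkpoly using hlkq
  have hδR' : ∀ c, δ0 ≤ δR c := fun c => hδ01.trans (hδ1R c)
  choose Rd hRd using fun c => exists_dirOK (Q (d c)) (R c) c (hR c)
    (c := fun o => o.elim ((l (d c) + u (d c)) / 2) σ')
    (ρ := fun o => o.elim ((u (d c) - l (d c)) / 2) ρ) (hlkpoly (d c)).1 (hεR c)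
    (by
      have : (0 : ℚ) < ρ0 := by exact_mod_cast hρ0
      exact this.ne') (hlkpoly (d c)).2
    (hDR c _ _ _
      (by
        rintro (_ | _ | v)
        · exact (hσ' _).trans (hδ0'.trans (hδR' c))
        · exact (hβ _).trans (hδR' c)
        · exact (hσ' v).trans (hδ0'.trans (hδR' c)))
      (by
        rintro (_ | _ | v)
        · exact (hρδ (.inl c)).trans (hδ0'.trans (hδR' c))
        · exact (hα _).trans (hδR' c)
        · exact (hρδ v).trans (hδ0'.trans (hδR' c))))
  obtain ⟨L, hs, hL, hs1, hs2⟩ := exists_certificate_of_links hP hp lk hlk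
    (fun j => (hlkpoly j).1) (fun _ => rfl) (fun j => (hlkpoly j).2) hlkβ hlkα
    (hDS boxIndex (boxData σ' fun j => (l j + u j) / 2) (boxData ρ fun j => (u j - l j) / 2)
      (by
        rintro ((v | v) | w)
        · exact (hσ' _).trans (hδ0'.trans hδ0S)
        · exact (hσ' _).trans (hδ0'.trans hδ0S)
        · exact (hβ _).trans hδ0S)
      (by
        rintro ((v | v) | w)
        · exact (hρδ (.inl v.1)).trans (hδ0'.trans hδ0S)
        · exact (hρδ (.inr v)).trans (hδ0'.trans hδ0S)
        · exact (hα _).trans hδ0S))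
  refine ⟨(List.ofFn lk, List.ofFn fun c => ((d c : ℕ), Rd c), L, hs), ?_, ?_, hL, hs1, hs2⟩
  · intro j hj
    simpa [hj] using hlk ⟨j, hj⟩
  · intro c hc
    simpa [hc] using hRd ⟨c, hc⟩

end SPoly

end RealGridCertificatesExist

section RationalCodes

/-- The code of a rational number before the renumbering. -/
abbrev ratCode (q : ℚ) : ℕ := @Encodable.encode ℚ Rat.instEncodable q

theorem exists_ratCode_gt (x : ℕ) : ∃ m, x + m + 1 ∈ Set.range ratCode := by
  have h1 : (Set.range ratCode).Infinite :=
    Set.infinite_range_of_injective (@Encodable.encode_injective ℚ Rat.instEncodable)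
  obtain ⟨y, hy, hxy⟩ := h1.exists_gt x
  obtain ⟨m, rfl⟩ := Nat.exists_eq_add_of_lt hxy
  exact ⟨m, hy⟩

open Classical in
theorem ratCode_ofNat_succ (n : ℕ) : ratCode (Denumerable.ofNat ℚ (n + 1)) =
    ratCode (Denumerable.ofNat ℚ n) +
      Nat.find (exists_ratCode_gt (ratCode (Denumerable.ofNat ℚ n))) + 1 := by
  let hdec : DecidablePred (· ∈ Set.range ratCode) :=
    @Encodable.decidableRangeEncode ℚ Rat.instEncodable
  let : Infinite (Set.range ratCode) := Infinite.of_injective _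
    (Equiv.ofInjective _ (@Encodable.encode_injective ℚ Rat.instEncodable)).injective
  have h : ∀ n, ratCode (Denumerable.ofNat ℚ n) =
      (@Nat.Subtype.ofNat (Set.range ratCode) hdec _ n : ℕ) := by
    intro n
    have h1 : Denumerable.ofNat ℚ n = (@Encodable.equivRangeEncode ℚ Rat.instEncodable).symm
      (@Nat.Subtype.ofNat (Set.range ratCode) hdec _ n) := rfl
    rw [h1]
    exact congrArg Subtype.val ((@Encodable.equivRangeEncode ℚ Rat.instEncodable).apply_symm_apply
      (@Nat.Subtype.ofNat (Set.range ratCode) hdec _ n))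
  have h2 : ∀ (x : ℕ) (hx : ∃ m, x + m + 1 ∈ Set.range ratCode),
      @Nat.find _ (fun m => hdec (x + m + 1)) hx = Nat.find (exists_ratCode_gt x) := by
    intro x hx
    congr!
  have h3 : (@Nat.Subtype.ofNat (Set.range ratCode) hdec _ (n + 1) : ℕ) =
      (@Nat.Subtype.ofNat (Set.range ratCode) hdec _ n : ℕ) +
        @Nat.find _ (fun m => hdec (_ + m + 1)) (exists_ratCode_gt _) + 1 := rfl
  rw [h, h, h3]
  congr!

theorem ratCode_eq (q : ℚ) : ratCode q = Nat.pair (Equiv.intEquivNat q.num) q.den := rfl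

theorem natAbs_intEquivNat_symm (a : ℕ) : (Equiv.intEquivNat.symm a).natAbs = (a + 1) / 2 := by
  obtain ⟨z, rfl⟩ := Equiv.intEquivNat.surjective a
  rw [Equiv.symm_apply_apply]
  cases z with
  | ofNat x =>
    have : Equiv.intEquivNat (Int.ofNat x) = 2 * x := rfl
    rw [this]
    simp
    omega
  | negSucc x =>
    have : Equiv.intEquivNat (Int.negSucc x) = 2 * x + 1 := rfl
    rw [this]
    simp
    omega

theorem nonneg_intEquivNat_symm (a : ℕ) : 0 ≤ Equiv.intEquivNat.symm a ↔ a % 2 = 0 := by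
  obtain ⟨z, rfl⟩ := Equiv.intEquivNat.surjective a
  rw [Equiv.symm_apply_apply]
  cases z with
  | ofNat x =>
    have : Equiv.intEquivNat (Int.ofNat x) = 2 * x := rfl
    rw [this]
    simp
  | negSucc x =>
    have : Equiv.intEquivNat (Int.negSucc x) = 2 * x + 1 := rfl
    rw [this]
    simp [Int.negSucc_not_nonneg]

theorem ratData_eq (q : ℚ) : SPoly.ratData q = (decide ((ratCode q).unpair.1 % 2 = 0),
    ((ratCode q).unpair.1 + 1) / 2, (ratCode q).unpair.2) := by
  have h1 := natAbs_intEquivNat_symm (Equiv.intEquivNat q.num)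
  have h2 := nonneg_intEquivNat_symm (Equiv.intEquivNat q.num)
  rw [Equiv.symm_apply_apply] at h1 h2
  rw [ratCode_eq, Nat.unpair_pair, ← h1, SPoly.ratData]
  simp [h2]

theorem mem_range_ratCode (t : ℕ) : t ∈ Set.range ratCode ↔ 0 < t.unpair.2 ∧
    ∀ x < t.unpair.2 + 1, ((t.unpair.1 + 1) / 2) % x = 0 → t.unpair.2 % x = 0 → x = 1 := by
  have h : 0 < t.unpair.2 → ((∀ x < t.unpair.2 + 1, ((t.unpair.1 + 1) / 2) % x = 0 →
      t.unpair.2 % x = 0 → x = 1) ↔ Nat.Coprime ((t.unpair.1 + 1) / 2) t.unpair.2) := by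
    intro h0
    constructor
    · intro h
      refine h _ ?_ ?_ ?_
      · exact Nat.lt_succ_of_le (Nat.gcd_le_right _ h0)
      · exact Nat.mod_eq_zero_of_dvd (Nat.gcd_dvd_left _ _)
      · exact Nat.mod_eq_zero_of_dvd (Nat.gcd_dvd_right _ _)
    · intro h x _ h1 h2
      exact Nat.eq_one_of_dvd_coprimes h (Nat.dvd_of_mod_eq_zero h1) (Nat.dvd_of_mod_eq_zero h2)
  constructor
  · rintro ⟨q, rfl⟩
    have h0 : 0 < (ratCode q).unpair.2 := by
      rw [ratCode_eq, Nat.unpair_pair]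
      exact q.den_pos
    refine ⟨h0, (h h0).2 ?_⟩
    rw [ratCode_eq, Nat.unpair_pair, ← natAbs_intEquivNat_symm, Equiv.symm_apply_apply]
    exact q.reduced
  · rintro ⟨h0, h1⟩
    rw [h h0, ← natAbs_intEquivNat_symm] at h1
    refine ⟨⟨Equiv.intEquivNat.symm t.unpair.1, t.unpair.2, h0.ne', h1⟩, ?_⟩
    rw [ratCode_eq]
    simp

theorem PrimrecPred.forall_mem_of {α β : Type*} [Primcodable α] [Primcodable β] {f : α → List β}
    {R : α → β → Prop} (hR : PrimrecRel R) (hf : Primrec f) :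
    PrimrecPred fun a => ∀ x ∈ f a, R a x :=
  (PrimrecRel.forall_mem_list (R := fun x a => R a x) hR.swap).comp hf Primrec.id

theorem PrimrecPred.forall_lt_of {α : Type*} [Primcodable α] {f : α → ℕ} {R : α → ℕ → Prop}
    (hR : PrimrecRel R) (hf : Primrec f) : PrimrecPred fun a => ∀ x < f a, R a x :=
  (PrimrecPred.forall_mem_of hR (Primrec.list_range.comp hf)).of_eq fun a => by simp

theorem PrimrecPred.imp {α : Type*} [Primcodable α] {p q : α → Prop} (hp : PrimrecPred p)
    (hq : PrimrecPred q) : PrimrecPred fun a => p a → q a :=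
  (hp.not.or hq).of_eq fun a => by tauto

theorem primrecPred_mem_range_ratCode : PrimrecPred (· ∈ Set.range ratCode) := by
  have h2 : Primrec fun t : ℕ => t.unpair.2 := Primrec.snd.comp Primrec.unpair
  have h1 : Primrec fun t : ℕ => (t.unpair.1 + 1) / 2 :=
    Primrec.nat_div.comp (Primrec.succ.comp (Primrec.fst.comp Primrec.unpair)) (Primrec.const 2)
  refine PrimrecPred.of_eq ((Primrec.nat_lt.comp (Primrec.const 0) h2).and
    (PrimrecPred.forall_lt_of (α := ℕ) (R := fun t x => ((t.unpair.1 + 1) / 2) % x = 0 →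
      t.unpair.2 % x = 0 → x = 1) ?_ (Primrec.succ.comp h2))) fun t => (mem_range_ratCode t).symm
  exact PrimrecPred.imp (Primrec.eq.comp (Primrec.nat_mod.comp (h1.comp Primrec.fst) Primrec.snd)
      (Primrec.const 0))
    (PrimrecPred.imp (Primrec.eq.comp (Primrec.nat_mod.comp (h2.comp Primrec.fst) Primrec.snd)
      (Primrec.const 0)) (Primrec.eq.comp Primrec.snd (Primrec.const 1)))

theorem computable_ratCode : Computable ratCode := by
  classical
  have h1 : Computable fun x => Nat.find (exists_ratCode_gt x) := by
    refine Computable.find (P := fun x m => x + m + 1 ∈ Set.range ratCode) ?_ _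
    have h : Primrec fun p : ℕ × ℕ => p.1 + p.2 + 1 :=
      Primrec.succ.comp (Primrec.nat_add.comp (Primrec.fst (α := ℕ) (β := ℕ)) Primrec.snd)
    exact PrimrecPred.computablePred (PrimrecPred.comp (f := fun p : ℕ × ℕ => p.1 + p.2 + 1)
      primrecPred_mem_range_ratCode h)
  have h2 : Computable fun n : ℕ => (Nat.rec (ratCode (Denumerable.ofNat ℚ 0))
      (fun _ x => x + Nat.find (exists_ratCode_gt x) + 1) n : ℕ) := by
    have h3 : Computable fun x : ℕ => x + Nat.find (exists_ratCode_gt x) + 1 :=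
      Computable.succ.comp (Primrec.nat_add.to_comp.comp Computable.id h1)
    exact Computable.nat_rec (σ := ℕ)
      (h := fun _ p => p.2 + Nat.find (exists_ratCode_gt p.2) + 1)
      Computable.id (Computable.const _) (h3.comp (Computable.snd.comp Computable.snd))
  have h3 : ∀ n : ℕ, (Nat.rec (ratCode (Denumerable.ofNat ℚ 0))
      (fun _ x => x + Nat.find (exists_ratCode_gt x) + 1) n : ℕ) =
        ratCode (Denumerable.ofNat ℚ n) := by
    intro n
    induction n with
    | zero => rfl
    | succ n ih => rw [ratCode_ofNat_succ, ← ih]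
  refine (h2.comp (Computable.encode (α := ℚ))).of_eq fun q => ?_
  rw [h3, Denumerable.ofNat_encode]

theorem computable_ratData : Computable SPoly.ratData := by
  have h1 : Primrec fun t : ℕ => (decide (t.unpair.1 % 2 = 0), (t.unpair.1 + 1) / 2, t.unpair.2) :=
    (PrimrecPred.decide (Primrec.eq.comp (Primrec.nat_mod.comp (Primrec.fst.comp Primrec.unpair)
      (Primrec.const 2)) (Primrec.const 0))).pair
      ((Primrec.nat_div.comp (Primrec.succ.comp (Primrec.fst.comp Primrec.unpair))
        (Primrec.const 2)).pair (Primrec.snd.comp Primrec.unpair))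
  exact (h1.to_comp.comp computable_ratCode).of_eq fun q => (ratData_eq q).symm

end RationalCodes

section PrimrecChecks

namespace SPoly

variable {α : Type*} [Primcodable α]

theorem primrec_mul {A B : α → SPoly} (hA : Primrec A) (hB : Primrec B) :
    Primrec fun a => mul (A a) (B a) := by
  have hbeq : Primrec₂ fun a b : Bool => a == b := Primrec.dom_finite _
  refine Primrec.list_flatMap hA (Primrec.list_map (f := fun p : α × (Bool × List ℕ) => B p.1)
    (hB.comp Primrec.fst) ?_)
  exact Primrec.pair
    (hbeq.comp (Primrec.fst.comp (Primrec.snd.comp Primrec.fst)) (Primrec.fst.comp Primrec.snd))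
    (Primrec.list_append.comp (Primrec.snd.comp (Primrec.snd.comp Primrec.fst))
      (Primrec.snd.comp Primrec.snd))

theorem primrec_neg {A : α → SPoly} (hA : Primrec A) : Primrec fun a => neg (A a) :=
  Primrec.list_map hA (Primrec.pair (Primrec.not.comp (Primrec.fst.comp Primrec.snd))
    (Primrec.snd.comp Primrec.snd))

theorem primrec_ren {A : α → SPoly} {h : α → ℕ → ℕ} (hh : Primrec₂ h) (hA : Primrec A) :
    Primrec fun a => ren (h a) (A a) :=
  Primrec.list_map hA (Primrec.pair (Primrec.fst.comp Primrec.snd)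
    (Primrec.list_map (f := fun p : α × (Bool × List ℕ) => p.2.2) (Primrec.snd.comp Primrec.snd)
      (hh.comp (Primrec.fst.comp Primrec.fst) Primrec.snd)))

theorem primrec_const {b : α → Bool} {c : α → ℕ} (hb : Primrec b) (hc : Primrec c) :
    Primrec fun a => const (b a) (c a) :=
  Primrec.list_map (Primrec.list_range.comp hc)
    (Primrec.pair (hb.comp Primrec.fst) (Primrec.const []))

theorem primrecRel_perm : PrimrecRel fun l m : List ℕ => l.Perm m := by
  have h1 : Primrec₂ fun (l : List ℕ) (a : ℕ) => l.count a := by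
    refine (Primrec.list_length.comp (PrimrecRel.listFilter
      (R := fun x a : ℕ => x = a) Primrec.eq)).of_eq fun p => ?_
    change _ = p.1.count p.2
    rw [List.count_eq_length_filter]
    rfl
  have h2 : PrimrecRel fun (p : List ℕ × List ℕ) (a : ℕ) => p.1.count a = p.2.count a :=
    Primrec.eq.comp (h1.comp (Primrec.fst.comp Primrec.fst) Primrec.snd)
      (h1.comp (Primrec.snd.comp Primrec.fst) Primrec.snd)
  refine (PrimrecPred.forall_mem_of h2 Primrec.list_append).of_eq fun p => ?_
  change _ ↔ p.1.Perm p.2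
  rw [List.perm_iff_count]
  refine ⟨fun h a => ?_, fun h a _ => h a⟩
  by_cases ha : a ∈ p.1 ++ p.2
  · exact h a ha
  · rw [List.mem_append, not_or] at ha
    rw [List.count_eq_zero_of_not_mem ha.1, List.count_eq_zero_of_not_mem ha.2]

theorem primrecPred_isZero {A : α → SPoly} (hA : Primrec A) :
    PrimrecPred fun a => IsZero (A a) := by
  have h (b : Bool) : Primrec₂ fun (L : SPoly) (e : Bool × List ℕ) =>
      (L.filter fun f => f.2.Perm e.2 ∧ f.1 = b).length := by
    refine Primrec.list_length.comp (PrimrecRel.listFilter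
      (R := fun f e : Bool × List ℕ => f.2.Perm e.2 ∧ f.1 = b) ?_)
    exact PrimrecPred.and (primrecRel_perm.comp (Primrec.snd.comp Primrec.fst)
      (Primrec.snd.comp Primrec.snd))
      (Primrec.eq.comp (Primrec.fst.comp Primrec.fst) (Primrec.const b))
  exact PrimrecPred.forall_mem_of (R := fun (a : α) e =>
    ((A a).filter fun f => f.2.Perm e.2 ∧ f.1 = true).length =
      ((A a).filter fun f => f.2.Perm e.2 ∧ f.1 = false).length)
    (Primrec.eq.comp ((h true).comp (hA.comp Primrec.fst) Primrec.snd)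
      ((h false).comp (hA.comp Primrec.fst) Primrec.snd)) hA

theorem primrecPred_dom {A : α → SPoly} (hA : Primrec A) : PrimrecPred fun a => Dom (A a) := by
  have h : Primrec fun L : SPoly => L.filter fun f => f = (true, []) :=
    Primrec.listFilter (Primrec.eq.comp Primrec.id (Primrec.const _))
  exact Primrec.nat_lt.comp (Primrec.list_length.comp hA)
    (Primrec.nat_mul.comp (Primrec.const 2) (Primrec.list_length.comp (h.comp hA)))

theorem primrec_pow {f g : α → ℕ} (hf : Primrec f) (hg : Primrec g) :
    Primrec fun a => f a ^ g a := by
  have h : Primrec₂ fun a b : ℕ => a ^ b := Primrec₂.unpaired'.1 Nat.Primrec.pow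
  exact h.comp hf hg

theorem primrec_rowOf {k m N i c : α → ℕ} (hk : Primrec k) (hm : Primrec m) (hN : Primrec N)
    (hi : Primrec i) (hc : Primrec c) :
    Primrec fun a => rowOf (k a) (m a) (N a) (i a) (c a) :=
  Primrec.nat_mod.comp (Primrec.nat_div.comp hN (primrec_pow hk
    (Primrec.nat_add.comp (Primrec.nat_mul.comp hi hm) hc))) hk

theorem primrec_boxVar {k m N i j v : α → ℕ} (hk : Primrec k) (hm : Primrec m) (hN : Primrec N)
    (hi : Primrec i) (hj : Primrec j) (hv : Primrec v) :
    Primrec fun a => boxVar (k a) (m a) (N a) (i a) (j a) (v a) :=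
  Primrec.nat_mul.comp (Primrec.const 2) (Primrec₂.natPair.comp hv
    (Primrec.ite (Primrec.eq.comp hv (Primrec.const 0)) (Primrec₂.natPair.comp hi hj)
      (primrec_rowOf hk hm hN hi (Primrec.pred.comp hv))))

theorem primrec_var {f : α → ℕ} (hf : Primrec f) :
    Primrec fun a => ([(true, [f a])] : SPoly) :=
  Primrec.list_cons.comp (Primrec.pair (Primrec.const true)
    (Primrec.list_cons.comp hf (Primrec.const []))) (Primrec.const _)

theorem primrec_difference {f g : α → ℕ} (hf : Primrec f) (hg : Primrec g) :
    Primrec fun a => ([(true, [f a]), (false, [g a])] : SPoly) :=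
  Primrec.list_cons.comp (Primrec.pair (Primrec.const true)
    (Primrec.list_cons.comp hf (Primrec.const []))) (Primrec.list_cons.comp
      (Primrec.pair (Primrec.const false) (Primrec.list_cons.comp hg (Primrec.const [])))
      (Primrec.const []))

theorem primrec_append {A B : α → SPoly} (hA : Primrec A) (hB : Primrec B) :
    Primrec fun a => A a ++ B a := Primrec.list_append.comp hA hB

theorem primrecPred_linkOK {l : α → Link} (hl : Primrec l) : PrimrecPred fun a => (l a).OK := by
  have h2 := Primrec.snd.comp hl
  have h3 := Primrec.snd.comp h2
  have h4 := Primrec.snd.comp h3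
  have h5 := Primrec.snd.comp h4
  have h6 := Primrec.snd.comp h5
  have h7 := Primrec.snd.comp h6
  have hx (b : Bool) : Primrec fun _ : α => ([(true, [0]), (b, [])] : SPoly) := Primrec.const _
  have hle {f : α → ℕ} (hf : Primrec f) : PrimrecPred fun a => 1 ≤ f a :=
    Primrec.nat_le.comp (Primrec.const 1) hf
  exact (hle (Primrec.fst.comp hl)).and ((hle (Primrec.fst.comp h2)).and
    ((primrecPred_dom (Primrec.fst.comp h5)).and ((primrecPred_dom (Primrec.fst.comp h7)).and
    ((primrecPred_isZero (primrec_append (Primrec.fst.comp h4) (primrec_neg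
      (primrec_append (Primrec.fst.comp h5) (primrec_mul (hx false) (Primrec.fst.comp h6)))))).and
    (primrecPred_isZero (primrec_append (Primrec.fst.comp h4) (primrec_append
      (Primrec.fst.comp h7) (primrec_neg (primrec_mul (hx true) (Primrec.snd.comp h7))))))))))

theorem primrecPred_dirOK {Q : α → SPoly} {c : α → ℕ} {R : α → ℕ × SPoly} (hQ : Primrec Q)
    (hc : Primrec c) (hR : Primrec R) : PrimrecPred fun a => DirOK (Q a) (c a) (R a) := by
  have hR2 := Primrec.snd.comp hR
  have h1 : Primrec₂ fun (_ : α) (v : ℕ) => v.succ := Primrec.succ.comp Primrec.snd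
  have h2 : Primrec₂ fun (a : α) (v : ℕ) => if v = c a + 1 then 0 else v + 1 :=
    Primrec.ite (Primrec.eq.comp Primrec.snd (Primrec.succ.comp (hc.comp Primrec.fst)))
      (Primrec.const 0) (Primrec.succ.comp Primrec.snd)
  exact ((primrecPred_dom hR2).or (primrecPred_dom (primrec_neg hR2))).and
    (primrecPred_isZero (primrec_append
      (primrec_mul (primrec_const (Primrec.const true) (Primrec.fst.comp hR))
        (primrec_append (primrec_ren h1 hQ) (primrec_neg (primrec_ren h2 hQ))))
      (primrec_neg (primrec_mul (primrec_difference (Primrec.succ.comp (Primrec.succ.comp hc))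
        (Primrec.const 0)) hR2))))

theorem primrec_posGen {k n m N : α → ℕ} {ls : α → List Link} {g : α → Bool × ℕ × ℕ}
    (hk : Primrec k) (hn : Primrec n) (hm : Primrec m) (hN : Primrec N) (hls : Primrec ls)
    (hg : Primrec g) : Primrec fun a => posGen (k a) (n a) (m a) (N a) (ls a) (g a) := by
  have hi := Primrec.fst.comp (Primrec.snd.comp hg)
  have hj := Primrec.snd.comp (Primrec.snd.comp hg)
  have hl : Primrec fun a => (ls a).getD (g a).2.2 default :=
    (Primrec.list_getD (default : Link)).comp hls hj
  have hl2 := Primrec.snd.comp hl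
  have hl3 := Primrec.snd.comp hl2
  have hb := Primrec.fst.comp hl3
  refine Primrec.ite (Primrec.eq.comp (Primrec.fst.comp hg) (Primrec.const true))
    (primrec_ren ?_ (Primrec.fst.comp (Primrec.snd.comp hl3))) ?_
  · exact primrec_boxVar (hk.comp Primrec.fst) (hm.comp Primrec.fst) (hN.comp Primrec.fst)
      (hi.comp Primrec.fst) (hj.comp Primrec.fst) Primrec.snd
  · exact primrec_append (primrec_mul (primrec_const (Primrec.const true) (Primrec.fst.comp hl))
        (primrec_var (Primrec.succ.comp (Primrec.nat_mul.comp (Primrec.const 2)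
          (Primrec.nat_add.comp (Primrec.nat_mul.comp hi hn) hj)))))
      (primrec_append (primrec_neg (primrec_const (Primrec.fst.comp hb) (Primrec.snd.comp hb)))
        (primrec_neg (primrec_mul (primrec_const (Primrec.const true) (Primrec.fst.comp hl2))
          (primrec_var (primrec_boxVar hk hm hN hi hj (Primrec.const 0))))))

theorem primrecPred_posCheck {k n m N : α → ℕ} {pI : α → SPoly} {z : α → PosCert}
    (hk : Primrec k) (hn : Primrec n) (hm : Primrec m) (hN : Primrec N) (hp : Primrec pI)
    (hz : Primrec z) : PrimrecPred fun a => PosCheck (k a) (n a) (m a) (N a) (pI a) (z a) := by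
  have hls := Primrec.fst.comp hz
  have hz2 := Primrec.snd.comp hz
  have hds := Primrec.fst.comp hz2
  have hz3 := Primrec.snd.comp hz2
  have hE := Primrec.fst.comp hz3
  have hH := Primrec.snd.comp hz3
  have hlsD {j : α × ℕ → ℕ} (hj : Primrec j) : Primrec fun a => (z a.1).1.getD (j a) default :=
    (Primrec.list_getD (default : Link)).comp (hls.comp Primrec.fst) hj
  have hdsD : Primrec fun a : α × ℕ => (z a.1).2.1.getD a.2 default :=
    (Primrec.list_getD (default : ℕ × ℕ × SPoly)).comp (hds.comp Primrec.fst) Primrec.snd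
  have hA : PrimrecPred fun a => ∀ j < n a, ((z a).1.getD j default).OK :=
    PrimrecPred.forall_lt_of (primrecPred_linkOK (hlsD Primrec.snd)) hn
  have hB : PrimrecPred fun a => ∀ c < m a, ((z a).2.1.getD c default).1 < n a ∧
      DirOK ((z a).1.getD ((z a).2.1.getD c default).1 default).poly c
        ((z a).2.1.getD c default).2 :=
    PrimrecPred.forall_lt_of ((Primrec.nat_lt.comp (Primrec.fst.comp hdsD)
      (hn.comp Primrec.fst)).and (primrecPred_dirOK (Primrec.fst.comp (Primrec.snd.comp
        (Primrec.snd.comp (Primrec.snd.comp (hlsD (Primrec.fst.comp hdsD))))))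
        Primrec.snd (Primrec.snd.comp hdsD))) hm
  have hC : PrimrecPred fun a => ∀ h ∈ (z a).2.2.2, h.2.2.1 < k a ∧ h.2.2.2 < n a := by
    refine PrimrecPred.forall_mem_of (R := fun a (h : SPoly × Bool × ℕ × ℕ) =>
      h.2.2.1 < k a ∧ h.2.2.2 < n a) ?_ hH
    have h2 : Primrec fun q : α × (SPoly × Bool × ℕ × ℕ) => q.2.2.2 :=
      Primrec.snd.comp (Primrec.snd.comp Primrec.snd)
    exact (Primrec.nat_lt.comp (Primrec.fst.comp h2) (hk.comp Primrec.fst)).and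
      (Primrec.nat_lt.comp (Primrec.snd.comp h2) (hn.comp Primrec.fst))
  have hr : Primrec₂ fun (_ : α) (v : ℕ) => 2 * v :=
    Primrec.nat_mul.comp (Primrec.const 2) Primrec.snd
  have hr' : Primrec₂ fun (_ : α) (v : ℕ) => 2 * v + 1 := Primrec.succ.comp hr
  have hD : Primrec fun a => (z a).2.2.2.flatMap fun h =>
      mul h.1 (posGen (k a) (n a) (m a) (N a) (z a).1 h.2) :=
    Primrec.list_flatMap hH (primrec_mul (Primrec.fst.comp Primrec.snd)
      (primrec_posGen (hk.comp Primrec.fst) (hn.comp Primrec.fst) (hm.comp Primrec.fst)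
        (hN.comp Primrec.fst) (hls.comp Primrec.fst) (Primrec.snd.comp Primrec.snd)))
  exact hA.and (hB.and ((primrecPred_dom hE).and (hC.and (primrecPred_isZero (primrec_append
    (primrec_mul (primrec_ren hr hE) (primrec_ren hr' hp)) (primrec_neg hD))))))

theorem primrec_gridVar {u : α → List ℕ} {j : α → ℕ} (hu : Primrec u) (hj : Primrec j) :
    Primrec fun a => gridVar (u a) (j a) :=
  Primrec.encode.comp (Primrec.sumInl.comp (Primrec.pair hu hj))

theorem primrec_lineVar {u : α → List ℕ × ℕ × ℕ} (hu : Primrec u) :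
    Primrec fun a => lineVar (u a) :=
  Primrec.encode.comp (Primrec.sumInr.comp hu)

theorem primrec_rowLabel {k m N i : α → ℕ} {v : α → List (List ℕ)} (hk : Primrec k)
    (hm : Primrec m) (hN : Primrec N) (hv : Primrec v) (hi : Primrec i) :
    Primrec fun a => rowLabel (k a) (m a) (N a) (v a) (i a) :=
  Primrec.list_map (Primrec.list_range.comp hm) ((Primrec.list_getD 0).comp
    ((Primrec.list_getD []).comp (hv.comp Primrec.fst) Primrec.snd)
    (primrec_rowOf (hk.comp Primrec.fst) (hm.comp Primrec.fst) (hN.comp Primrec.fst)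
      (hi.comp Primrec.fst) Primrec.snd))

theorem primrec_lineLabel {m c e : α → ℕ} {u : α → List ℕ} (hm : Primrec m) (hu : Primrec u)
    (hc : Primrec c) (he : Primrec e) : Primrec fun a => lineLabel (m a) (u a) (c a) (e a) :=
  Primrec.list_map (Primrec.list_range.comp hm)
    (Primrec.ite (Primrec.eq.comp Primrec.snd (hc.comp Primrec.fst)) (he.comp Primrec.fst)
      ((Primrec.list_getD 0).comp (hu.comp Primrec.fst) Primrec.snd))

theorem primrec_distSq {n : α → ℕ} {u u' : α → List ℕ} (hn : Primrec n) (hu : Primrec u)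
    (hu' : Primrec u') : Primrec fun a => distSq (n a) (u a) (u' a) := by
  have h : Primrec fun q : α × ℕ =>
      ([(true, [gridVar (u q.1) q.2]), (false, [gridVar (u' q.1) q.2])] : SPoly) :=
    primrec_difference (primrec_gridVar (hu.comp Primrec.fst) Primrec.snd)
      (primrec_gridVar (hu'.comp Primrec.fst) Primrec.snd)
  exact Primrec.list_flatMap (Primrec.list_range.comp hn) (primrec_mul h h)

theorem primrec_negGen {k n m N : α → ℕ} {pI : α → SPoly}
    {g : α → List (List ℕ) ⊕ (List ℕ × ℕ × ℕ)} (hk : Primrec k) (hn : Primrec n)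
    (hm : Primrec m) (hN : Primrec N) (hp : Primrec pI) (hg : Primrec g) :
    Primrec fun a => negGen (k a) (n a) (m a) (N a) (pI a) (g a) := by
  have h1 : Primrec₂ fun (a : α) (v : List (List ℕ)) =>
      ren (fun e => gridVar (rowLabel (k a) (m a) (N a) v (e / n a)) (e % n a)) (pI a) := by
    refine primrec_ren ?_ (hp.comp Primrec.fst)
    have ha : Primrec fun q : (α × List (List ℕ)) × ℕ => q.1.1 := Primrec.fst.comp Primrec.fst
    exact primrec_gridVar (primrec_rowLabel (hk.comp ha) (hm.comp ha) (hN.comp ha)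
      (Primrec.snd.comp Primrec.fst) (Primrec.nat_div.comp Primrec.snd (hn.comp ha)))
      (Primrec.nat_mod.comp Primrec.snd (hn.comp ha))
  have h2 : Primrec₂ fun (a : α) (u : List ℕ × ℕ × ℕ) =>
      if u.2.1 < m a ∧ u.2.2 ≠ u.1.getD u.2.1 0 then
        mul [(true, [lineVar u])] (distSq (n a) u.1 (lineLabel (m a) u.1 u.2.1 u.2.2)) ++
          const false 1 else [] := by
    have hm' : Primrec fun q : α × (List ℕ × ℕ × ℕ) => m q.1 := hm.comp Primrec.fst
    have hn' : Primrec fun q : α × (List ℕ × ℕ × ℕ) => n q.1 := hn.comp Primrec.fst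
    have hu1 : Primrec fun q : α × (List ℕ × ℕ × ℕ) => q.2.1 := Primrec.fst.comp Primrec.snd
    have hu2 : Primrec fun q : α × (List ℕ × ℕ × ℕ) => q.2.2.1 :=
      Primrec.fst.comp (Primrec.snd.comp Primrec.snd)
    have hu3 : Primrec fun q : α × (List ℕ × ℕ × ℕ) => q.2.2.2 :=
      Primrec.snd.comp (Primrec.snd.comp Primrec.snd)
    exact Primrec.ite ((Primrec.nat_lt.comp hu2 hm').and
        (Primrec.eq.comp hu3 ((Primrec.list_getD 0).comp hu1 hu2)).not)
      (primrec_append (primrec_mul (primrec_var (primrec_lineVar Primrec.snd))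
        (primrec_distSq hn' hu1 (primrec_lineLabel hm' hu1 hu2 hu3))) (Primrec.const _))
      (Primrec.const [])
  refine (Primrec.sumCasesOn hg h1 h2).of_eq fun a => ?_
  rcases h : g a with v | u <;> rfl

theorem primrecPred_negCheck {k n m N : α → ℕ} {pI : α → SPoly} {z : α → NegCert}
    (hk : Primrec k) (hn : Primrec n) (hm : Primrec m) (hN : Primrec N) (hp : Primrec pI)
    (hz : Primrec z) : PrimrecPred fun a => NegCheck (k a) (n a) (m a) (N a) (pI a) (z a) := by
  refine primrecPred_isZero (primrec_append (primrec_const (Primrec.const true)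
    (Primrec.succ.comp (Primrec.fst.comp hz))) (primrec_append
    (Primrec.list_flatMap (Primrec.fst.comp (Primrec.snd.comp hz))
      (primrec_mul Primrec.snd Primrec.snd))
    (Primrec.list_flatMap (Primrec.snd.comp (Primrec.snd.comp hz))
      (primrec_mul (Primrec.fst.comp Primrec.snd) (primrec_negGen (hk.comp Primrec.fst)
        (hn.comp Primrec.fst) (hm.comp Primrec.fst) (hN.comp Primrec.fst) (hp.comp Primrec.fst)
        (Primrec.snd.comp Primrec.snd))))))

end SPoly
end PrimrecChecks

section ComputableCodes

theorem Computable.list_map_fun {α β : Type*} [Primcodable α] [Primcodable β] {f : α → β}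
    (hf : Computable f) : Computable fun l : List α => l.map f := by
  have h1 : Computable fun l : List α => (Nat.rec [] (fun i r => Option.casesOn l[i]? r
      fun a => r ++ [f a]) l.length : List β) := by
    refine Computable.nat_rec (σ := List β) (h := fun l p => Option.casesOn l[p.1]? p.2
      fun a => p.2 ++ [f a]) Computable.list_length (Computable.const []) ?_
    exact Computable.option_casesOn (Computable.list_getElem?.comp Computable.fst
      (Computable.fst.comp Computable.snd)) (Computable.snd.comp Computable.snd)
      (Computable.list_concat.comp (Computable.snd.comp (Computable.snd.comp Computable.fst))
        (hf.comp Computable.snd))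
  have h2 : ∀ (l : List α) (n : ℕ), n ≤ l.length → (Nat.rec [] (fun i r =>
      Option.casesOn l[i]? r fun a => r ++ [f a]) n : List β) = (l.take n).map f := by
    intro l n
    induction n with
    | zero => simp
    | succ n ih =>
      intro hn
      have hn' : l[n]? = some l[n] := List.getElem?_eq_getElem hn
      rw [List.take_add_one, List.map_append, ← ih (by omega)]
      simp only [hn']
      rfl
  exact h1.of_eq fun l => by rw [h2 l _ le_rfl, List.take_length]

namespace SPoly

theorem computable_codePoly : Computable₂ codePoly := by
  have h1 : Computable fun c : PolyCode => c.map fun e => (ratData e.1, e.2) :=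
    Computable.list_map_fun ((computable_ratData.comp Computable.fst).pair Computable.snd)
  have hden : Primrec fun l : List ((Bool × ℕ × ℕ) × List ℕ) =>
      l.foldr (fun e s => e.1.2.2 * s) 1 :=
    Primrec.list_foldr (h := fun _ (p : ((Bool × ℕ × ℕ) × List ℕ) × ℕ) => p.1.1.2.2 * p.2)
      Primrec.id (Primrec.const 1)
      (Primrec.nat_mul.comp (Primrec.snd.comp (Primrec.snd.comp (Primrec.fst.comp
        (Primrec.fst.comp Primrec.snd)))) (Primrec.snd.comp Primrec.snd))
  have hmon : Primrec₂ codeMonomial :=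
    Primrec.list_flatMap (Primrec.list_range.comp Primrec.fst) (Primrec.list_map
      (Primrec.list_range.comp ((Primrec.list_getD 0).comp (Primrec.snd.comp Primrec.fst)
        Primrec.snd)) (Primrec.snd.comp Primrec.fst))
  have h2 : Primrec fun q : ℕ × List ((Bool × ℕ × ℕ) × List ℕ) => q.2.flatMap fun e =>
      (List.range (e.1.2.1 * (q.2.foldr (fun e s => e.1.2.2 * s) 1 / e.1.2.2))).map fun _ =>
        (e.1.1, codeMonomial q.1 e.2) := by
    have he : Primrec fun p : (ℕ × List ((Bool × ℕ × ℕ) × List ℕ)) ×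
        ((Bool × ℕ × ℕ) × List ℕ) => p.2.1 := Primrec.fst.comp Primrec.snd
    have he2 := Primrec.snd.comp he
    refine Primrec.list_flatMap Primrec.snd (Primrec.list_map (Primrec.list_range.comp
      (Primrec.nat_mul.comp (Primrec.fst.comp he2) (Primrec.nat_div.comp
        (hden.comp (Primrec.snd.comp Primrec.fst)) (Primrec.snd.comp he2)))) ?_)
    exact Primrec.pair ((Primrec.fst.comp he).comp Primrec.fst)
      (hmon.comp (Primrec.fst.comp (Primrec.fst.comp Primrec.fst))
        (Primrec.snd.comp (Primrec.snd.comp Primrec.fst)))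
  refine (h2.to_comp.comp (Computable.fst.pair (h1.comp Computable.snd))).of_eq fun q => ?_
  rw [codePoly, codeDen, List.flatMap_map, List.foldr_map]

end SPoly
end ComputableCodes

section Decision

open Cardinal

theorem exists_grid_bound {κ : Cardinal.{0}} (hκ : ℵ₀ ≤ κ) (hκc : κ < continuum) :
    ∃ B : ℕ → ℕ, Primrec B ∧ ∀ k, (∀ m ≤ B k, Order.succ^[m] κ ≤ continuum) ∧
      ∀ T : Type, #T ≤ continuum → SeparatedColoring κ T (B k) k := by
  classical
  by_cases h : ∃ m, continuum ≤ Order.succ^[m] κ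
  · refine ⟨fun _ => Nat.find h, Primrec.const _, fun k => ⟨fun m hm => ?_, fun T hT => ?_⟩⟩
    · rcases m with _ | m
      · exact hκc.le
      · rw [Function.iterate_succ_apply']
        exact Order.succ_le_of_lt (not_le.1 (Nat.find_min h hm))
    · exact separatedColoring_of_le hκ k (hT.trans (Nat.find_spec h))
  · push Not at h
    exact ⟨fun k => k * k, Primrec.nat_mul.comp Primrec.id Primrec.id,
      fun k => ⟨fun m _ => (h m).le, fun T _ => separatedColoring_mul_self hκ T k⟩⟩

theorem avoidable_of_continuum_le {κ : Cardinal.{0}} (hκ : continuum ≤ κ) {k n : ℕ} (hk : 2 ≤ k)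
    (p : MvPolynomial (Fin k × Fin n) ℚ) : Avoidable κ p := by
  refine ⟨Fin n → ℝ, id, ?_, fun a ha _ => ⟨⟨0, by omega⟩, ⟨1, by omega⟩, fun h => ?_⟩⟩
  · refine le_trans ?_ hκ
    rw [mk_pi, prod_const]
    simp only [lift_id, mk_real, mk_fin]
    exact_mod_cast power_nat_le aleph0_le_continuum
  · simpa using ha h

theorem exists_localGrid_of_not_avoidableOver {K : Type} [Field K] [Algebra ℚ K]
    (hK : #K ≤ continuum) {κ : Cardinal.{0}} (hκ : ℵ₀ ≤ κ) {B k n : ℕ} (hk : 0 < k)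
    (hB : ∀ T : Type, #T ≤ continuum → SeparatedColoring κ T B k)
    {p : MvPolynomial (Fin k × Fin n) ℚ} (hp : ¬ AvoidableOver K κ p) :
    ∃ m ≤ B, ∃ P : Fin k → Fin m → Fin k, Function.Injective P ∧ LocalGrid K p m P := by
  have : CharZero K := algebraRat.charZero K
  obtain ⟨e, -⟩ := exists_ringHom_complex hK
  obtain ⟨T, x, hx⟩ := exists_isTranscendenceBasis' ℚ K
  exact exists_localGrid hκ e.toRatAlgHom hx ⟨0, hk⟩
    (hB T ((mk_le_of_injective hx.1.injective).trans hK)) p hp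

namespace SPoly

theorem exists_rowOf {k m : ℕ} (P : Fin k → Fin m → Fin k) :
    ∃ N < k ^ (k * m), ∀ i c, (P i c : ℕ) = rowOf k m N i c := by
  let f : Fin (k * m) → Fin k := fun t => P (finProdFinEquiv.symm t).1 (finProdFinEquiv.symm t).2
  refine ⟨finFunctionFinEquiv f, (finFunctionFinEquiv f).2, fun i c => ?_⟩
  have h1 : (finFunctionFinEquiv.symm (finFunctionFinEquiv f) (finProdFinEquiv (i, c)) : ℕ) =
      P i c := by
    rw [Equiv.symm_apply_apply]
    change (P (finProdFinEquiv.symm (finProdFinEquiv (i, c))).1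
      (finProdFinEquiv.symm (finProdFinEquiv (i, c))).2 : ℕ) = P i c
    rw [Equiv.symm_apply_apply]
  rw [← h1, finFunctionFinEquiv_symm_apply_val, rowOf]
  simp [add_comm, mul_comm]

/-- The rows of the pattern coded by `N` are distinct. -/
def RowsInjective (k m N : ℕ) : Prop :=
  ∀ i < k, ∀ j < k, (∀ c < m, rowOf k m N i c = rowOf k m N j c) → i = j

theorem rowsInjective_iff {k m N : ℕ} {P : Fin k → Fin m → Fin k}
    (hP : ∀ i c, (P i c : ℕ) = rowOf k m N i c) : RowsInjective k m N ↔ Function.Injective P := by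
  constructor
  · intro h i j hij
    refine Fin.ext (h i i.2 j j.2 fun c hc => ?_)
    rw [← hP i ⟨c, hc⟩, ← hP j ⟨c, hc⟩, hij]
  · intro h i hi j hj hij
    refine congrArg Fin.val (@h ⟨i, hi⟩ ⟨j, hj⟩ (funext fun c => Fin.ext ?_))
    rw [hP, hP]
    exact hij c c.2

theorem exists_pattern {k : ℕ} (hk : 0 < k) (m N : ℕ) :
    ∃ P : Fin k → Fin m → Fin k, ∀ i c, (P i c : ℕ) = rowOf k m N i c :=
  ⟨fun i c => ⟨rowOf k m N i c, Nat.mod_lt _ hk⟩, fun _ _ => rfl⟩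

theorem not_avoidable_of_posCheck {κ : Cardinal.{0}} (hκ : ℵ₀ ≤ κ) {k n m N : ℕ} (hk : 0 < k)
    (hm : Order.succ^[m] κ ≤ continuum) {c : PolyCode} (hN : RowsInjective k m N) {z : PosCert}
    (hz : PosCheck k n m N (codePoly (k * n) c) z) : ¬ Avoidable κ (decodePoly k n c) := by
  obtain ⟨P, hP⟩ := exists_pattern hk m N
  refine GridOver.not_avoidableOver (hz.gridOver hP) ((rowsInjective_iff hP).1 hN) hκ (hm.trans ?_)
  rw [mk_Icc_real (by norm_num)]

theorem exists_posCheck_of_not_avoidableOver {F : Type} [Field F] [Algebra ℚ F]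
    (hF : #F ≤ continuum) (hs : ¬ IsSumSq (-1 : F)) {κ : Cardinal.{0}} (hκ : ℵ₀ ≤ κ) {B k n : ℕ}
    (hk : 0 < k) (hB : ∀ T : Type, #T ≤ continuum → SeparatedColoring κ T B k) {c : PolyCode}
    (hp : ¬ AvoidableOver F κ (decodePoly k n c)) :
    ∃ m ≤ B, ∃ N < k ^ (k * m), RowsInjective k m N ∧
      ∃ z, PosCheck k n m N (codePoly (k * n) c) z := by
  obtain ⟨m, hm, P, hP, h⟩ := exists_localGrid_of_not_avoidableOver hF hκ hk hB hp
  obtain ⟨N, hN, hPN⟩ := exists_rowOf P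
  exact ⟨m, hm, N, hN, (rowsInjective_iff hPN).2 hP, exists_posCheck hPN (h.transfer hs)⟩

theorem not_avoidable_iff {κ : Cardinal.{0}} (hκ : ℵ₀ ≤ κ) {B k n : ℕ} (hk : 0 < k)
    (hB1 : ∀ m ≤ B, Order.succ^[m] κ ≤ continuum)
    (hB2 : ∀ T : Type, #T ≤ continuum → SeparatedColoring κ T B k) (c : PolyCode) :
    ¬ Avoidable κ (decodePoly k n c) ↔ ∃ w : (ℕ × ℕ) × PosCert, w.1.1 ≤ B ∧
      RowsInjective k w.1.1 w.1.2 ∧ PosCheck k n w.1.1 w.1.2 (codePoly (k * n) c) w.2 := by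
  constructor
  · intro h
    have hs : ¬ IsSumSq (-1 : ℝ) := fun h => absurd h.nonneg (by norm_num)
    obtain ⟨m, hm, N, -, hN, z, hz⟩ :=
      exists_posCheck_of_not_avoidableOver (F := ℝ) mk_real.le hs hκ hk hB2 h
    exact ⟨((m, N), z), hm, hN, hz⟩
  · rintro ⟨⟨⟨m, N⟩, z⟩, hm, hN, hz⟩
    exact not_avoidable_of_posCheck hκ hk (hB1 m hm) hN hz

theorem avoidable_iff {κ : Cardinal.{0}} (hκ : ℵ₀ ≤ κ) {B k n : ℕ} (hk : 0 < k)
    (hB1 : ∀ m ≤ B, Order.succ^[m] κ ≤ continuum)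
    (hB2 : ∀ T : Type, #T ≤ continuum → SeparatedColoring κ T B k) (c : PolyCode) :
    Avoidable κ (decodePoly k n c) ↔ ∃ L : List NegCert, ∀ m < B + 1, ∀ N < k ^ (k * m),
      RowsInjective k m N → ∃ z ∈ L, NegCheck k n m N (codePoly (k * n) c) z := by
  classical
  have hs : ¬ IsSumSq (-1 : ℝ) := fun h => absurd h.nonneg (by norm_num)
  constructor
  · intro h
    have h1 : ∀ m ≤ B, ∀ N, RowsInjective k m N →
        ∃ z, NegCheck k n m N (codePoly (k * n) c) z := by
      intro m hm N hN
      by_contra! hno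
      obtain ⟨P, hP⟩ := exists_pattern hk m N
      obtain ⟨F, _, _, hFs, hFc, hF⟩ := exists_gridOver_field (X := ℝ) mk_real.le hP hno
      have hav := hF.not_avoidableOver ((rowsInjective_iff hP).1 hN) hκ
        ((hB1 m hm).trans mk_real.ge)
      obtain ⟨m', hm', N', -, hN', z, hz⟩ :=
        exists_posCheck_of_not_avoidableOver hFc hFs hκ hk hB2 hav
      exact not_avoidable_of_posCheck hκ hk (hB1 m' hm') hN' hz h
    have h2 : ∀ q : ℕ × ℕ, ∃ z, q.1 ≤ B → RowsInjective k q.1 q.2 →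
        NegCheck k n q.1 q.2 (codePoly (k * n) c) z := by
      intro q
      by_cases hq : q.1 ≤ B ∧ RowsInjective k q.1 q.2
      · obtain ⟨z, hz⟩ := h1 q.1 hq.1 q.2 hq.2
        exact ⟨z, fun _ _ => hz⟩
      · exact ⟨default, fun h3 h4 => absurd ⟨h3, h4⟩ hq⟩
    choose z hz using h2
    refine ⟨(List.range (B + 1)).flatMap fun m => (List.range (k ^ (k * m))).map fun N => z (m, N),
      fun m hm N hN hinj => ⟨z (m, N), ?_, hz (m, N) (Nat.le_of_lt_succ hm) hinj⟩⟩
    simp only [List.mem_flatMap, List.mem_map, List.mem_range]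
    exact ⟨m, hm, N, hN, rfl⟩
  · rintro ⟨L, hL⟩
    by_contra hav
    obtain ⟨m, hm, N, hN, hinj, z, hz⟩ :=
      exists_posCheck_of_not_avoidableOver (F := ℝ) mk_real.le hs hκ hk hB2 hav
    obtain ⟨z', -, hz'⟩ := hL m (Nat.lt_succ_of_le hm) N hN hinj
    obtain ⟨P, hP⟩ := exists_pattern hk m N
    have : Infinite (Set.Icc (-1 : ℝ) 1) := (Set.Icc_infinite (by norm_num)).to_subtype
    exact not_negCheck hP (hz.gridOver hP) z' hz'

end SPoly
end Decision

section DecisionProcedure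

open Cardinal

theorem REPred.exists_of_computablePred {α β : Type*} [Primcodable α] [Primcodable β]
    {R : α → β → Prop} (hR : ComputablePred fun q : α × β => R q.1 q.2) :
    REPred fun a => ∃ b, R a b := by
  obtain ⟨f, hf, hRf⟩ := ComputablePred.computable_iff.1 hR
  have hR' : ∀ a b, R a b ↔ f (a, b) = true := fun a b => iff_of_eq (congrFun hRf (a, b))
  have h1 : Computable₂ fun (a : α) (n : ℕ) =>
      (Option.casesOn (Encodable.decode (α := β) n) false fun b => f (a, b) : Bool) :=
    Computable.option_casesOn (Computable.decode.comp Computable.snd) (Computable.const false)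
      (hf.comp ((Computable.fst.comp Computable.fst).pair Computable.snd))
  refine (Partrec.rfind h1.partrec₂).dom_re.of_eq fun a => ?_
  rw [Nat.rfind_dom]
  constructor
  · rintro ⟨n, hn, -⟩
    have h2 := (Part.mem_some_iff.1 hn).symm
    rcases hb : Encodable.decode (α := β) n with _ | b
    · simp [hb] at h2
    · simp only [hb] at h2
      exact ⟨b, (hR' a b).2 h2⟩
  · rintro ⟨b, hb⟩
    refine ⟨Encodable.encode b, Part.mem_some_iff.2 ?_, fun _ => trivial⟩
    simp only [Encodable.encodek]
    exact ((hR' a b).1 hb).symm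

theorem PrimrecPred.computablePred_comp {α β : Type*} [Primcodable α] [Primcodable β]
    {p : β → Prop} (hp : PrimrecPred p) {f : α → β} (hf : Computable f) :
    ComputablePred fun a => p (f a) := by
  obtain ⟨g, hg, hpg⟩ := ComputablePred.computable_iff.1 hp.computablePred
  exact ComputablePred.computable_iff.2 ⟨fun a => g (f a), hg.comp hf,
    funext fun a => congrFun hpg (f a)⟩

namespace SPoly

theorem primrecPred_rowsInjective {α : Type*} [Primcodable α] {k m N : α → ℕ} (hk : Primrec k)
    (hm : Primrec m) (hN : Primrec N) :
    PrimrecPred fun a => RowsInjective (k a) (m a) (N a) := by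
  have h2 : PrimrecRel fun (q : (α × ℕ) × ℕ) (c : ℕ) => rowOf (k q.1.1) (m q.1.1) (N q.1.1) q.1.2 c
      = rowOf (k q.1.1) (m q.1.1) (N q.1.1) q.2 c := by
    have ha : Primrec fun r : ((α × ℕ) × ℕ) × ℕ => r.1.1.1 :=
      Primrec.fst.comp (Primrec.fst.comp Primrec.fst)
    have hi : Primrec fun r : ((α × ℕ) × ℕ) × ℕ => r.1.1.2 :=
      Primrec.snd.comp (Primrec.fst.comp Primrec.fst)
    have hj : Primrec fun r : ((α × ℕ) × ℕ) × ℕ => r.1.2 := Primrec.snd.comp Primrec.fst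
    exact Primrec.eq.comp
      (primrec_rowOf (hk.comp ha) (hm.comp ha) (hN.comp ha) hi Primrec.snd)
      (primrec_rowOf (hk.comp ha) (hm.comp ha) (hN.comp ha) hj Primrec.snd)
  have h3 : PrimrecPred fun q : (α × ℕ) × ℕ => (∀ c < m q.1.1, rowOf (k q.1.1) (m q.1.1) (N q.1.1)
      q.1.2 c = rowOf (k q.1.1) (m q.1.1) (N q.1.1) q.2 c) → q.1.2 = q.2 :=
    (PrimrecPred.forall_lt_of h2 (hm.comp (Primrec.fst.comp Primrec.fst))).imp
      (Primrec.eq.comp (Primrec.snd.comp Primrec.fst) Primrec.snd)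
  have h4 : PrimrecPred fun q : α × ℕ => ∀ j < k q.1, (∀ c < m q.1,
      rowOf (k q.1) (m q.1) (N q.1) q.2 c = rowOf (k q.1) (m q.1) (N q.1) j c) → q.2 = j :=
    PrimrecPred.forall_lt_of (R := fun (q : α × ℕ) j => (∀ c < m q.1,
      rowOf (k q.1) (m q.1) (N q.1) q.2 c = rowOf (k q.1) (m q.1) (N q.1) j c) → q.2 = j)
      h3 (hk.comp Primrec.fst)
  exact PrimrecPred.forall_lt_of (R := fun a i => ∀ j < k a, (∀ c < m a,
    rowOf (k a) (m a) (N a) i c = rowOf (k a) (m a) (N a) j c) → i = j) h4 hk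

theorem primrecPred_posCheck_bounded {B : ℕ → ℕ} (hB : Primrec B) :
    PrimrecPred fun q : (ℕ × ℕ × SPoly) × ((ℕ × ℕ) × PosCert) => ¬ 0 < q.1.1 ∨
      (q.2.1.1 ≤ B q.1.1 ∧ RowsInjective q.1.1 q.2.1.1 q.2.1.2 ∧
        PosCheck q.1.1 q.1.2.1 q.2.1.1 q.2.1.2 q.1.2.2 q.2.2) := by
  have hk : Primrec fun q : (ℕ × ℕ × SPoly) × ((ℕ × ℕ) × PosCert) => q.1.1 :=
    Primrec.fst.comp Primrec.fst
  have hn : Primrec fun q : (ℕ × ℕ × SPoly) × ((ℕ × ℕ) × PosCert) => q.1.2.1 :=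
    Primrec.fst.comp (Primrec.snd.comp Primrec.fst)
  have hp : Primrec fun q : (ℕ × ℕ × SPoly) × ((ℕ × ℕ) × PosCert) => q.1.2.2 :=
    Primrec.snd.comp (Primrec.snd.comp Primrec.fst)
  have hm : Primrec fun q : (ℕ × ℕ × SPoly) × ((ℕ × ℕ) × PosCert) => q.2.1.1 :=
    Primrec.fst.comp (Primrec.fst.comp Primrec.snd)
  have hN : Primrec fun q : (ℕ × ℕ × SPoly) × ((ℕ × ℕ) × PosCert) => q.2.1.2 :=
    Primrec.snd.comp (Primrec.fst.comp Primrec.snd)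
  exact (Primrec.nat_lt.comp (Primrec.const 0) hk).not.or
    ((Primrec.nat_le.comp hm (hB.comp hk)).and ((primrecPred_rowsInjective hk hm hN).and
      (primrecPred_posCheck hk hn hm hN hp (Primrec.snd.comp Primrec.snd))))

theorem primrecPred_negCheck_bounded {B : ℕ → ℕ} (hB : Primrec B) :
    PrimrecPred fun q : (ℕ × ℕ × SPoly) × List NegCert => 0 < q.1.1 ∧
      ∀ m < B q.1.1 + 1, ∀ N < q.1.1 ^ (q.1.1 * m), RowsInjective q.1.1 m N →
        ∃ z ∈ q.2, NegCheck q.1.1 q.1.2.1 m N q.1.2.2 z := by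
  have h1 : PrimrecRel fun (r : (((ℕ × ℕ × SPoly) × List NegCert) × ℕ) × ℕ) (z : NegCert) =>
      ¬ NegCheck r.1.1.1.1 r.1.1.1.2.1 r.1.2 r.2 r.1.1.1.2.2 z := by
    have hq : Primrec fun t : ((((ℕ × ℕ × SPoly) × List NegCert) × ℕ) × ℕ) × NegCert =>
      t.1.1.1.1 := Primrec.fst.comp (Primrec.fst.comp (Primrec.fst.comp Primrec.fst))
    exact (primrecPred_negCheck (Primrec.fst.comp hq) (Primrec.fst.comp (Primrec.snd.comp hq))
      (Primrec.snd.comp (Primrec.fst.comp Primrec.fst)) (Primrec.snd.comp Primrec.fst)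
      (Primrec.snd.comp (Primrec.snd.comp hq)) Primrec.snd).not
  have hq : Primrec fun r : (((ℕ × ℕ × SPoly) × List NegCert) × ℕ) × ℕ => r.1.1 :=
    Primrec.fst.comp Primrec.fst
  have h2 : PrimrecPred fun r : (((ℕ × ℕ × SPoly) × List NegCert) × ℕ) × ℕ =>
      RowsInjective r.1.1.1.1 r.1.2 r.2 → ∃ z ∈ r.1.1.2,
        NegCheck r.1.1.1.1 r.1.1.1.2.1 r.1.2 r.2 r.1.1.1.2.2 z := by
    refine PrimrecPred.imp (primrecPred_rowsInjective (Primrec.fst.comp (Primrec.fst.comp hq))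
      (Primrec.snd.comp Primrec.fst) Primrec.snd)
      ((PrimrecPred.forall_mem_of h1 (Primrec.snd.comp hq)).not.of_eq fun r => ?_)
    push Not
    rfl
  have h3 : PrimrecPred fun r : ((ℕ × ℕ × SPoly) × List NegCert) × ℕ =>
      ∀ N < r.1.1.1 ^ (r.1.1.1 * r.2), RowsInjective r.1.1.1 r.2 N →
        ∃ z ∈ r.1.2, NegCheck r.1.1.1 r.1.1.2.1 r.2 N r.1.1.2.2 z := by
    have hk : Primrec fun r : ((ℕ × ℕ × SPoly) × List NegCert) × ℕ => r.1.1.1 :=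
      Primrec.fst.comp (Primrec.fst.comp Primrec.fst)
    exact PrimrecPred.forall_lt_of (R := fun (r : ((ℕ × ℕ × SPoly) × List NegCert) × ℕ) N =>
      RowsInjective r.1.1.1 r.2 N → ∃ z ∈ r.1.2, NegCheck r.1.1.1 r.1.1.2.1 r.2 N r.1.1.2.2 z)
      h2 (primrec_pow hk (Primrec.nat_mul.comp hk Primrec.snd))
  have hk : Primrec fun q : (ℕ × ℕ × SPoly) × List NegCert => q.1.1 :=
    Primrec.fst.comp Primrec.fst
  exact (Primrec.nat_lt.comp (Primrec.const 0) hk).and (PrimrecPred.forall_lt_of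
    (R := fun (q : (ℕ × ℕ × SPoly) × List NegCert) m => ∀ N < q.1.1 ^ (q.1.1 * m),
      RowsInjective q.1.1 m N → ∃ z ∈ q.2, NegCheck q.1.1 q.1.2.1 m N q.1.2.2 z)
    h3 (Primrec.succ.comp (hB.comp hk)))

end SPoly

theorem computablePred_avoidable {κ : Cardinal.{0}} (hκ : ℵ₀ ≤ κ) (hκc : κ < continuum) :
    ComputablePred fun q : ℕ × ℕ × PolyCode => 0 < q.1 ∧ Avoidable κ (decodePoly q.1 q.2.1 q.2.2) := by
  obtain ⟨B, hB, hB'⟩ := exists_grid_bound hκ hκc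
  have hc {β : Type} [Primcodable β] : Computable fun q : (ℕ × ℕ × PolyCode) × β =>
      ((q.1.1, q.1.2.1, SPoly.codePoly (q.1.1 * q.1.2.1) q.1.2.2), q.2) := by
    have hk : Computable fun q : (ℕ × ℕ × PolyCode) × β => q.1.1 :=
      Computable.fst.comp Computable.fst
    have hn : Computable fun q : (ℕ × ℕ × PolyCode) × β => q.1.2.1 :=
      Computable.fst.comp (Computable.snd.comp Computable.fst)
    exact (hk.pair (hn.pair (SPoly.computable_codePoly.comp (Primrec.nat_mul.to_comp.comp hk hn)
      (Computable.snd.comp (Computable.snd.comp Computable.fst))))).pair Computable.snd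
  refine ComputablePred.computable_iff_re_compl_re'.2 ⟨?_, ?_⟩
  · refine (REPred.exists_of_computablePred (R := fun (q : ℕ × ℕ × PolyCode)
      (L : List SPoly.NegCert) => 0 < q.1 ∧ ∀ m < B q.1 + 1, ∀ N < q.1 ^ (q.1 * m),
      SPoly.RowsInjective q.1 m N → ∃ z ∈ L,
        SPoly.NegCheck q.1 q.2.1 m N (SPoly.codePoly (q.1 * q.2.1) q.2.2) z)
      ((SPoly.primrecPred_negCheck_bounded hB).computablePred_comp hc)).of_eq fun q => ?_
    by_cases hk : 0 < q.1
    · rw [SPoly.avoidable_iff hκ hk (hB' q.1).1 (hB' q.1).2]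
      simp only [hk, true_and]
    · simp only [hk, false_and, exists_false]
  · refine (REPred.exists_of_computablePred (R := fun (q : ℕ × ℕ × PolyCode)
      (w : (ℕ × ℕ) × SPoly.PosCert) => ¬ 0 < q.1 ∨ (w.1.1 ≤ B q.1 ∧
        SPoly.RowsInjective q.1 w.1.1 w.1.2 ∧ SPoly.PosCheck q.1 q.2.1 w.1.1 w.1.2
          (SPoly.codePoly (q.1 * q.2.1) q.2.2) w.2))
      ((SPoly.primrecPred_posCheck_bounded hB).computablePred_comp hc)).of_eq fun q => ?_
    by_cases hk : 0 < q.1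
    · have h := SPoly.not_avoidable_iff hκ hk (hB' q.1).1 (hB' q.1).2 (n := q.2.1) q.2.2
      simp only [hk, not_true_eq_false, false_or, true_and]
      exact h.symm
    · simp only [hk, not_false_eq_true, true_or, false_and, iff_true]
      exact ⟨((0, 0), default), trivial⟩

end DecisionProcedure

/-- For each infinite cardinal `κ`, the set of `κ`-avoidable polynomials over `ℚ`
is computable. -/
theorem avoidable_computable (κ : Cardinal.{0}) (hκ : Cardinal.aleph0 ≤ κ) :
    ∃ F : ℕ × ℕ × PolyCode → Bool, Computable F ∧
      ∀ k n : ℕ, 2 ≤ k → 1 ≤ n → ∀ c : PolyCode,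
        (F (k, n, c) = true ↔ Avoidable κ (decodePoly k n c)) := by
  rcases lt_or_ge κ Cardinal.continuum with h | h
  · obtain ⟨F, hF, hFe⟩ := ComputablePred.computable_iff.1 (computablePred_avoidable hκ h)
    refine ⟨F, hF, fun k n hk _ c => ?_⟩
    have h1 := iff_of_eq (congrFun hFe (k, n, c))
    rw [← h1]
    exact and_iff_right (by omega)
  · exact ⟨fun _ => true, Computable.const true, fun k n hk _ c =>
      iff_of_true rfl (avoidable_of_continuum_le h hk _)⟩
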